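/- If Γ is a graph of girth at least 5 on 23 vertices with 50 edges, then either (δ(Γ), Δ(Γ)) = (3,5) and Γ has an embedded S_{5,[4,4,3,3,3]} star, or (δ(Γ), Δ(Γ)) = (4,5) and Γ has an embedded S_{5,[4,4,3,3,3]} star or an embedded S_{5,[4,3,3,3,3]} star. (Here an embedded S_{5,[4,4,3,3,3]} star is a vertex of degree 5 with two neighbours of degree at least 5 and three of degree at least 4, and an embedded S_{5,[4,3,3,3,3]} star is a vertex of degree 5 with one neighbour of degree at least 5 and four of degree at least 4.) -/

import Mathlib

open SimpleGraph

/-- `Γ` has girth at least 5: every cycle has length at least 5. -/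
def GirthAtLeast5 {V : Type*} (G : SimpleGraph V) : Prop :=
  ∀ ⦃u : V⦄ (w : G.Walk u u), w.IsCycle → 5 ≤ w.length

/-- `G` has an embedded `S_{D,[e 0, …, e (D-1)]}` star: a vertex `x` of degree `D`
whose `D` neighbours can be enumerated as `y 0, …, y (D-1)` with
`deg (y i) ≥ e i + 1` for each `i`. -/
def HasEmbeddedStar {V : Type*} [Fintype V] (G : SimpleGraph V) [DecidableRel G.Adj]
    (D : ℕ) (e : Fin D → ℕ) : Prop :=
  ∃ (x : V) (y : Fin D → V), G.degree x = D ∧ Function.Injective y ∧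
    (∀ i, G.Adj x (y i)) ∧ ∀ i, e i + 1 ≤ G.degree (y i)

namespace Eng

def force {α : Type} (x : ℕ) (f : ℕ → α) : α := Nat.rec (f 0) (fun k _ => f (Nat.succ k)) x
def bcond {α : Type} (b : Bool) (t e : α) : α := Bool.rec e t b

@[simp] theorem force_eq {α : Type} (x : ℕ) (f : ℕ → α) : force x f = f x := by cases x <;> rfl
theorem bcond_eq {α : Type} (b : Bool) (t e : α) : bcond b t e = if b = true then t else e := by
  cases b <;> rfl

def lgs (s : ℕ) (k : ℕ → ℕ → ℕ) (x a : ℕ) : ℕ :=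
  force (Nat.shiftRight x s) fun y => bcond (Nat.beq y 0) (k x a) (k y (Nat.add a s))
def lg (x : ℕ) : ℕ := lgs 16 (lgs 8 (lgs 4 (lgs 2 (lgs 1 fun _ a => a)))) x 0

theorem lgs_eq (s : ℕ) (k : ℕ → ℕ → ℕ) (hk : ∀ x a, x ≠ 0 → x < 2 ^ s → k x a = a + Nat.log2 x) :
    ∀ x a, x ≠ 0 → x < 2 ^ (s + s) → lgs s k x a = a + Nat.log2 x := by
  intro x a hx hl
  simp only [lgs, force_eq, bcond_eq, Nat.beq_eq]
  change (if x >>> s = 0 then k x a else k (x >>> s) (a + s)) = _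
  rw [Nat.shiftRight_eq_div_pow]
  have hp : 0 < 2 ^ s := by positivity
  split
  · rename_i h
    rw [Nat.div_eq_zero_iff] at h
    exact hk x a hx (by omega)
  · rename_i h
    have h1 : x / 2 ^ s < 2 ^ s := by
      rw [Nat.div_lt_iff_lt_mul hp, ← pow_add]; exact hl
    rw [hk _ _ h h1, add_assoc]
    congr 1
    symm
    rw [Nat.log2_eq_iff hx]
    have h2 := (Nat.log2_eq_iff h).1 rfl
    generalize Nat.log2 (x / 2 ^ s) = l at h2
    rw [Nat.le_div_iff_mul_le hp, Nat.div_lt_iff_lt_mul hp, ← pow_add, ← pow_add] at h2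
    rw [add_comm s l]
    refine ⟨h2.1, ?_⟩
    rw [show l + s + 1 = l + 1 + s by ring]; exact h2.2

theorem lg_eq {x : ℕ} (hx : x ≠ 0) (hl : x < 2 ^ 32) : lg x = Nat.log2 x := by
  rw [lg, lgs_eq 16 _ (lgs_eq 8 _ (lgs_eq 4 _ (lgs_eq 2 _ (lgs_eq 1 _ ?_)))) x 0 hx hl, Nat.zero_add]
  intro x a h1 h2
  have : x = 1 := by omega
  subst this; show a = a + Nat.log2 1
  rw [(Nat.log2_eq_iff (by norm_num)).2 (by norm_num : 2 ^ 0 ≤ 1 ∧ 1 < 2 ^ (0 + 1))]; rfl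

def foldb (f : ℕ → ℕ → ℕ) (fuel : ℕ) : ℕ → ℕ → ℕ :=
  Nat.rec (fun _ a => a) (fun _ ih x a => bcond (Nat.beq x 0) a
    (force (lg x) fun i => force (f i a) fun b =>
      force (Nat.xor x (Nat.shiftLeft 1 i)) fun y => ih y b)) fuel

theorem top_lt {x : ℕ} (hx : x ≠ 0) : x ^^^ (1 <<< Nat.log2 x) < 2 ^ Nat.log2 x := by
  apply Nat.lt_pow_two_of_testBit
  intro j hj
  rw [Nat.testBit_xor, Nat.one_shiftLeft, Nat.testBit_two_pow]
  rcases Nat.lt_or_ge (Nat.log2 x) j with h | h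
  · have : x < 2 ^ j := lt_of_lt_of_le (Nat.lt_log2_self) (Nat.pow_le_pow_right (by norm_num) h)
    rw [Nat.testBit_lt_two_pow this]; simp; omega
  · have : Nat.log2 x = j := by omega
    subst this
    rw [Nat.testBit_log2 hx]; simp

theorem foldb_ind (f : ℕ → ℕ → ℕ) (P : ℕ → ℕ → ℕ → Prop) (h0 : ∀ a, P 0 a a)
    (hs : ∀ x a r, x ≠ 0 → P (x ^^^ (1 <<< Nat.log2 x)) (f (Nat.log2 x) a) r → P x a r) :
    ∀ fuel, fuel ≤ 32 → ∀ x a, x < 2 ^ fuel → P x a (foldb f fuel x a) := by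
  intro fuel
  induction fuel with
  | zero => intro _ x a hx; have : x = 0 := by simpa using hx
            subst this; exact h0 a
  | succ k ih =>
    intro hk x a hx
    by_cases h : x = 0
    · subst h; exact h0 a
    · have e : foldb f (k+1) x a = foldb f k (x ^^^ (1 <<< Nat.log2 x)) (f (Nat.log2 x) a) := by
        show bcond (Nat.beq x 0) a (force (lg x) fun i => force (f i a) fun b =>
          force (Nat.xor x (Nat.shiftLeft 1 i)) fun y => foldb f k y b) = _
        rw [bcond_eq, if_neg (by simpa using h)]
        simp only [force_eq]
        rw [lg_eq h (lt_of_lt_of_le hx (Nat.pow_le_pow_right (by norm_num) hk))]; rfl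
      rw [e]
      apply hs x a _ h
      apply ih (by omega)
      refine lt_of_lt_of_le (top_lt h) (Nat.pow_le_pow_right (by norm_num) ?_)
      have := (Nat.log2_lt h).2 hx
      omega

def bits (x : ℕ) : Finset ℕ := (Finset.range 31).filter (fun i => x.testBit i = true)

theorem mem_bits {x i : ℕ} : i ∈ bits x ↔ i < 31 ∧ x.testBit i = true := by simp [bits]

theorem bits_step {x : ℕ} (hx : x ≠ 0) (h : x < 2 ^ 31) :
    Nat.log2 x ∉ bits (x ^^^ (1 <<< Nat.log2 x)) ∧
    bits x = insert (Nat.log2 x) (bits (x ^^^ (1 <<< Nat.log2 x))) := by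
  have hl := (Nat.log2_lt hx).2 h
  constructor
  · rw [mem_bits, Nat.testBit_lt_two_pow (top_lt hx)]; simp
  · ext i
    rw [Finset.mem_insert, mem_bits, mem_bits, Nat.testBit_xor, Nat.one_shiftLeft, Nat.testBit_two_pow]
    by_cases hi : Nat.log2 x = i
    · subst hi; simp [hl, Nat.testBit_log2 hx]
    · simp [hi, Ne.symm hi]

theorem xor_lt31 {x : ℕ} (h : x < 2 ^ 31) (hx : x ≠ 0) : x ^^^ (1 <<< Nat.log2 x) < 2 ^ 31 :=
  lt_trans (top_lt hx) (Nat.pow_lt_pow_right (by norm_num) ((Nat.log2_lt hx).2 h))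

theorem foldb_sum (g : ℕ → ℕ) (x a : ℕ) (h : x < 2 ^ 31) :
    foldb (fun i a => Nat.add a (g i)) 31 x a = a + ∑ i ∈ bits x, g i := by
  refine foldb_ind (fun i a => Nat.add a (g i)) (fun x a r => x < 2 ^ 31 → r = a + ∑ i ∈ bits x, g i) ?_ ?_ 31 (by norm_num) x a h h
  · intro a _; simp [bits]
  · intro x a r hx ih h
    rw [ih (xor_lt31 h hx), (bits_step hx h).2, Finset.sum_insert (bits_step hx h).1]
    show a + g _ + _ = _
    ring

theorem foldb_or (g : ℕ → ℕ) (x a j : ℕ) (h : x < 2 ^ 31) :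
    (foldb (fun i a => Nat.lor a (g i)) 31 x a).testBit j = true ↔
      a.testBit j = true ∨ ∃ i ∈ bits x, (g i).testBit j = true := by
  refine foldb_ind (fun i a => Nat.lor a (g i)) (fun x a r => x < 2 ^ 31 → (r.testBit j = true ↔
      a.testBit j = true ∨ ∃ i ∈ bits x, (g i).testBit j = true)) ?_ ?_ 31 (by norm_num) x a h h
  · intro a _; simp [bits]
  · intro x a r hx ih h
    rw [ih (xor_lt31 h hx), (bits_step hx h).2]
    show (a ||| g _).testBit j = true ∨ _ ↔ _
    rw [Nat.testBit_or]
    simp only [Bool.or_eq_true, Finset.mem_insert, exists_eq_or_imp, or_assoc]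

theorem foldb_or_lt (g : ℕ → ℕ) (x a : ℕ) (ha : a < 2 ^ 31) (hg : ∀ i, g i < 2 ^ 31) (h : x < 2 ^ 31) :
    foldb (fun i a => Nat.lor a (g i)) 31 x a < 2 ^ 31 := by
  refine foldb_ind (fun i a => Nat.lor a (g i)) (fun x a r => a < 2 ^ 31 → r < 2 ^ 31) ?_ ?_ 31 (by norm_num) x a h ha
  · intro a h; exact h
  · intro x a r hx ih h
    exact ih (Nat.or_lt_two_pow h (hg _))

def PT : ℕ := 0x8776766576656554766565546554544376656554655454436554544354434332766565546554544365545443544343326554544354434332544343324332322176656554655454436554544354434332655454435443433254434332433232216554544354434332544343324332322154434332433232214332322132212110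
def pb (y : ℕ) : ℕ := Nat.mod (Nat.shiftRight PT (Nat.shiftLeft y 2)) 16
def pop (x : ℕ) : ℕ := force x fun x =>
  Nat.add (Nat.add (pb (Nat.mod x 256)) (pb (Nat.mod (Nat.shiftRight x 8) 256)))
    (Nat.add (pb (Nat.mod (Nat.shiftRight x 16) 256)) (pb (Nat.mod (Nat.shiftRight x 24) 256)))

theorem pb_eq : ∀ y < 256, pb y = ∑ j ∈ Finset.range 8, (y.testBit j).toNat := by decide +kernel

theorem pb_eq2 (x s : ℕ) : pb (Nat.mod (Nat.shiftRight x s) 256) = ∑ j ∈ Finset.range 8, (x.testBit (s + j)).toNat := by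
  refine (pb_eq _ (Nat.mod_lt _ (by norm_num))).trans ?_
  apply Finset.sum_congr rfl
  intro j hj
  change ((x >>> s % 2 ^ 8).testBit j).toNat = _
  rw [Nat.testBit_mod_two_pow, Nat.testBit_shiftRight]
  simp [Finset.mem_range.1 hj]

theorem pop_eq {x : ℕ} (h : x < 2 ^ 31) : pop x = (bits x).card := by
  simp only [pop, force_eq]
  have h0 := pb_eq2 x 0
  change pb (Nat.mod x 256) = _ at h0
  rw [h0, pb_eq2, pb_eq2, pb_eq2, bits, Finset.card_filter]
  have h31 : x.testBit 31 = false := Nat.testBit_lt_two_pow h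
  have e : ∀ i, (if x.testBit i = true then 1 else 0) = (x.testBit i).toNat := by
    intro i; cases x.testBit i <;> rfl
  simp only [e, Finset.sum_range_succ, Finset.sum_range_zero]
  change (_ + _ : ℕ) + (_ + _) = _
  norm_num [h31]
  ring

def sumN (g : ℕ → ℕ) (n : ℕ) : ℕ := Nat.rec 0 (fun i ih => Nat.add ih (g i)) n
theorem sumN_eq (g : ℕ → ℕ) (n : ℕ) : sumN g n = ∑ i ∈ Finset.range n, g i := by
  induction n with
  | zero => rfl
  | succ k ih => rw [Finset.sum_range_succ, ← ih]; rfl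

def row (M v : ℕ) : ℕ := Nat.mod (Nat.shiftRight M (Nat.shiftLeft v 5)) 2147483648
theorem row_lt (M v : ℕ) : row M v < 2 ^ 31 := Nat.mod_lt _ (by norm_num)
theorem row_testBit {M v j : ℕ} (hj : j < 31) : (row M v).testBit j = M.testBit (32 * v + j) := by
  show ((M >>> (v <<< 5)) % 2147483648).testBit j = _
  rw [show (2147483648 : ℕ) = 2 ^ 31 by norm_num, Nat.testBit_mod_two_pow, Nat.testBit_shiftRight,
    Nat.shiftLeft_eq]
  simp [hj, mul_comm]

def lanes (w : ℕ) : ℕ → ℕ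
  | 0 => 0
  | m + 1 => 2 ^ w * lanes w m + 1

theorem lanes_mul (w X : ℕ) (hX : X < 2 ^ w) (m i j : ℕ) (hi : i < m) (hj : j < w) :
    (X * lanes w m).testBit (w * i + j) = X.testBit j := by
  induction m generalizing i with
  | zero => omega
  | succ m ih =>
    have e : X * lanes w (m+1) = 2 ^ w * (X * lanes w m) + X := by rw [lanes]; ring
    rw [e, Nat.testBit_two_pow_mul_add _ hX]
    cases i with
    | zero => simp [hj]
    | succ i =>
      rw [if_neg (by rw [Nat.mul_succ]; omega)]
      rw [show w * (i+1) + j - w = w * i + j by rw [Nat.mul_succ]; omega]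
      exact ih i (by omega)

theorem lanes_bit (w : ℕ) (hw : 1 < w) (m i j : ℕ) (hi : i < m) (hj : j < w) :
    (lanes w m).testBit (w * i + j) = decide (j = 0) := by
  have h := lanes_mul w 1 (Nat.one_lt_two_pow (by omega)) m i j hi hj
  rw [one_mul] at h; rw [h]
  cases j <;> simp [Nat.testBit_succ]

theorem lanes_high (w m k : ℕ) (hw : 1 < w) (hk : w * m ≤ k) : (lanes w m).testBit k = false := by
  apply Nat.testBit_lt_two_pow
  refine lt_of_lt_of_le ?_ (Nat.pow_le_pow_right (by norm_num) hk)
  clear hk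
  induction m with
  | zero => simp [lanes]
  | succ m ih =>
    rw [lanes, Nat.mul_succ, pow_add]
    have : (2:ℕ) ^ w ≥ 2 ^ 1 := Nat.pow_le_pow_right (by norm_num) hw.le
    nlinarith

theorem sp_mul (S Y : ℕ) (hS : ∀ k, S.testBit k = true → k % 32 = 0) (hY : Y < 2 ^ 32) (i j : ℕ)
    (hj : j < 32) : (S * Y).testBit (32 * i + j) = (S.testBit (32 * i) && Y.testBit j) := by
  induction i generalizing S with
  | zero =>
    have e : S * Y = 2 ^ 32 * (S / 2 ^ 32 * Y) + S % 2 ^ 32 * Y := by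
      conv_lhs => rw [← Nat.div_add_mod S (2 ^ 32)]
      ring
    have hm : S % 2 ^ 32 = if S.testBit 0 then 1 else 0 := by
      apply Nat.eq_of_testBit_eq
      intro k
      rw [Nat.testBit_mod_two_pow]
      by_cases hk : k = 0
      · subst hk; cases S.testBit 0 <;> simp
      · have : (decide (k < 32) && S.testBit k) = false := by
          by_contra hc
          simp only [Bool.not_eq_false, Bool.and_eq_true, decide_eq_true_eq] at hc
          have := hS k hc.2; omega
        rw [this]
        split
        · rw [Nat.testBit_one_eq_true_iff_self_eq_zero.not.mpr hk |> Bool.eq_false_iff.mpr]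
        · simp
    have hlt : S % 2 ^ 32 * Y < 2 ^ 32 := by rw [hm]; split <;> simp <;> omega
    rw [e, Nat.testBit_two_pow_mul_add _ hlt, if_pos (by omega), hm]
    cases S.testBit 0 <;> simp
  | succ i ih =>
    have e : S * Y = 2 ^ 32 * (S / 2 ^ 32 * Y) + S % 2 ^ 32 * Y := by
      conv_lhs => rw [← Nat.div_add_mod S (2 ^ 32)]
      ring
    have hm : S % 2 ^ 32 ≤ 1 := by
      by_contra hc
      obtain ⟨k, hk⟩ := Nat.exists_testBit_ne_of_ne (x := S % 2 ^ 32) (y := S % 2) (by omega)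
      rw [Nat.testBit_mod_two_pow, show (2:ℕ) = 2 ^ 1 by norm_num, Nat.testBit_mod_two_pow] at hk
      by_cases hb : S.testBit k = true
      · have := hS k hb
        simp [hb] at hk; omega
      · simp [hb] at hk
    have hlt : S % 2 ^ 32 * Y < 2 ^ 32 := by nlinarith
    rw [e, Nat.testBit_two_pow_mul_add _ hlt, if_neg (by omega),
      show 32 * (i + 1) + j - 32 = 32 * i + j by omega, ih]
    · rw [Nat.testBit_div_two_pow]; congr 2
    · intro k hk
      rw [Nat.testBit_div_two_pow] at hk
      have := hS _ hk; omega

def C31 : ℕ := 0x40000000800000010000000200000004000000080000001000000020000000400000008000000100000002000000040000000800000010000000200000004000000080000001000000020000000400000008000000100000002000000040000000800000010000000200000004000000080000001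
def C32 : ℕ := 0x1000000010000000100000001000000010000000100000001000000010000000100000001000000010000000100000001000000010000000100000001000000010000000100000001000000010000000100000001000000010000000100000001000000010000000100000001000000010000000100000001

def prod (X Y : ℕ) : ℕ := Nat.mul (Nat.land (Nat.mul X C31) C32) Y

theorem C31_eq : C31 = lanes 31 31 := by decide +kernel
theorem C32_eq : C32 = lanes 32 31 := by decide +kernel

theorem prod_testBit {X Y i j : ℕ} (hX : X < 2 ^ 31) (hY : Y < 2 ^ 31) (hi : i < 31) (hj : j < 31) :
    (prod X Y).testBit (32 * i + j) = (X.testBit i && Y.testBit j) := by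
  show (((X * C31) &&& C32) * Y).testBit _ = _
  rw [sp_mul _ _ _ (by omega) _ _ (by omega)]
  · rw [Nat.testBit_and, C32_eq]
    have h2 := lanes_bit 32 (by norm_num) 31 i 0 hi (by norm_num)
    rw [Nat.add_zero] at h2
    rw [h2, C31_eq, show 32 * i = 31 * i + i by ring, lanes_mul 31 X hX 31 i i hi hi]
    simp
  · intro k hk
    rw [Nat.testBit_and, C32_eq, Bool.and_eq_true] at hk
    have hk := hk.2
    by_cases hk2 : k < 32 * 31
    · have := lanes_bit 32 (by norm_num) 31 (k / 32) (k % 32) (by omega) (by omega)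
      rw [Nat.div_add_mod, hk] at this
      simpa using this.symm
    · rw [lanes_high 32 31 k (by norm_num) (by omega)] at hk
      simp at hk

def rmv (U X Y : ℕ) : ℕ := force U fun U => force (Nat.lor (prod X Y) (prod Y X)) fun M =>
  Nat.xor U (Nat.land U M)

theorem rmv_row {U X Y i j : ℕ} (hX : X < 2 ^ 31) (hY : Y < 2 ^ 31) (hi : i < 31) (hj : j < 31) :
    (row (rmv U X Y) i).testBit j = true ↔ (row U i).testBit j = true ∧
      ¬ (X.testBit i = true ∧ Y.testBit j = true) ∧ ¬ (Y.testBit i = true ∧ X.testBit j = true) := by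
  rw [row_testBit hj, row_testBit hj]
  simp only [rmv, force_eq]
  show (U ^^^ (U &&& (prod X Y ||| prod Y X))).testBit _ = true ↔ _
  rw [Nat.testBit_xor, Nat.testBit_and, Nat.testBit_or, prod_testBit hX hY hi hj, prod_testBit hY hX hi hj]
  cases U.testBit (32 * i + j) <;> cases X.testBit i <;> cases Y.testBit i <;> cases X.testBit j <;>
    cases Y.testBit j <;> simp

end Eng

namespace Eng

structure Par where
  n : ℕ
  D : ℕ
  dmin : ℕ
  m : ℕ
  tau : ℕ
  T : ℕ
  top : ℕ
  E2 : ℕ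
  LT : ℕ

def dg (p : Par) (i : ℕ) : ℕ := Nat.mod (Nat.shiftRight p.D (Nat.shiftLeft i 2)) 16
def lt (p : Par) (t : ℕ) : ℕ := row p.LT t
def thr (p : Par) (k : ℕ) : ℕ := Nat.mod (Nat.shiftRight p.T (Nat.shiftLeft k 3)) 256

structure Ok (p : Par) : Prop where
  n30 : p.n ≤ 30
  lt : ∀ t < 8, ∀ i < 31, (lt p t).testBit i = decide (i < p.n ∧ dg p i < t)
  E2 : p.E2 = ∑ i ∈ Finset.range p.n, dg p i
  dmin : ∀ i < p.n, p.dmin ≤ dg p i ∧ dg p i ≤ p.dmin + p.m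
  m7 : p.dmin + p.m < 8
  top : p.top < 2 ^ p.n

structure Free (R : ℕ → ℕ → Prop) : Prop where
  sym : ∀ i j, R i j → R j i
  irr : ∀ i, ¬ R i i
  tri : ∀ i j k, R i j → R j k → R i k → False
  c4 : ∀ a b x y, R a x → R a y → R b x → R b y → x ≠ y → a = b

open Classical in
noncomputable def nb (R : ℕ → ℕ → Prop) (T : Finset ℕ) (i : ℕ) : Finset ℕ := T.filter (R i)

theorem mem_nb {R : ℕ → ℕ → Prop} {T : Finset ℕ} {i j : ℕ} : j ∈ nb R T i ↔ j ∈ T ∧ R i j := by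
  simp [nb]

structure Model (p : Par) (R : ℕ → ℕ → Prop) : Prop extends Free R where
  supp : ∀ i j, R i j → j < p.n
  deg : ∀ i < p.n, (nb R (Finset.range p.n) i).card = dg p i
  ns : ∀ i < p.n, dg p i = 5 → (∀ j, R i j → 4 ≤ dg p j) →
    ((nb R (Finset.range p.n) i).filter (fun j => 5 ≤ dg p j)).card ≤ p.tau

structure Sat (R : ℕ → ℕ → Prop) (A U : ℕ) : Prop where
  symA : ∀ i j, i < 31 → j ∈ bits (row A i) → i ∈ bits (row A j)
  symU : ∀ i j, i < 31 → j ∈ bits (row U i) → i ∈ bits (row U j)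
  ar : ∀ i j, i < 31 → j ∈ bits (row A i) → R i j
  ru : ∀ i j, R i j → j ∈ bits (row A i) ∨ j ∈ bits (row U i)

def Unsat (p : Par) (A U : ℕ) : Prop := ∀ R, Model p R → ¬ Sat R A U

def HD (p : Par) : Prop := ∀ R, Model p R → ∀ S ⊆ Finset.range p.n,
  2 * thr p S.card + ∑ i ∈ S, (nb R S i).card ≤ 2 * ∑ i ∈ S, dg p i

theorem lt31 {i x : ℕ} (h : i ∈ bits x) : i < 31 := (mem_bits.1 h).1

theorem mem_rmv {U X Y i j : ℕ} (hX : X < 2 ^ 31) (hY : Y < 2 ^ 31) (hi : i < 31) :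
    j ∈ bits (row (rmv U X Y) i) ↔ j ∈ bits (row U i) ∧
      ¬ (i ∈ bits X ∧ j ∈ bits Y) ∧ ¬ (i ∈ bits Y ∧ j ∈ bits X) := by
  by_cases hj : j < 31
  · simp only [mem_bits, hi, hj, true_and, rmv_row hX hY hi hj]
  · simp only [mem_bits, hj, false_and]

theorem bits_one {v : ℕ} (hv : v < 31) : bits (Nat.shiftLeft 1 v) = {v} := by
  ext i
  show i ∈ bits (1 <<< v) ↔ _
  rw [mem_bits, Nat.one_shiftLeft, Nat.testBit_two_pow, Finset.mem_singleton]
  simp; omega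

theorem one_lt {v : ℕ} (hv : v < 31) : Nat.shiftLeft 1 v < 2 ^ 31 := by
  show 1 <<< v < _
  rw [Nat.one_shiftLeft]; exact Nat.pow_lt_pow_right (by norm_num) hv

theorem bits_lor (x y : ℕ) : bits (Nat.lor x y) = bits x ∪ bits y := by
  ext i
  show i ∈ bits (x ||| y) ↔ _
  rw [Finset.mem_union, mem_bits, mem_bits, mem_bits, Nat.testBit_or, Bool.or_eq_true]
  tauto

theorem lor_lt {x y : ℕ} (hx : x < 2 ^ 31) (hy : y < 2 ^ 31) : Nat.lor x y < 2 ^ 31 := Nat.or_lt_two_pow hx hy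
theorem land_lt {x y : ℕ} (hx : x < 2 ^ 31) : Nat.land x y < 2 ^ 31 := lt_of_le_of_lt Nat.and_le_left hx
theorem xor_lt {x y : ℕ} (hx : x < 2 ^ 31) (hy : y < 2 ^ 31) : Nat.xor x y < 2 ^ 31 := Nat.xor_lt_two_pow hx hy

theorem bits_land (x y : ℕ) : bits (Nat.land x y) = bits x ∩ bits y := by
  ext i
  show i ∈ bits (x &&& y) ↔ _
  rw [Finset.mem_inter, mem_bits, mem_bits, mem_bits, Nat.testBit_and, Bool.and_eq_true]
  tauto

theorem bits_diff (x y : ℕ) : bits (Nat.xor x (Nat.land x y)) = bits x \ bits y := by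
  ext i
  show i ∈ bits (x ^^^ (x &&& y)) ↔ _
  rw [Finset.mem_sdiff, mem_bits, mem_bits, mem_bits, Nat.testBit_xor, Nat.testBit_and]
  cases x.testBit i <;> cases y.testBit i <;> simp

theorem mem_lt {p : Par} (ok : Ok p) {t i : ℕ} (ht : t < 8) : i ∈ bits (lt p t) ↔ i < p.n ∧ dg p i < t := by
  rw [mem_bits]
  constructor
  · rintro ⟨h1, h2⟩; rw [ok.lt t ht i h1] at h2; simpa using h2
  · intro h
    have : i < 31 := by have := ok.n30; omega
    exact ⟨this, by rw [ok.lt t ht i this]; simpa using h⟩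

theorem eq_of_bits {x y : ℕ} (hx : x < 2 ^ 31) (hy : y < 2 ^ 31) (h : bits x = bits y) : x = y := by
  apply Nat.eq_of_testBit_eq
  intro i
  by_cases hi : i < 31
  · have := Finset.ext_iff.1 h i
    rw [mem_bits, mem_bits] at this
    simp only [hi, true_and] at this
    exact Bool.eq_iff_iff.2 this
  · rw [Nat.testBit_lt_two_pow, Nat.testBit_lt_two_pow]
    · exact lt_of_lt_of_le hy (Nat.pow_le_pow_right (by norm_num) (by omega))
    · exact lt_of_lt_of_le hx (Nat.pow_le_pow_right (by norm_num) (by omega))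

/- rmv preserves Sat -/
theorem sat_rmv {R : ℕ → ℕ → Prop} {A U X Y : ℕ} (F : Free R) (hR : ∀ i j, R i j → i < 31) (S : Sat R A U) (hX : X < 2 ^ 31) (hY : Y < 2 ^ 31)
    (h : ∀ i j, i ∈ bits X → j ∈ bits Y → R i j → j ∈ bits (row A i)) : Sat R A (rmv U X Y) where
  symA := S.symA
  ar := S.ar
  symU i j hi hj := by
    rw [mem_rmv hX hY hi] at hj
    rw [mem_rmv hX hY (lt31 hj.1)]
    exact ⟨S.symU i j hi hj.1, fun h => hj.2.2 ⟨h.2, h.1⟩, fun h => hj.2.1 ⟨h.2, h.1⟩⟩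
  ru i j hij := by
    have hi := hR i j hij
    rw [mem_rmv hX hY hi]
    by_cases hA : j ∈ bits (row A i)
    · exact Or.inl hA
    right
    refine ⟨(S.ru i j hij).resolve_left hA, fun hc => hA (h i j hc.1 hc.2 hij), fun hc => hA ?_⟩
    have := h j i hc.2 hc.1 (F.sym _ _ hij)
    exact S.symA j i (lt31 hc.2) this

def addA (A v w : ℕ) : ℕ := Nat.lor (Nat.lor A (Nat.shiftLeft 1 (Nat.add (Nat.shiftLeft v 5) w)))
  (Nat.shiftLeft 1 (Nat.add (Nat.shiftLeft w 5) v))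

theorem mem_addA {A v w i j : ℕ} (hv : v < 31) (hw : w < 31) :
    j ∈ bits (row (addA A v w) i) ↔ j ∈ bits (row A i) ∨ (i = v ∧ j = w) ∨ (i = w ∧ j = v) := by
  by_cases hj : j < 31
  · simp only [mem_bits, hj, true_and]
    rw [row_testBit hj, row_testBit hj]
    show ((A ||| 1 <<< (v <<< 5 + w)) ||| 1 <<< (w <<< 5 + v)).testBit _ = true ↔ _
    rw [Nat.testBit_or, Nat.testBit_or, Nat.one_shiftLeft, Nat.one_shiftLeft, Nat.testBit_two_pow, Nat.testBit_two_pow,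
      Nat.shiftLeft_eq, Nat.shiftLeft_eq]
    simp only [Bool.or_eq_true, decide_eq_true_eq, or_assoc]
    have e1 : v * 2 ^ 5 + w = 32 * i + j ↔ i = v ∧ j = w := by omega
    have e2 : w * 2 ^ 5 + v = 32 * i + j ↔ i = w ∧ j = v := by omega
    rw [e1, e2]
  · simp only [mem_bits, hj, false_and, false_or]
    constructor
    · tauto
    · rintro (h | h) <;> omega

def orr (A x a : ℕ) : ℕ := foldb (fun i a => Nat.lor a (row A i)) 31 x a
def sat1 (p : Par) (A U v : ℕ) : ℕ := bcond (Nat.ble (dg p v) (pop (row A v))) (rmv U (Nat.shiftLeft 1 v) 2147483647) U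
def X1 (A v : ℕ) := Nat.lor (row A v) (Nat.shiftLeft 1 v)
def X2 (A v : ℕ) := orr A (row A v) (X1 A v)
def addU (p : Par) (A U v w : ℕ) : ℕ :=
  sat1 p (addA A v w) (sat1 p (addA A v w) (rmv (rmv (rmv U (X1 A v) (X1 A w)) (Nat.shiftLeft 1 v) (X2 A w))
    (X2 A v) (Nat.shiftLeft 1 w)) v) w
def opAdd (p : Par) (A U v w : ℕ) (k : ℕ → ℕ → Bool) : Bool :=
  force (row A v) fun a => force (row A w) fun b => force (Nat.shiftLeft 1 v) fun bv => force (Nat.shiftLeft 1 w) fun bw =>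
  force (Nat.lor a bv) fun x1 => force (Nat.lor b bw) fun y1 =>
  force (orr A a x1) fun x2 => force (orr A b y1) fun y2 =>
  force (rmv (rmv (rmv U x1 y1) bv y2) x2 bw) fun U1 =>
  force (addA A v w) fun A1 =>
  force (sat1 p A1 U1 v) fun U2 => force (sat1 p A1 U2 w) fun U3 => k A1 U3
theorem opAdd_eq (p : Par) (A U v w : ℕ) (k : ℕ → ℕ → Bool) :
    opAdd p A U v w k = k (addA A v w) (addU p A U v w) := by
  simp only [opAdd, force_eq, addU, X1, X2]

theorem X1_lt (A v : ℕ) (hv : v < 31) : X1 A v < 2 ^ 31 := lor_lt (row_lt _ _) (one_lt hv)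
theorem X2_lt (A v : ℕ) (hv : v < 31) : X2 A v < 2 ^ 31 :=
  foldb_or_lt _ _ _ (X1_lt A v hv) (fun i => row_lt A i) (row_lt A v)
theorem mem_X1 {A v x : ℕ} (hv : v < 31) : x ∈ bits (X1 A v) ↔ x ∈ bits (row A v) ∨ x = v := by
  rw [X1, bits_lor, bits_one hv, Finset.mem_union, Finset.mem_singleton]
theorem mem_X2 {A v x : ℕ} (hv : v < 31) : x ∈ bits (X2 A v) ↔
    x ∈ bits (row A v) ∨ x = v ∨ ∃ y ∈ bits (row A v), x ∈ bits (row A y) := by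
  rw [← or_assoc, ← mem_X1 hv]
  by_cases hx : x < 31
  · simp only [mem_bits (i := x), hx, true_and]
    exact foldb_or (row A) (row A v) (X1 A v) x (row_lt _ _)
  · simp only [mem_bits (i := x), hx, false_and, and_false, exists_false, or_false]

section
variable {p : Par} {R : ℕ → ℕ → Prop} {A U : ℕ}

theorem Model.l31 (ok : Ok p) (M : Model p R) (i j : ℕ) (h : R i j) : i < 31 := by
  have := M.supp j i (M.sym _ _ h); have := ok.n30; omega
theorem Model.ln (M : Model p R) (i j : ℕ) (h : R i j) : i < p.n := M.supp j i (M.sym _ _ h)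

theorem sub_nb (ok : Ok p) (M : Model p R) (S : Sat R A U) {v : ℕ} (hv : v < p.n) :
    bits (row A v) ⊆ nb R (Finset.range p.n) v := by
  intro j hj
  have := S.ar v j (by have := ok.n30; omega) hj
  exact mem_nb.2 ⟨Finset.mem_range.2 (M.supp _ _ this), this⟩

theorem rest_sub (S : Sat R A U) (v n : ℕ) : nb R (Finset.range n) v \ bits (row A v) ⊆ bits (row U v) := by
  intro j hj
  rw [Finset.mem_sdiff, mem_nb] at hj
  exact (S.ru v j hj.1.2).resolve_left hj.2

theorem rest_card (ok : Ok p) (M : Model p R) (S : Sat R A U) {v : ℕ} (hv : v < p.n) :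
    (nb R (Finset.range p.n) v \ bits (row A v)).card = dg p v - (bits (row A v)).card := by
  rw [Finset.card_sdiff_of_subset (sub_nb ok M S hv), M.deg v hv]

theorem sat_sat1 (ok : Ok p) (M : Model p R) (S : Sat R A U) {v : ℕ} (hv : v < p.n) :
    Sat R A (sat1 p A U v) := by
  have h31 : v < 31 := by have := ok.n30; omega
  rw [sat1, bcond_eq]
  split
  · rename_i h
    apply sat_rmv M.toFree (M.l31 ok) S (one_lt h31) (by norm_num)
    intro i j hi _ hij
    rw [bits_one h31, Finset.mem_singleton] at hi
    subst hi
    rw [Nat.ble_eq, pop_eq (row_lt _ _)] at h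
    have hc := rest_card ok M S hv
    rw [show dg p i - (bits (row A i)).card = 0 by omega, Finset.card_eq_zero, Finset.sdiff_eq_empty_iff_subset] at hc
    exact hc (mem_nb.2 ⟨Finset.mem_range.2 (M.supp _ _ hij), hij⟩)
  · exact S

theorem sat_add (ok : Ok p) (M : Model p R) (S : Sat R A U) {v w : ℕ} (hvw : R v w) :
    Sat R (addA A v w) (addU p A U v w) := by
  have hv := M.ln v w hvw
  have hw := M.supp v w hvw
  have hv31 : v < 31 := by have := ok.n30; omega
  have hw31 : w < 31 := by have := ok.n30; omega
  have S0 : Sat R (addA A v w) U := by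
    refine ⟨?_, S.symU, ?_, ?_⟩
    · intro i j hi
      rw [mem_addA hv31 hw31, mem_addA hv31 hw31]
      have := S.symA i j hi
      tauto
    · intro i j hi
      rw [mem_addA hv31 hw31]
      rintro (h | ⟨rfl, rfl⟩ | ⟨rfl, rfl⟩)
      · exact S.ar i j hi h
      · exact hvw
      · exact M.sym _ _ hvw
    · intro i j hij
      rw [mem_addA hv31 hw31]
      have := S.ru i j hij
      tauto
  have arv : ∀ x, x ∈ bits (row A v) → R v x := fun x => S.ar v x hv31
  have arw : ∀ x, x ∈ bits (row A w) → R w x := fun x => S.ar w x hw31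
  have hl := M.l31 ok
  unfold addU
  apply sat_sat1 ok M _ hw
  apply sat_sat1 ok M _ hv
  apply sat_rmv M.toFree hl _ (X2_lt A v hv31) (one_lt hw31)
  · intro x y hx hy hxy
    rw [bits_one hw31, Finset.mem_singleton] at hy
    subst hy
    rw [mem_addA hv31 hw31]
    rw [mem_X2 hv31] at hx
    rcases hx with hx | rfl | ⟨z, hz, hx⟩
    · exact (M.tri v x y (arv x hx) hxy hvw).elim
    · exact Or.inr (Or.inl ⟨rfl, rfl⟩)
    · have h1 := arv z hz
      have h2 := S.ar z x (lt31 hz) hx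
      by_cases hzy : z = y
      · subst hzy; left; exact S.symA z x (lt31 hz) hx
      · have := M.c4 v x z y h1 hvw (M.sym _ _ h2) hxy hzy
        exact Or.inr (Or.inl ⟨this.symm, rfl⟩)
  apply sat_rmv M.toFree hl _ (one_lt hv31) (X2_lt A w hw31)
  · intro x y hy hx hxy
    rw [bits_one hv31, Finset.mem_singleton] at hy
    subst hy
    rw [mem_addA hv31 hw31]
    rw [mem_X2 hw31] at hx
    rcases hx with hx | rfl | ⟨z, hz, hx⟩
    · exact (M.tri x w y hvw (arw y hx) hxy).elim
    · exact Or.inr (Or.inl ⟨rfl, rfl⟩)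
    · have h1 := arw z hz
      have h2 := S.ar z y (lt31 hz) hx
      by_cases hzy : z = x
      · subst hzy; left; exact hx
      · have := M.c4 w y z x h1 (M.sym _ _ hvw) (M.sym _ _ h2) (M.sym _ _ hxy) hzy
        exact Or.inr (Or.inl ⟨rfl, this.symm⟩)
  apply sat_rmv M.toFree hl S0 (X1_lt A v hv31) (X1_lt A w hw31)
  intro x y hx hy hxy
  rw [mem_addA hv31 hw31]
  rw [mem_X1 hv31] at hx
  rw [mem_X1 hw31] at hy
  rcases hx with hx | rfl
  · rcases hy with hy | rfl
    · by_cases h1 : x = w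
      · subst h1; exact Or.inl hy
      by_cases h2 : y = v
      · subst h2; left; exact S.symA y x hv31 hx
      · exact (h2 (M.c4 y v x w (M.sym _ _ hxy) (M.sym _ _ (arw y hy)) (arv x hx) hvw h1)).elim
    · exact (M.tri v x y (arv x hx) hxy hvw).elim
  · rcases hy with hy | rfl
    · exact (M.tri x w y hvw (arw y hy) hxy).elim
    · exact Or.inr (Or.inl ⟨rfl, rfl⟩)

end
end Eng

namespace Eng

def dsum (p : Par) (x : ℕ) : ℕ := foldb (fun i a => Nat.add a (dg p i)) 31 x 0
theorem dsum_eq (p : Par) {x : ℕ} (h : x < 2 ^ 31) : dsum p x = ∑ i ∈ bits x, dg p i := by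
  rw [dsum, foldb_sum (dg p) x 0 h, Nat.zero_add]

def lbt (p : Par) (u need k t : ℕ) : ℕ :=
  force (Nat.sub need (pop (Nat.land u (lt p t)))) fun q => bcond (Nat.beq q 0) (bcond (Nat.ble t k) 1 0) q
def lb (p : Par) (a u need k : ℕ) : ℕ :=
  Nat.add (Nat.add (dsum p a) (Nat.mul need p.dmin)) (sumN (fun i => lbt p u need k (Nat.add (Nat.add p.dmin 1) i)) p.m)

def opRE (p : Par) (A U v k : ℕ) (cl : Bool) (kk : ℕ → ℕ → Bool) : Bool :=
  bcond (Nat.ble 8 k) false <|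
  force (row A v) fun a => force (row U v) fun u => force (Nat.sub (dg p v) (pop a)) fun need =>
  bcond (Nat.ble p.n (lb p a u need k))
    (bcond (Nat.beq k 0) cl (bcond (Nat.ble need (pop (Nat.land u (lt p k))))
      (force (rmv U (Nat.shiftLeft 1 v) (Nat.xor u (Nat.land u (lt p k)))) fun U' => kk A U') cl))
    (bcond (Nat.ble need (pop u)) false cl)

def opNS (p : Par) (A U v : ℕ) (cl : Bool) (kk : ℕ → ℕ → Bool) : Bool :=
  force (row A v) fun a => force (row U v) fun u =>
  bcond (Nat.beq (dg p v) 5) (bcond (Nat.beq (Nat.land (Nat.lor a u) (lt p 4)) 0)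
    (force (pop (Nat.xor a (Nat.land a (lt p 5)))) fun r =>
      bcond (Nat.ble r p.tau) (bcond (Nat.beq r p.tau)
        (force (rmv U (Nat.shiftLeft 1 v) (Nat.xor u (Nat.land u (lt p 5)))) fun U' => kk A U') false) cl) false) false

def foLoop (p : Par) (v : ℕ) (kk : ℕ → ℕ → Bool) (fuel : ℕ) : ℕ → ℕ → ℕ → Bool :=
  Nat.rec (fun _ A U => kk A U) (fun _ ih x A U => bcond (Nat.beq x 0) (kk A U)
    (force (lg x) fun w => force (Nat.xor x (Nat.shiftLeft 1 w)) fun y =>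
      bcond (Nat.beq (Nat.mod (Nat.shiftRight (row U v) w) 2) 1)
        (opAdd p A U v w fun A U => ih y A U) (ih y A U))) fuel

def opFO (p : Par) (A U v : ℕ) (kk : ℕ → ℕ → Bool) : Bool :=
  force (row U v) fun u => bcond (Nat.ble (Nat.add (pop (row A v)) (pop u)) (dg p v))
    (foLoop p v kk 31 u A U) false

def opDE (p : Par) (A S : ℕ) (cl : Bool) : Bool :=
  bcond (Nat.ble (Nat.shiftLeft 1 p.n) S) false <|
  bcond (Nat.ble (Nat.add (Nat.mul 2 (thr p (pop S))) (foldb (fun i a => Nat.add a (pop (Nat.land (row A i) S))) 31 S 0))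
    (Nat.mul 2 (dsum p S))) false cl

def chc (lo hi m : ℕ) : ℕ := bcond (Nat.ble m hi) (bcond (Nat.ble lo m) m lo) hi
def chv (p : Par) (A U F th v : ℕ) : ℕ :=
  force (pop (Nat.land (row A v) F)) fun lo =>
  force (Nat.add lo (pop (Nat.land (row U v) F))) fun h =>
  force (dg p v) fun d =>
  force (Nat.mod (Nat.shiftRight F v) 2) fun f =>
  force (chc lo (bcond (Nat.ble h d) h d) (Nat.div (Nat.sub (Nat.add th 1) f) 2)) fun c =>
  Nat.add (Nat.add (Nat.mul c (Nat.sub c 1)) (Nat.mul f c)) (Nat.mul th (Nat.sub d c))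
def opCH (p : Par) (A U x th : ℕ) (cl : Bool) : Bool :=
  force (bcond (Nat.beq x 31) p.top (Nat.xor p.top (Nat.shiftLeft 1 x))) fun F =>
  bcond (Nat.ble (Nat.shiftLeft 1 p.n) F) false <|
  force (pop F) fun N =>
  bcond (Nat.ble (sumN (fun v => chv p A U F th v) p.n)
    (Nat.add (Nat.mul N (Nat.sub N 1)) (Nat.mul th (Nat.sub p.E2 (dsum p F))))) false cl

section
variable {p : Par} {R : ℕ → ℕ → Prop} {A U : ℕ}

theorem nbr_sumF (M : Free R) (N : Finset ℕ) {v : ℕ} (hv : v ∈ N) :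
    ∑ y ∈ nb R N v, (nb R N y).card < N.card := by
  classical
  have key : ((nb R N v).biUnion (fun y => insert y ((nb R N y).erase v))).card = ∑ y ∈ nb R N v, (nb R N y).card := by
    rw [Finset.card_biUnion]
    · apply Finset.sum_congr rfl
      intro y hy
      rw [mem_nb] at hy
      have h1 : y ∉ (nb R N y).erase v := by
        intro h; exact M.irr y (mem_nb.1 (Finset.mem_of_mem_erase h)).2
      have h2 : v ∈ nb R N y := mem_nb.2 ⟨hv, M.sym _ _ hy.2⟩
      have h3 : 0 < (nb R N y).card := Finset.card_pos.2 ⟨v, h2⟩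
      rw [Finset.card_insert_of_notMem h1, Finset.card_erase_of_mem h2]
      omega
    · intro y hy z hz hyz
      simp only [Finset.mem_coe, mem_nb] at hy hz
      rw [Function.onFun, Finset.disjoint_left]
      intro t ht1 ht2
      rw [Finset.mem_insert, Finset.mem_erase, mem_nb] at ht1 ht2
      rcases ht1 with rfl | ⟨a, _, b⟩
      · rcases ht2 with rfl | ⟨c, _, d⟩
        · exact hyz rfl
        · exact M.tri v z t hz.2 d hy.2
      · rcases ht2 with rfl | ⟨c, _, d⟩
        · exact M.tri v y t hy.2 b hz.2
        · exact a (M.c4 v t y z hy.2 hz.2 (M.sym _ _ b) (M.sym _ _ d) hyz).symm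
  rw [← key]
  have : (nb R N v).biUnion (fun y => insert y ((nb R N y).erase v)) ⊆ N.erase v := by
    intro t
    simp only [Finset.mem_biUnion, Finset.mem_insert, Finset.mem_erase, mem_nb]
    rintro ⟨y, hy, rfl | ⟨h1, h2, h3⟩⟩
    · refine ⟨?_, hy.1⟩
      rintro rfl; exact M.irr _ hy.2
    · exact ⟨h1, h2⟩
  exact lt_of_le_of_lt (Finset.card_le_card this) (Finset.card_erase_lt_of_mem hv)

theorem nbr_sum (M : Model p R) {v : ℕ} (hv : v < p.n) :
    ∑ y ∈ nb R (Finset.range p.n) v, dg p y < p.n := by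
  have := nbr_sumF M.toFree (Finset.range p.n) (Finset.mem_range.2 hv)
  rw [Finset.card_range] at this
  refine lt_of_eq_of_lt (Finset.sum_congr rfl fun y hy => ?_) this
  exact (M.deg y (Finset.mem_range.1 (mem_nb.1 hy).1)).symm

theorem lb_le (ok : Ok p) (M : Model p R) (S : Sat R A U) {v k : ℕ} (hv : v < p.n)
    (hk : k = 0 ∨ ∃ y ∈ nb R (Finset.range p.n) v \ bits (row A v), k ≤ dg p y) :
    lb p (row A v) (row U v) (dg p v - pop (row A v)) k < p.n := by
  classical
  refine lt_of_le_of_lt ?_ (nbr_sum M hv)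
  have hs := sub_nb ok M S hv
  have hr := rest_sub S v p.n
  have hc := rest_card ok M S hv
  rw [← pop_eq (row_lt _ _)] at hc
  rw [← Finset.sum_sdiff hs]
  set N := nb R (Finset.range p.n) v
  set a := bits (row A v)
  have hin : ∀ y ∈ N \ a, y < p.n := fun y hy => Finset.mem_range.1 (mem_nb.1 (Finset.mem_sdiff.1 hy).1).1
  have e : ∑ y ∈ N \ a, dg p y = (N \ a).card * p.dmin +
      ∑ i ∈ Finset.range p.m, ((N \ a).filter (fun y => p.dmin + 1 + i ≤ dg p y)).card := by
    simp only [Finset.card_filter]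
    rw [Finset.sum_comm, Finset.card_eq_sum_ones, Finset.sum_mul, ← Finset.sum_add_distrib]
    apply Finset.sum_congr rfl
    intro y hy
    rw [← Finset.card_filter]
    have hd := ok.dmin y (hin y hy)
    have : (Finset.range p.m).filter (fun i => p.dmin + 1 + i ≤ dg p y) = Finset.range (dg p y - p.dmin) := by
      ext i; simp only [Finset.mem_filter, Finset.mem_range]; omega
    rw [this, Finset.card_range]; omega
  rw [e, lb, sumN_eq, dsum_eq p (row_lt _ _), hc]
  show (∑ i ∈ a, dg p i) + (dg p v - pop (row A v)) * p.dmin +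
    ∑ i ∈ Finset.range p.m, lbt p (row U v) (dg p v - pop (row A v)) k ((p.dmin + 1) + i) ≤ _
  have : ∑ i ∈ Finset.range p.m, lbt p (row U v) (dg p v - pop (row A v)) k ((p.dmin + 1) + i) ≤
      ∑ i ∈ Finset.range p.m, ((N \ a).filter (fun y => p.dmin + 1 + i ≤ dg p y)).card := by
    apply Finset.sum_le_sum
    intro i hi
    have ht : p.dmin + 1 + i < 8 := by have := ok.m7; have := Finset.mem_range.1 hi; omega
    rw [lbt, force_eq, bcond_eq, bcond_eq, pop_eq (land_lt (row_lt _ _)), bits_land]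
    have h1 : dg p v - pop (row A v) ≤ (bits (row U v) ∩ bits (lt p (p.dmin + 1 + i))).card +
        ((N \ a).filter (fun y => p.dmin + 1 + i ≤ dg p y)).card := by
      rw [← hc, ← Finset.card_filter_add_card_filter_not (s := N \ a) (fun y => p.dmin + 1 + i ≤ dg p y), add_comm]
      apply Nat.add_le_add_right
      apply Finset.card_le_card
      intro y hy
      rw [Finset.mem_filter] at hy
      rw [Finset.mem_inter, mem_lt ok ht]
      exact ⟨hr hy.1, hin y hy.1, by omega⟩
    split
    · split
      · rename_i h2
        rw [Nat.ble_eq] at h2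
        rcases hk with hk | ⟨y, hy, hk⟩
        · omega
        · apply Finset.card_pos.2
          exact ⟨y, Finset.mem_filter.2 ⟨hy, by omega⟩⟩
      · omega
    · exact Nat.sub_le_iff_le_add.2 (by omega)
  linarith

theorem opRE_sound (ok : Ok p) {v k : ℕ} {cl : Bool} {kk : ℕ → ℕ → Bool} (hv : v < p.n)
    (h : opRE p A U v k cl kk = true) :
    (cl = true ∧ Unsat p A U) ∨ ∃ A' U', kk A' U' = true ∧ (Unsat p A' U' → Unsat p A U) := by
  have h31 : v < 31 := by have := ok.n30; omega
  simp only [opRE, bcond_eq, force_eq] at h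
  split at h
  · simp at h
  rename_i hk8
  simp only [Nat.ble_eq] at hk8
  push Not at hk8
  have hpop : ∀ {R}, Model p R → Sat R A U → ∀ k < 8, (∀ y ∈ nb R (Finset.range p.n) v \ bits (row A v), dg p y < k) →
      dg p v - pop (row A v) ≤ pop (Nat.land (row U v) (lt p k)) := by
    intro R M S k hk hy
    rw [pop_eq (row_lt _ _), ← rest_card ok M S hv, pop_eq (land_lt (row_lt _ _)), bits_land]
    apply Finset.card_le_card
    intro y h
    rw [Finset.mem_inter, mem_lt ok hk]
    exact ⟨rest_sub S v p.n h, Finset.mem_range.1 (mem_nb.1 (Finset.mem_sdiff.1 h).1).1, hy y h⟩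
  split at h
  · rename_i hlb
    rw [Nat.ble_eq] at hlb
    split at h
    · rename_i hk
      refine Or.inl ⟨h, fun R M S => ?_⟩
      have := lb_le (k := k) ok M S hv (Or.inl (by simpa using hk))
      change p.n ≤ lb p (row A v) (row U v) (dg p v - pop (row A v)) k at hlb
      omega
    · have key : ∀ {R}, Model p R → Sat R A U → (∀ y ∈ nb R (Finset.range p.n) v \ bits (row A v), dg p y < k) := by
        intro R M S y hy
        by_contra hc
        have := lb_le (k := k) ok M S hv (Or.inr ⟨y, hy, by omega⟩)
        change p.n ≤ lb p (row A v) (row U v) (dg p v - pop (row A v)) k at hlb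
        omega
      split at h
      · refine Or.inr ⟨_, _, h, fun hU R M S => hU R M ?_⟩
        apply sat_rmv M.toFree (M.l31 ok) S (one_lt h31) (xor_lt (row_lt _ _) (land_lt (row_lt _ _)))
        intro i j hi hj hij
        rw [bits_one h31, Finset.mem_singleton] at hi
        subst hi
        rw [bits_diff, Finset.mem_sdiff, mem_lt ok (by omega)] at hj
        by_contra hc
        have hn := M.supp _ _ hij
        exact hj.2 ⟨hn, key M S j (Finset.mem_sdiff.2 ⟨mem_nb.2 ⟨Finset.mem_range.2 hn, hij⟩, hc⟩)⟩
      · rename_i hne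
        refine Or.inl ⟨h, fun R M S => hne ?_⟩
        rw [Nat.ble_eq]
        exact hpop M S k (by omega) (key M S)
  · split at h
    · simp at h
    · rename_i hne
      refine Or.inl ⟨h, fun R M S => hne ?_⟩
      rw [Nat.ble_eq]
      show dg p v - pop (row A v) ≤ _
      rw [pop_eq (row_lt _ _), ← rest_card ok M S hv, pop_eq (row_lt _ _)]
      exact Finset.card_le_card (rest_sub S v p.n)

theorem opNS_sound (ok : Ok p) {v : ℕ} {cl : Bool} {kk : ℕ → ℕ → Bool} (hv : v < p.n)
    (h : opNS p A U v cl kk = true) :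
    (cl = true ∧ Unsat p A U) ∨ ∃ A' U', kk A' U' = true ∧ (Unsat p A' U' → Unsat p A U) := by
  have h31 : v < 31 := by have := ok.n30; omega
  simp only [opNS, bcond_eq, force_eq] at h
  split at h
  swap
  · simp at h
  rename_i hd
  rw [Nat.beq_eq] at hd
  split at h
  swap
  · simp at h
  rename_i h4
  rw [Nat.beq_eq] at h4
  have h4' : ∀ j, j ∈ bits (row A v) ∪ bits (row U v) → j < p.n → 4 ≤ dg p j := by
    intro j hj hn
    by_contra hc
    have : j ∈ bits (Nat.land (Nat.lor (row A v) (row U v)) (lt p 4)) := by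
      rw [bits_land, bits_lor, Finset.mem_inter, mem_lt ok (by norm_num)]
      exact ⟨hj, hn, by omega⟩
    rw [h4] at this
    simp [bits] at this
  have hns : ∀ {R}, Model p R → Sat R A U →
      ((nb R (Finset.range p.n) v).filter (fun j => 5 ≤ dg p j)).card ≤ p.tau := by
    intro R M S
    apply M.ns v hv hd
    intro j hj
    exact h4' j (Finset.mem_union.2 (S.ru v j hj)) (M.supp _ _ hj)
  have hsub : ∀ {R}, Model p R → Sat R A U → bits (row A v) \ bits (lt p 5) ⊆
      (nb R (Finset.range p.n) v).filter (fun j => 5 ≤ dg p j) := by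
    intro R M S j hj
    rw [Finset.mem_sdiff, mem_lt ok (by norm_num)] at hj
    have h1 := sub_nb ok M S hv hj.1
    have h2 := Finset.mem_range.1 (mem_nb.1 h1).1
    rw [Finset.mem_filter]
    exact ⟨h1, by by_contra hc; exact hj.2 ⟨h2, by omega⟩⟩
  rw [pop_eq (xor_lt (row_lt _ _) (land_lt (row_lt _ _))), bits_diff] at h
  split at h
  · split at h
    · rename_i hr
      rw [Nat.beq_eq] at hr
      refine Or.inr ⟨_, _, h, fun hU R M S => hU R M ?_⟩
      apply sat_rmv M.toFree (M.l31 ok) S (one_lt h31) (xor_lt (row_lt _ _) (land_lt (row_lt _ _)))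
      intro i j hi hj hij
      rw [bits_one h31, Finset.mem_singleton] at hi
      subst hi
      have he := Finset.eq_of_subset_of_card_le (hsub M S) (by rw [hr]; exact hns M S)
      have hn := M.supp _ _ hij
      rw [bits_diff, Finset.mem_sdiff, mem_lt ok (by norm_num)] at hj
      have : j ∈ (nb R (Finset.range p.n) i).filter (fun j => 5 ≤ dg p j) := by
        rw [Finset.mem_filter, mem_nb, Finset.mem_range]
        exact ⟨⟨hn, hij⟩, by by_contra hc; exact hj.2 ⟨hn, by omega⟩⟩
      rw [← he] at this
      exact (Finset.mem_sdiff.1 this).1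
    · simp at h
  · rename_i hr
    refine Or.inl ⟨h, fun R M S => hr ?_⟩
    rw [Nat.ble_eq]
    exact (Finset.card_le_card (hsub M S)).trans (hns M S)

theorem foLoop_sound (ok : Ok p) (v : ℕ) (kk : ℕ → ℕ → Bool) (fuel : ℕ) : ∀ x A U, x < 2 ^ 31 →
    foLoop p v kk fuel x A U = true → ∃ A' U', kk A' U' = true ∧
      ∀ R, Model p R → (∀ w ∈ bits x, R v w) → Sat R A U → Sat R A' U' := by
  induction fuel with
  | zero => intro x A U _ h; exact ⟨A, U, h, fun R _ _ S => S⟩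
  | succ n ih =>
    intro x A U hx h
    change bcond (Nat.beq x 0) (kk A U)
      (force (lg x) fun w => force (Nat.xor x (Nat.shiftLeft 1 w)) fun y =>
      bcond (Nat.beq (Nat.mod (Nat.shiftRight (row U v) w) 2) 1)
        (opAdd p A U v w fun A U => foLoop p v kk n y A U) (foLoop p v kk n y A U)) = true at h
    simp only [bcond_eq, force_eq, opAdd_eq] at h
    split at h
    · exact ⟨A, U, h, fun R _ _ S => S⟩
    · rename_i h0
      have h0 : x ≠ 0 := by simpa using h0
      have hb := (bits_step h0 hx).2
      rw [lg_eq h0 (by omega)] at h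
      split at h
      · obtain ⟨A', U', h1, h2⟩ := ih _ _ _ (xor_lt31 hx h0) h
        refine ⟨A', U', h1, fun R M hw S => h2 R M ?_ (sat_add ok M S ?_)⟩
        · intro w hw'; exact hw w (by rw [hb]; exact Finset.mem_insert_of_mem hw')
        · exact hw _ (by rw [hb]; exact Finset.mem_insert_self _ _)
      · obtain ⟨A', U', h1, h2⟩ := ih _ _ _ (xor_lt31 hx h0) h
        refine ⟨A', U', h1, fun R M hw S => h2 R M ?_ S⟩
        intro w hw'; exact hw w (by rw [hb]; exact Finset.mem_insert_of_mem hw')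

theorem opFO_sound (ok : Ok p) {v : ℕ} {kk : ℕ → ℕ → Bool} (hv : v < p.n)
    (h : opFO p A U v kk = true) :
    ∃ A' U', kk A' U' = true ∧ (Unsat p A' U' → Unsat p A U) := by
  simp only [opFO, bcond_eq, force_eq] at h
  split at h
  swap
  · simp at h
  rename_i hd
  rw [Nat.ble_eq, pop_eq (row_lt _ _), pop_eq (row_lt _ _)] at hd
  obtain ⟨A', U', h1, h2⟩ := foLoop_sound ok v kk 31 _ _ _ (row_lt _ _) h
  refine ⟨A', U', h1, fun hU R M S => hU R M (h2 R M ?_ S)⟩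
  have hsub : nb R (Finset.range p.n) v ⊆ bits (row A v) ∪ bits (row U v) := by
    intro j hj; exact Finset.mem_union.2 (S.ru v j (mem_nb.1 hj).2)
  have he := Finset.eq_of_subset_of_card_le hsub (by
    rw [M.deg v hv]; exact (Finset.card_union_le _ _).trans hd)
  intro w hw
  have : w ∈ nb R (Finset.range p.n) v := by rw [he]; exact Finset.mem_union_right _ hw
  exact (mem_nb.1 this).2

theorem bits_sub_range {n x : ℕ} (hx : x < 2 ^ n) : bits x ⊆ Finset.range n := by
  intro i hi
  by_contra hc
  rw [Finset.mem_range] at hc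
  rw [mem_bits, Nat.testBit_lt_two_pow (lt_of_lt_of_le hx (Nat.pow_le_pow_right (by norm_num) (by omega)))] at hi
  simp at hi

theorem lt31_of_n (ok : Ok p) {x : ℕ} (hx : x < 2 ^ p.n) : x < 2 ^ 31 :=
  lt_of_lt_of_le hx (Nat.pow_le_pow_right (by norm_num) (by have := ok.n30; omega))

theorem opDE_sound (ok : Ok p) (hD : HD p) {S : ℕ} {cl : Bool}
    (h : opDE p A S cl = true) : cl = true ∧ Unsat p A U := by
  simp only [opDE, bcond_eq] at h
  split at h
  · simp at h
  rename_i hS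
  have hS : S < 2 ^ p.n := by
    rw [Nat.ble_eq] at hS
    change ¬ (1 <<< p.n ≤ S) at hS
    rw [Nat.one_shiftLeft] at hS; omega
  have hS31 := lt31_of_n ok hS
  split at h
  · simp at h
  rename_i hc
  refine ⟨h, fun R M Sa => hc ?_⟩
  have := hD R M (bits S) (bits_sub_range hS)
  rw [Nat.ble_eq, foldb_sum (fun i => pop (Nat.land (row A i) S)) _ _ hS31, pop_eq hS31, dsum_eq p hS31]
  show 2 * _ + _ ≤ 2 * _
  refine le_trans ?_ this
  rw [Nat.zero_add]
  apply Nat.add_le_add_left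
  apply Finset.sum_le_sum
  intro i hi
  rw [pop_eq (land_lt (row_lt _ _)), bits_land]
  apply Finset.card_le_card
  intro j hj
  rw [Finset.mem_inter] at hj
  exact mem_nb.2 ⟨hj.2, Sa.ar i j (lt31 hi) hj.1⟩

theorem cherry (F : Free R) (V W : Finset ℕ) :
    ∑ v ∈ V, (nb R W v).card * ((nb R W v).card - 1) + ∑ v ∈ W, (nb R W v).card ≤ W.card * (W.card - 1) := by
  classical
  have e1 : ∀ v, (nb R W v).card * ((nb R W v).card - 1) = ∑ q ∈ W.offDiag, if R v q.1 ∧ R v q.2 then 1 else 0 := by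
    intro v
    rw [← Finset.card_filter, Nat.mul_sub_one, ← Finset.offDiag_card]
    congr 1
    ext q
    simp only [Finset.mem_offDiag, mem_nb, Finset.mem_filter]
    tauto
  have e2 : ∑ v ∈ W, (nb R W v).card = ∑ q ∈ W.offDiag, if R q.1 q.2 then 1 else 0 := by
    rw [← Finset.card_filter, Finset.card_eq_sum_card_fiberwise (f := Prod.fst) (t := W)]
    · apply Finset.sum_congr rfl
      intro v hv
      apply Finset.card_bij (fun x _ => (v, x))
      · intro x hx
        rw [mem_nb] at hx
        simp only [Finset.mem_filter, Finset.mem_offDiag]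
        refine ⟨⟨⟨hv, hx.1, ?_⟩, hx.2⟩, trivial⟩
        rintro rfl; exact F.irr _ hx.2
      · intro a _ b _ h; exact (Prod.mk.inj h).2
      · rintro ⟨a, b⟩ h
        simp only [Finset.mem_filter, Finset.mem_offDiag] at h
        obtain ⟨⟨⟨h1, h2, h3⟩, h4⟩, rfl⟩ := h
        exact ⟨b, mem_nb.2 ⟨h2, h4⟩, rfl⟩
    · intro q hq
      simp only [Finset.mem_coe, Finset.mem_filter, Finset.mem_offDiag] at hq
      exact hq.1.1
  simp only [e1]
  rw [e2, Finset.sum_comm, ← Finset.sum_add_distrib, Nat.mul_sub_one, ← Finset.offDiag_card, Finset.card_eq_sum_ones]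
  apply Finset.sum_le_sum
  intro q hq
  rw [Finset.mem_offDiag] at hq
  rw [← Finset.card_filter]
  split
  · rename_i hr
    rw [Finset.card_eq_zero.2]
    apply Finset.filter_eq_empty_iff.2
    rintro v _ ⟨h1, h2⟩
    exact F.tri v q.1 q.2 h1 hr h2
  · rw [Nat.add_zero]
    apply Finset.card_le_one.2
    intro a ha b hb
    rw [Finset.mem_filter] at ha hb
    exact F.c4 a b q.1 q.2 ha.2.1 ha.2.2 hb.2.1 hb.2.2 hq.2.2

theorem chc_min (lo hi th f c d : ℕ) (h1 : lo ≤ c) (h2 : c ≤ hi) (h3 : hi ≤ d) (_ : f ≤ 1) :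
    chc lo hi ((th + 1 - f) / 2) * (chc lo hi ((th + 1 - f) / 2) - 1) + f * chc lo hi ((th + 1 - f) / 2)
      + th * (d - chc lo hi ((th + 1 - f) / 2)) ≤ c * (c - 1) + f * c + th * (d - c) := by
  obtain ⟨m, hm⟩ : ∃ m, m = (th + 1 - f) / 2 := ⟨_, rfl⟩
  rw [← hm]
  have hm1 : 2 * m ≤ th + 1 - f := by omega
  have hm2 : th ≤ 2 * m + f := by omega
  obtain ⟨x, hx⟩ : ∃ x, x = chc lo hi m := ⟨_, rfl⟩
  rw [← hx]
  have hcase : (hi < m ∧ x = hi) ∨ (m ≤ hi ∧ lo ≤ m ∧ x = m) ∨ (m ≤ hi ∧ m < lo ∧ x = lo) := by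
    simp only [chc, bcond_eq, Nat.ble_eq] at hx
    split at hx
    · split at hx <;> omega
    · omega
  have hxd : x ≤ d := by omega
  have hcd : c ≤ d := by omega
  have ez : ∀ y : ℕ, ((y * (y - 1) : ℕ) : ℤ) = (y : ℤ) * (y - 1) := by
    intro y; cases y <;> simp
  zify [hxd, hcd]
  have e1 := ez x
  have e2 := ez c
  push_cast at e1 e2
  rw [e1, e2]
  have : (0 : ℤ) ≤ ((c : ℤ) - x) * (c + x - 1 + f - th) := by
    rcases lt_trichotomy c x with h | h | h
    · apply mul_nonneg_of_nonpos_of_nonpos <;> omega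
    · subst h; simp
    · apply mul_nonneg <;> omega
  nlinarith

theorem opCH_sound (ok : Ok p) {x th : ℕ} {cl : Bool}
    (h : opCH p A U x th cl = true) : cl = true ∧ Unsat p A U := by
  classical
  simp only [opCH, force_eq] at h
  generalize bcond (Nat.beq x 31) p.top (Nat.xor p.top (Nat.shiftLeft 1 x)) = F at h
  simp only [bcond_eq] at h
  split at h
  · simp at h
  rename_i hS
  have hS : F < 2 ^ p.n := by
    rw [Nat.ble_eq] at hS
    change ¬ (1 <<< p.n ≤ F) at hS
    rw [Nat.one_shiftLeft] at hS; omega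
  have hS31 := lt31_of_n ok hS
  split at h
  · simp at h
  rename_i hc
  refine ⟨h, fun R M Sa => hc ?_⟩
  rw [Nat.ble_eq, sumN_eq, pop_eq hS31, dsum_eq p hS31, ok.E2]
  set W := bits F with hW
  have hWs : W ⊆ Finset.range p.n := bits_sub_range hS
  have hch := cherry M.toFree (Finset.range p.n) W
  show _ ≤ W.card * (W.card - 1) + th * (_ - _)
  have hle : ∀ v ∈ Finset.range p.n, (nb R W v).card ≤ dg p v := by
    intro v hv
    rw [← M.deg v (Finset.mem_range.1 hv)]
    apply Finset.card_le_card
    intro j hj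
    rw [mem_nb] at hj ⊢
    exact ⟨hWs hj.1, hj.2⟩
  have hsum : ∑ v ∈ Finset.range p.n, (nb R W v).card = ∑ v ∈ W, dg p v := by
    have : ∀ v ∈ W, dg p v = ∑ x ∈ Finset.range p.n, if R v x then 1 else 0 := by
      intro v hv
      rw [← M.deg v (Finset.mem_range.1 (hWs hv)), nb, Finset.card_filter]
    rw [Finset.sum_congr rfl this, Finset.sum_comm]
    apply Finset.sum_congr rfl
    intro v _
    rw [nb, Finset.card_filter]
    apply Finset.sum_congr rfl
    intro x _
    have : R v x ↔ R x v := ⟨M.sym _ _, M.sym _ _⟩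
    simp only [this]
  have hterm : ∀ v ∈ Finset.range p.n, chv p A U F th v ≤ (nb R W v).card * ((nb R W v).card - 1)
      + (if v ∈ W then (nb R W v).card else 0) + th * (dg p v - (nb R W v).card) := by
    intro v hv
    have hvn := Finset.mem_range.1 hv
    have h31 : v < 31 := by have := ok.n30; omega
    obtain ⟨f, hf⟩ : ∃ f, f = if v ∈ W then 1 else 0 := ⟨_, rfl⟩
    have hf2 : Nat.mod (Nat.shiftRight F v) 2 = f := by
      have hm : v ∈ W ↔ F / 2 ^ v % 2 = 1 := by
        rw [hW, mem_bits, Nat.testBit_eq_decide_div_mod_eq, decide_eq_true_eq]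
        simp only [h31, true_and]
      rw [hf]
      show (F >>> v) % 2 = _
      rw [Nat.shiftRight_eq_div_pow]
      split <;> rename_i hq <;> rw [hm] at hq <;> omega
    have hf3 : (if v ∈ W then (nb R W v).card else 0) = f * (nb R W v).card := by
      rw [hf]; split <;> simp
    simp only [chv, force_eq]
    rw [hf2, hf3, pop_eq (land_lt (row_lt _ _)), pop_eq (land_lt (row_lt _ _)), bits_land, bits_land]
    refine chc_min _ _ th f _ _ ?_ ?_ ?_ (by rw [hf]; split <;> simp)
    · apply Finset.card_le_card
      intro j hj
      rw [Finset.mem_inter] at hj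
      exact mem_nb.2 ⟨hj.2, Sa.ar v j h31 hj.1⟩
    · have : (nb R W v).card ≤ (bits (row A v) ∩ W).card + (bits (row U v) ∩ W).card := by
        refine le_trans (Finset.card_le_card ?_) (Finset.card_union_le _ _)
        intro j hj
        rw [mem_nb] at hj
        have := Sa.ru v j hj.2
        simp only [Finset.mem_union, Finset.mem_inter]
        tauto
      rw [bcond_eq]
      split
      · exact this
      · exact hle v hv
    · rw [bcond_eq]
      split
      · rename_i hb; simpa using hb
      · exact le_rfl
  refine (Finset.sum_le_sum hterm).trans ?_
  rw [Finset.sum_add_distrib, Finset.sum_add_distrib, ← Finset.mul_sum, ← hsum,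
    ← Finset.sum_filter, Finset.filter_mem_eq_inter, Finset.inter_eq_right.2 hWs]
  apply Nat.add_le_add hch
  apply Nat.mul_le_mul_left
  have : ∑ v ∈ Finset.range p.n, (dg p v - (nb R W v).card) + ∑ v ∈ Finset.range p.n, (nb R W v).card
      = ∑ v ∈ Finset.range p.n, dg p v := by
    rw [← Finset.sum_add_distrib]
    apply Finset.sum_congr rfl
    intro v hv
    have := hle v hv; omega
  omega

end
end Eng

namespace Eng

def orN (g : ℕ → ℕ) (n : ℕ) : ℕ := Nat.rec 0 (fun i ih => Nat.lor ih (g i)) n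
theorem mem_orN (g : ℕ → ℕ) (n x : ℕ) : x ∈ bits (orN g n) ↔ ∃ i < n, x ∈ bits (g i) := by
  induction n with
  | zero => simp [orN, bits]
  | succ k ih =>
    change x ∈ bits (Nat.lor (orN g k) (g k)) ↔ _
    rw [bits_lor, Finset.mem_union, ih]
    constructor
    · rintro (⟨i, hi, h⟩ | h)
      · exact ⟨i, by omega, h⟩
      · exact ⟨k, by omega, h⟩
    · rintro ⟨i, hi, h⟩
      by_cases hk : i = k
      · subst hk; exact Or.inr h
      · exact Or.inl ⟨i, by omega, h⟩
theorem orN_lt (g : ℕ → ℕ) (n : ℕ) (h : ∀ i < n, g i < 2 ^ 31) : orN g n < 2 ^ 31 := by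
  induction n with
  | zero => simp [orN]
  | succ k ih => exact lor_lt (ih fun i hi => h i (by omega)) (h k (by omega))

def twt (p : Par) (A U d a u bv x : ℕ) : ℕ :=
  bcond (Nat.beq (dg p x) d) (bcond (Nat.beq (row A x) a)
    (force (Nat.shiftLeft 1 x) fun bx => force (Nat.lor bv bx) fun b =>
      bcond (Nat.beq (Nat.lor (Nat.xor (row U x) u) b) b) bx 0) 0) 0
def tw (p : Par) (A U v w : ℕ) : ℕ :=
  force (dg p v) fun d => force (row A v) fun a => force (row U v) fun u => force (Nat.shiftLeft 1 v) fun bv =>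
  force (orN (twt p A U d a u bv) p.n) fun t => Nat.xor t (Nat.land t (Nat.shiftLeft 1 w))

structure Twin (p : Par) (A U v x : ℕ) : Prop where
  xn : x < p.n
  d : dg p x = dg p v
  a : row A x = row A v
  u : ∀ j, j ≠ x → j ≠ v → (j ∈ bits (row U x) ↔ j ∈ bits (row U v))

section
variable {p : Par} {R : ℕ → ℕ → Prop} {A U : ℕ}

theorem twt_lt (ok : Ok p) (d a u bv : ℕ) : ∀ x < p.n, twt p A U d a u bv x < 2 ^ 31 := by
  intro x hx
  have h31 : x < 31 := by have := ok.n30; omega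
  simp only [twt, bcond_eq, force_eq]
  split
  · split
    · split
      · exact one_lt h31
      · norm_num
    · norm_num
  · norm_num

theorem tw_lt (ok : Ok p) (v w : ℕ) : tw p A U v w < 2 ^ 31 := by
  simp only [tw, force_eq]
  have := orN_lt _ p.n (twt_lt (A := A) (U := U) ok (dg p v) (row A v) (row U v) (Nat.shiftLeft 1 v))
  exact xor_lt this (land_lt this)

theorem mem_tw (ok : Ok p) {v w x : ℕ} (hv : v < p.n) (hw : w < p.n) (h : x ∈ bits (tw p A U v w)) :
    x ≠ w ∧ Twin p A U v x := by
  have hv31 : v < 31 := by have := ok.n30; omega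
  have hw31 : w < 31 := by have := ok.n30; omega
  simp only [tw, force_eq] at h
  rw [bits_diff, Finset.mem_sdiff, bits_one hw31, Finset.mem_singleton, mem_orN] at h
  obtain ⟨⟨i, hi, h⟩, hxw⟩ := h
  refine ⟨hxw, ?_⟩
  have hi31 : i < 31 := by have := ok.n30; omega
  simp only [twt, bcond_eq, force_eq] at h
  have h0 : ¬ x ∈ bits 0 := by simp [bits]
  split at h
  swap
  · exact (h0 h).elim
  rename_i h1
  split at h
  swap
  · exact (h0 h).elim
  rename_i h2
  split at h
  swap
  · exact (h0 h).elim
  rename_i h3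
  rw [bits_one hi31, Finset.mem_singleton] at h
  subst h
  rw [Nat.beq_eq] at h1 h2 h3
  refine ⟨hi, h1, h2, ?_⟩
  intro j hj1 hj2
  by_cases hj : j < 31
  · simp only [mem_bits, hj, true_and]
    have h4 := congrArg (fun y => j ∈ bits y) h3
    simp only [bits_lor, Finset.mem_union, bits_one hv31, bits_one hi31, Finset.mem_singleton, hj1, hj2, or_false] at h4
    rw [mem_bits] at h4
    change (j < 31 ∧ (row U x ^^^ row U v).testBit j = true) = False at h4
    rw [Nat.testBit_xor] at h4
    cases h5 : (row U x).testBit j <;> cases h6 : (row U v).testBit j <;> simp_all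
  · simp only [mem_bits, hj, false_and]

theorem swap_model {v x : ℕ} (M : Model p R) (hv : v < p.n) (hx : x < p.n) (hd : dg p x = dg p v) :
    Model p (fun i j => R (Equiv.swap v x i) (Equiv.swap v x j)) := by
  classical
  set σ := Equiv.swap v x with hσ
  have hn : ∀ i, σ i < p.n ↔ i < p.n := by
    intro i
    rw [hσ, Equiv.swap_apply_def]
    split
    · subst_vars; simp [hx, hv]
    · split
      · subst_vars; simp [hx, hv]
      · rfl
  have hdg : ∀ i, dg p (σ i) = dg p i := by
    intro i
    rw [hσ, Equiv.swap_apply_def]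
    split
    · subst_vars; exact hd
    · split
      · subst_vars; exact hd.symm
      · rfl
  have hss : ∀ i, σ (σ i) = i := fun i => by rw [hσ]; exact Equiv.swap_apply_self v x i
  have hnb : ∀ i, nb (fun i j => R (σ i) (σ j)) (Finset.range p.n) i = (nb R (Finset.range p.n) (σ i)).map σ.toEmbedding := by
    intro i
    ext j
    rw [mem_nb, Finset.mem_map_equiv, mem_nb, Finset.mem_range, Finset.mem_range]
    have : σ.symm j = σ j := by rw [hσ, Equiv.symm_swap]
    rw [this, hn]
  refine ⟨⟨fun i j h => M.sym _ _ h, fun i h => M.irr _ h, fun i j k a b c => M.tri _ _ _ a b c,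
    fun a b y z h1 h2 h3 h4 h5 => σ.injective (M.c4 _ _ _ _ h1 h2 h3 h4 (fun h => h5 (σ.injective h)))⟩, ?_, ?_, ?_⟩
  · intro i j h; exact (hn j).1 (M.supp _ _ h)
  · intro i hi
    rw [hnb, Finset.card_map, M.deg _ ((hn i).2 hi), hdg]
  · intro i hi h5 h4
    rw [hnb, Finset.filter_map, Finset.card_map]
    have := M.ns (σ i) ((hn i).2 hi) (by rw [hdg, h5]) (fun j hj => by
      have := h4 (σ j) (by rw [hss]; exact hj)
      rwa [hdg] at this)
    convert this using 3
    simp only [Function.comp, Equiv.coe_toEmbedding, hdg]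

theorem swap_sat {v x : ℕ} (ok : Ok p) (M : Model p R) (S : Sat R A U) (hv : v < p.n) (t : Twin p A U v x) :
    Sat (fun i j => R (Equiv.swap v x i) (Equiv.swap v x j)) A U := by
  by_cases hxv : x = v
  · subst hxv; simpa using S
  have hv31 : v < 31 := by have := ok.n30; omega
  have hx31 : x < 31 := by have := ok.n30; have := t.xn; omega
  have ta : ∀ j, j ∈ bits (row A x) ↔ j ∈ bits (row A v) := by rw [t.a]; simp
  have hvv : v ∉ bits (row A v) := fun h => M.irr _ (S.ar v v hv31 h)
  have hvx : x ∉ bits (row A v) := fun h => by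
    have := S.symA v x hv31 h
    rw [t.a] at this; exact hvv this
  have cA : ∀ i, i < 31 → (x ∈ bits (row A i) ↔ v ∈ bits (row A i)) := by
    intro i hi
    constructor
    · intro h
      have := S.symA i x hi h
      rw [t.a] at this
      exact S.symA v i hv31 this
    · intro h
      have := S.symA i v hi h
      rw [← t.a] at this
      exact S.symA x i hx31 this
  have cU : ∀ i, i < 31 → i ≠ x → i ≠ v → (x ∈ bits (row U i) ↔ v ∈ bits (row U i)) := by
    intro i hi h1 h2
    constructor
    · intro h
      exact S.symU v i hv31 ((t.u i h1 h2).1 (S.symU i x hi h))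
    · intro h
      exact S.symU x i hx31 ((t.u i h1 h2).2 (S.symU i v hi h))
  have keyA : ∀ i j, i < 31 → (Equiv.swap v x j ∈ bits (row A (Equiv.swap v x i)) ↔ j ∈ bits (row A i)) := by
    intro i j hi
    have e1 : row A (Equiv.swap v x i) = row A i := by
      rw [Equiv.swap_apply_def]
      split
      · subst_vars; exact t.a
      · split
        · subst_vars; exact t.a.symm
        · rfl
    rw [e1, Equiv.swap_apply_def]
    split
    · subst_vars; exact cA i hi
    · split
      · subst_vars; exact (cA i hi).symm
      · rfl
  have h31 : ∀ i, i < 31 → Equiv.swap v x i < 31 := by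
    intro i hi
    rw [Equiv.swap_apply_def]
    split
    · exact hx31
    · split
      · exact hv31
      · exact hi
  refine ⟨S.symA, S.symU, ?_, ?_⟩
  · intro i j hi hj
    exact S.ar _ _ (h31 i hi) ((keyA i j hi).2 hj)
  · intro i j hij
    have hi : i < 31 := by
      have := h31 _ (M.l31 ok _ _ hij)
      rwa [Equiv.swap_apply_self] at this
    rcases S.ru _ _ hij with h | h
    · exact Or.inl ((keyA i j hi).1 h)
    · right
      have hne : Equiv.swap v x i ≠ Equiv.swap v x j := by
        intro h; rw [h] at hij; exact M.irr _ hij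
      rw [Equiv.swap_apply_def, Equiv.swap_apply_def] at h hne
      by_cases hiv : i = v
      · subst hiv
        by_cases hjv : j = i
        · subst hjv; simp at hne
        by_cases hjx : j = x
        · subst hjx; simp [hxv] at h; exact S.symU _ _ hx31 h
        · simp [hjv, hjx] at h; exact (t.u j hjx hjv).1 h
      by_cases hix : i = x
      · subst hix
        by_cases hjv : j = v
        · subst hjv; simp [hxv] at h; exact S.symU _ _ hv31 h
        by_cases hjx : j = i
        · subst hjx; simp at hne
        · simp [hjv, hjx, hiv] at h; exact (t.u j hjx hjv).2 h
      · simp only [hiv, hix, if_false] at h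
        split at h
        · subst_vars; exact (cU i hi hix hiv).1 h
        · split at h
          · subst_vars; exact (cU i hi hix hiv).2 h
          · exact h

theorem br_sound (ok : Ok p) {v w : ℕ} (hv : v < p.n) (hw : w < p.n)
    (h1 : Unsat p (addA A v w) (addU p A U v w)) (h2 : Unsat p A (rmv U (Nat.shiftLeft 1 v) (Nat.shiftLeft 1 w))) :
    Unsat p A U := by
  have hv31 : v < 31 := by have := ok.n30; omega
  have hw31 : w < 31 := by have := ok.n30; omega
  intro R M S
  by_cases h : R v w
  · exact h1 R M (sat_add ok M S h)
  · apply h2 R M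
    apply sat_rmv M.toFree (M.l31 ok) S (one_lt hv31) (one_lt hw31)
    intro i j hi hj hij
    rw [bits_one hv31, Finset.mem_singleton] at hi
    rw [bits_one hw31, Finset.mem_singleton] at hj
    subst hi; subst hj; exact (h hij).elim

theorem bt_sound (ok : Ok p) {v w : ℕ} (hv : v < p.n) (hw : w < p.n) (hvw : v ≠ w)
    (h1 : Unsat p (addA A v w) (addU p A U v w)) (h2 : Unsat p A (rmv U (tw p A U v w) (tw p A U w v))) :
    Unsat p A U := by
  intro R M S
  apply h2 R M
  apply sat_rmv M.toFree (M.l31 ok) S (tw_lt ok v w) (tw_lt ok w v)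
  intro x y hx hy hxy
  exfalso
  obtain ⟨hxw, tx⟩ := mem_tw ok hv hw hx
  obtain ⟨hyv, ty⟩ := mem_tw ok hw hv hy
  have M1 := swap_model M hv tx.xn tx.d
  have S1 := swap_sat ok M S hv tx
  have M2 := swap_model M1 hw ty.xn ty.d
  have S2 := swap_sat ok M1 S1 hw ty
  refine h1 _ M2 (sat_add ok M2 S2 ?_)
  have hyx : y ≠ x := by rintro rfl; exact M.irr _ hxy
  show R (Equiv.swap v x (Equiv.swap w y v)) (Equiv.swap v x (Equiv.swap w y w))
  rw [Equiv.swap_apply_left, Equiv.swap_apply_of_ne_of_ne hvw hyv.symm, Equiv.swap_apply_left,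
    Equiv.swap_apply_of_ne_of_ne hyv hyx]
  exact hxy

end

abbrev K := ℕ → ℕ → ℕ → List (ℕ × ℕ) → Bool

def popK (ih : ℕ → ℕ → List (ℕ × ℕ) → Bool) (st : List (ℕ × ℕ)) : Bool :=
  List.rec true (fun s r _ => force s.1 fun A => force s.2 fun U => ih A U r) st

def step (p : Par) (ih : K) (c A U : ℕ) (st : List (ℕ × ℕ)) : Bool :=
  force (Nat.mod c 8) fun o => force (Nat.mod (Nat.shiftRight c 3) 32) fun v =>
  force (Nat.mod (Nat.shiftRight c 8) 32) fun w => force (Nat.shiftRight c 13) fun c1 =>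
  bcond (Nat.ble o 5)
    (bcond (Nat.ble p.n v) false
      (bcond (Nat.beq o 3) (opRE p A U v w (popK (ih c1) st) (fun A U => ih c1 A U st))
      (bcond (Nat.beq o 4) (opNS p A U v (popK (ih c1) st) (fun A U => ih c1 A U st))
      (bcond (Nat.beq o 5) (opFO p A U v (fun A U => ih c1 A U st))
      (bcond (Nat.ble p.n w) false
      (bcond (Nat.beq o 1)
        (force (rmv U (Nat.shiftLeft 1 v) (Nat.shiftLeft 1 w)) fun UB => opAdd p A U v w fun A' U' => ih c1 A' U' ((A, UB) :: st))
      (bcond (Nat.beq v w) false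
        (force (tw p A U v w) fun t1 => force (tw p A U w v) fun t2 =>
          force (rmv U t1 t2) fun UB => opAdd p A U v w fun A' U' => ih c1 A' U' ((A, UB) :: st)))))))))
    (bcond (Nat.beq o 6) (force (Nat.shiftRight c 26) fun c2 =>
        opDE p A (Nat.mod (Nat.shiftRight c 3) 8388608) (popK (ih c2) st))
      (opCH p A U v w (popK (ih c1) st)))

def inner (p : Par) (out : ℕ → ℕ → List (ℕ × ℕ) → Bool) (fuel : ℕ) : K :=
  Nat.rec (fun _ _ _ _ => false) (fun _ ih c A U st => bcond (Nat.beq c 0) (out A U st) (step p ih c A U st)) fuel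

def run (p : Par) (cs : List ℕ) : ℕ → ℕ → List (ℕ × ℕ) → Bool :=
  List.rec (fun _ _ _ => false) (fun c _ ih A U st => inner p ih 100 c A U st) cs

def Good (p : Par) (A U : ℕ) (st : List (ℕ × ℕ)) : Prop := Unsat p A U ∧ ∀ s ∈ st, Unsat p s.1 s.2

section
variable {p : Par}

theorem popK_sound {ih : ℕ → ℕ → List (ℕ × ℕ) → Bool} (hih : ∀ A U st, ih A U st = true → Good p A U st)
    {st : List (ℕ × ℕ)} (h : popK ih st = true) : ∀ s ∈ st, Unsat p s.1 s.2 := by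
  cases st with
  | nil => simp
  | cons s r =>
    change force s.1 (fun A => force s.2 fun U => ih A U r) = true at h
    simp only [force_eq] at h
    have := hih _ _ _ h
    intro t ht
    rcases List.mem_cons.1 ht with rfl | ht
    · exact this.1
    · exact this.2 t ht

theorem step_sound (ok : Ok p) (hD : HD p) {ih : K} (hih : ∀ c A U st, ih c A U st = true → Good p A U st)
    (c A U : ℕ) (st : List (ℕ × ℕ)) (h : step p ih c A U st = true) : Good p A U st := by
  unfold step at h
  simp only [force_eq] at h
  generalize Nat.mod c 8 = o at h
  generalize Nat.mod (Nat.shiftRight c 3) 32 = v at h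
  generalize Nat.mod (Nat.shiftRight c 8) 32 = w at h
  generalize Nat.shiftRight c 13 = c1 at h
  simp only [bcond_eq] at h
  have hp := fun c => popK_sound (p := p) (st := st) (hih c)
  split at h
  · split at h
    · simp at h
    rename_i hv
    rw [Nat.ble_eq, not_le] at hv
    split at h
    · rcases opRE_sound ok hv h with ⟨h1, h2⟩ | ⟨A', U', h1, h2⟩
      · exact ⟨h2, hp _ h1⟩
      · have := hih _ _ _ _ h1
        exact ⟨h2 this.1, this.2⟩
    split at h
    · rcases opNS_sound ok hv h with ⟨h1, h2⟩ | ⟨A', U', h1, h2⟩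
      · exact ⟨h2, hp _ h1⟩
      · have := hih _ _ _ _ h1
        exact ⟨h2 this.1, this.2⟩
    split at h
    · obtain ⟨A', U', h1, h2⟩ := opFO_sound ok hv h
      have := hih _ _ _ _ h1
      exact ⟨h2 this.1, this.2⟩
    split at h
    · simp at h
    rename_i hw
    rw [Nat.ble_eq, not_le] at hw
    split at h
    · rw [opAdd_eq] at h
      have := hih _ _ _ _ h
      exact ⟨br_sound ok hv hw this.1 (this.2 _ List.mem_cons_self), fun s hs => this.2 s (List.mem_cons_of_mem _ hs)⟩
    split at h
    · simp at h
    rename_i hne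
    rw [opAdd_eq] at h
    have := hih _ _ _ _ h
    exact ⟨bt_sound ok hv hw (by simpa using hne) this.1 (this.2 _ List.mem_cons_self),
      fun s hs => this.2 s (List.mem_cons_of_mem _ hs)⟩
  · split at h
    · have := opDE_sound (U := U) ok hD h
      exact ⟨this.2, hp _ this.1⟩
    · have := opCH_sound ok h
      exact ⟨this.2, hp _ this.1⟩

theorem inner_sound (ok : Ok p) (hD : HD p) {out : ℕ → ℕ → List (ℕ × ℕ) → Bool}
    (ho : ∀ A U st, out A U st = true → Good p A U st) (fuel : ℕ) :
    ∀ c A U st, inner p out fuel c A U st = true → Good p A U st := by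
  induction fuel with
  | zero => intro c A U st h; simp [inner] at h
  | succ k ih =>
    intro c A U st h
    change bcond (Nat.beq c 0) (out A U st) (step p (inner p out k) c A U st) = true at h
    rw [bcond_eq] at h
    split at h
    · exact ho _ _ _ h
    · exact step_sound ok hD ih _ _ _ _ h

theorem run_sound (ok : Ok p) (hD : HD p) (cs : List ℕ) :
    ∀ A U st, run p cs A U st = true → Good p A U st := by
  induction cs with
  | nil => intro A U st h; simp [run] at h
  | cons c cs ih =>
    intro A U st h
    exact inner_sound ok hD ih 100 c A U st h

end
end Eng

namespace Eng
open Finset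

section
variable {p : Par} {R : ℕ → ℕ → Prop}

theorem no_model (ok : Ok p) (hD : HD p) (cs : List ℕ) (U : ℕ)
    (hU : ∀ i < 31, ∀ j < 31, (row U i).testBit j = decide (i < p.n ∧ j < p.n ∧ i ≠ j))
    (h : run p cs 0 U [] = true) (M : Model p R) : False := by
  refine (run_sound ok hD cs 0 U [] h).1 R M ?_
  have hz : ∀ i j, ¬ j ∈ bits (row 0 i) := by
    intro i j hj
    rw [mem_bits] at hj
    rw [row_testBit hj.1] at hj; simp at hj
  have hm : ∀ i j, i < 31 → (j ∈ bits (row U i) ↔ i < p.n ∧ j < p.n ∧ i ≠ j) := by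
    intro i j hi
    rw [mem_bits]
    constructor
    · rintro ⟨h1, h2⟩; rw [hU i hi j h1] at h2; simpa using h2
    · intro h
      have : j < 31 := by have := ok.n30; omega
      exact ⟨this, by rw [hU i hi j this]; simpa using h⟩
  refine ⟨fun i j _ h => (hz _ _ h).elim, ?_, fun i j _ h => (hz _ _ h).elim, ?_⟩
  · intro i j hi hj
    have := (hm i j hi).1 hj
    have hj31 := lt31 hj
    rw [hm j i hj31]; omega
  · intro i j hij
    right
    rw [hm i j (M.l31 ok _ _ hij)]
    refine ⟨M.ln _ _ hij, M.supp _ _ hij, ?_⟩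
    rintro rfl; exact M.irr _ hij

/-- double counting between two sets -/
theorem dc (F : Free R) (S T : Finset ℕ) : ∑ i ∈ S, (nb R T i).card = ∑ j ∈ T, (nb R S j).card := by
  classical
  have e : ∀ (A : Finset ℕ) i, (nb R A i).card = ∑ j ∈ A, if R i j then 1 else 0 := by
    intro A i
    rw [← Finset.card_filter]
    rfl
  simp only [e]
  rw [Finset.sum_comm]
  refine Finset.sum_congr rfl fun j _ => Finset.sum_congr rfl fun i _ => ?_
  simp only [show R i j ↔ R j i from ⟨F.sym _ _, F.sym _ _⟩]

theorem nb_split (R : ℕ → ℕ → Prop) (T S : Finset ℕ) (h : S ⊆ T) (i : ℕ) :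
    (nb R T i).card = (nb R (T \ S) i).card + (nb R S i).card := by
  classical
  rw [← Finset.card_union_of_disjoint]
  · congr 1
    ext j
    simp only [mem_nb, Finset.mem_union, Finset.mem_sdiff]
    constructor
    · rintro ⟨a, b⟩
      by_cases hj : j ∈ S
      · exact Or.inr ⟨hj, b⟩
      · exact Or.inl ⟨⟨a, hj⟩, b⟩
    · rintro (⟨a, b⟩ | ⟨a, b⟩)
      · exact ⟨a.1, b⟩
      · exact ⟨h a, b⟩
  · rw [Finset.disjoint_left]
    intro j h1 h2
    rw [mem_nb] at h1 h2
    exact (Finset.mem_sdiff.1 h1.1).2 h2.1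

theorem del (F : Free R) (T S : Finset ℕ) (h : S ⊆ T) :
    ∑ i ∈ T, (nb R T i).card + ∑ i ∈ S, (nb R S i).card =
      ∑ i ∈ T \ S, (nb R (T \ S) i).card + 2 * ∑ i ∈ S, (nb R T i).card := by
  have h1 : ∑ i ∈ T, (nb R T i).card = ∑ i ∈ T \ S, (nb R T i).card + ∑ i ∈ S, (nb R T i).card :=
    (Finset.sum_sdiff h).symm
  have h2 : ∑ i ∈ T \ S, (nb R T i).card = ∑ i ∈ T \ S, (nb R (T \ S) i).card + ∑ i ∈ T \ S, (nb R S i).card := by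
    rw [← Finset.sum_add_distrib]
    exact Finset.sum_congr rfl fun i _ => nb_split R T S h i
  have h3 : ∑ i ∈ S, (nb R T i).card = ∑ i ∈ S, (nb R (T \ S) i).card + ∑ i ∈ S, (nb R S i).card := by
    rw [← Finset.sum_add_distrib]
    exact Finset.sum_congr rfl fun i _ => nb_split R T S h i
  have h4 := dc F (T \ S) S
  omega

theorem even_sum (F : Free R) (T : Finset ℕ) : ∃ E, ∑ i ∈ T, (nb R T i).card = 2 * E := by
  classical
  induction T using Finset.induction_on with
  | empty => exact ⟨0, by simp⟩
  | insert a T ha ih =>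
    obtain ⟨E, ih⟩ := ih
    have h := del F (insert a T) {a} (by simp)
    have e : insert a T \ {a} = T := by
      ext x; simp only [Finset.mem_sdiff, Finset.mem_insert, Finset.mem_singleton]
      constructor
      · tauto
      · intro hx; exact ⟨Or.inr hx, by rintro rfl; exact ha hx⟩
    rw [e, ih] at h
    have : (nb R {a} a).card = 0 := by
      rw [Finset.card_eq_zero]
      apply Finset.eq_empty_of_forall_notMem
      intro x hx
      rw [mem_nb, Finset.mem_singleton] at hx
      rw [hx.1] at hx
      exact F.irr _ hx.2
    rw [Finset.sum_singleton, this] at h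
    exact ⟨E + ∑ i ∈ ({a} : Finset ℕ), (nb R (insert a T) i).card, by omega⟩

def FB (m b : ℕ) : Prop := ∀ R, Free R → ∀ T : Finset ℕ, T.card = m → ∑ i ∈ T, (nb R T i).card ≤ 2 * b

theorem del1 {m b : ℕ} (hb : FB m b) (F : Free R) {T : Finset ℕ} (hT : T.card = m + 1) {v : ℕ} (hv : v ∈ T) :
    ∑ i ∈ T, (nb R T i).card ≤ 2 * b + 2 * (nb R T v).card := by
  have h := del F T {v} (by simpa using hv)
  have h2 := hb R F (T \ {v}) (by rw [Finset.card_sdiff_of_subset (by simpa using hv), hT]; simp)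
  rw [Finset.sum_singleton] at h
  rw [Finset.sum_singleton] at h
  omega

def ff (m : ℕ) : ℕ := [0, 0, 0, 0, 0, 0, 0, 0, 10, 12, 15, 16, 18, 21, 23, 26, 28, 31, 34, 38, 41, 44, 47].getD m 0
def FA (n : ℕ) : Prop := ∀ m, 8 ≤ m → m < n → FB m (ff m)

theorem HD_of (hA : FA p.n) (hE : p.E2 = ∑ i ∈ Finset.range p.n, dg p i)
    (hc : ∀ k < p.n + 1, thr p k = 0 ∨ (0 < k ∧ 8 + k ≤ p.n ∧ 2 * thr p k + 2 * ff (p.n - k) ≤ p.E2)) : HD p := by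
  intro R M S hS
  have hk : S.card < p.n + 1 := by
    have := Finset.card_le_card hS
    rw [Finset.card_range] at this; omega
  have hd : ∀ i ∈ Finset.range p.n, (nb R (Finset.range p.n) i).card = dg p i := fun i hi =>
    M.deg i (Finset.mem_range.1 hi)
  rcases hc _ hk with h | ⟨h1, h2, h3⟩
  · have : ∑ i ∈ S, (nb R S i).card ≤ ∑ i ∈ S, dg p i := by
      apply Finset.sum_le_sum
      intro i hi
      rw [← hd i (hS hi)]
      apply Finset.card_le_card
      intro j hj
      rw [mem_nb] at hj ⊢
      exact ⟨hS hj.1, hj.2⟩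
    omega
  · have h := del M.toFree (Finset.range p.n) S hS
    rw [Finset.sum_congr rfl hd, ← hE, Finset.sum_congr rfl (fun i hi => hd i (hS hi))] at h
    have h4 := hA (p.n - S.card) (by omega) (by omega) R M.toFree (Finset.range p.n \ S) (by
      rw [Finset.card_sdiff_of_subset hS, Finset.card_range])
    change _ = _ + 2 * ∑ i ∈ S, dg p i at h
    omega

noncomputable def cnt (R : ℕ → ℕ → Prop) (T : Finset ℕ) (c : ℕ) : ℕ := (T.filter (fun t => (nb R T t).card = c)).card
def cntp (p : Par) (c : ℕ) : ℕ := ((Finset.range p.n).filter (fun i => dg p i = c)).card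

theorem relabel (p : Par) (F : Free R) (T : Finset ℕ) (hc : ∀ c, cnt R T c = cntp p c)
    (hns : ∀ i ∈ T, (nb R T i).card = 5 → (∀ j ∈ nb R T i, 4 ≤ (nb R T j).card) →
      ((nb R T i).filter (fun j => 5 ≤ (nb R T j).card)).card ≤ p.tau) : ∃ R', Model p R' := by
  classical
  let f : {i // i ∈ Finset.range p.n} → ℕ := fun i => dg p i
  let g : {i // i ∈ T} → ℕ := fun i => (nb R T i).card
  have hfe : ∀ c, Nonempty ({a // f a = c} ≃ {b // g b = c}) := by
    intro c
    refine ⟨Fintype.equivOfCardEq ?_⟩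
    have h1 : Fintype.card {a // f a = c} = cntp p c := by
      rw [Fintype.card_subtype, cntp, Finset.card_filter, Finset.card_filter, ← Finset.sum_coe_sort (Finset.range p.n)]
    have h2 : Fintype.card {a // g a = c} = cnt R T c := by
      rw [Fintype.card_subtype, cnt, Finset.card_filter, Finset.card_filter, ← Finset.sum_coe_sort T]
    rw [h1, h2, hc]
  let e := Equiv.ofFiberEquiv (f := f) (g := g) (fun c => (hfe c).some)
  have he : ∀ a, (nb R T (e a)).card = dg p a := fun a =>
    Equiv.ofFiberEquiv_map (f := f) (g := g) (fun c => (hfe c).some) a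
  let R' : ℕ → ℕ → Prop := fun i j => ∃ (hi : i ∈ Finset.range p.n) (hj : j ∈ Finset.range p.n), R (e ⟨i, hi⟩) (e ⟨j, hj⟩)
  have hnb : ∀ i (hi : i ∈ Finset.range p.n), ∀ (P : ℕ → Prop) [DecidablePred P],
      ((nb R' (Finset.range p.n) i).filter (fun j => P (dg p j))).card =
      ((nb R T (e ⟨i, hi⟩)).filter (fun j => P (nb R T j).card)).card := by
    intro i hi P _
    apply Finset.card_bij' (fun j _ => if hj : j ∈ Finset.range p.n then (e ⟨j, hj⟩ : ℕ) else 0)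
      (fun j _ => if hj : j ∈ T then (e.symm ⟨j, hj⟩ : ℕ) else 0)
    · intro j hj
      rw [Finset.mem_filter, mem_nb] at hj
      obtain ⟨⟨hj1, h1, h2, h3⟩, h4⟩ := hj
      rw [dif_pos hj1, Finset.mem_filter, mem_nb, he]
      exact ⟨⟨(e _).2, h3⟩, h4⟩
    · intro j hj
      rw [Finset.mem_filter, mem_nb] at hj
      obtain ⟨⟨hj1, h1⟩, h4⟩ := hj
      rw [dif_pos hj1, Finset.mem_filter, mem_nb]
      have := he (e.symm ⟨j, hj1⟩)
      rw [Equiv.apply_symm_apply] at this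
      refine ⟨⟨(e.symm _).2, hi, (e.symm _).2, ?_⟩, ?_⟩
      · simpa using h1
      · rw [← this]; exact h4
    · intro j hj
      rw [Finset.mem_filter, mem_nb] at hj
      simp [hj.1.1]
    · intro j hj
      rw [Finset.mem_filter, mem_nb] at hj
      simp [hj.1.1]
  have hinj : ∀ a b, (e a : ℕ) = e b → (a : ℕ) = b := by
    intro a b h
    exact congrArg Subtype.val (e.injective (Subtype.ext h))
  refine ⟨R', ⟨⟨?_, ?_, ?_, ?_⟩, ?_, ?_, ?_⟩⟩
  · rintro i j ⟨h1, h2, h3⟩; exact ⟨h2, h1, F.sym _ _ h3⟩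
  · rintro i ⟨h1, h2, h3⟩; exact F.irr _ h3
  · rintro i j k ⟨h1, h2, h3⟩ ⟨_, h5, h6⟩ ⟨_, _, h9⟩; exact F.tri _ _ _ h3 h6 h9
  · rintro a b x y ⟨h1, h2, h3⟩ ⟨_, h5, h6⟩ ⟨h7, _, h9⟩ ⟨_, _, h12⟩ hxy
    exact hinj _ _ (F.c4 _ _ _ _ h3 h6 h9 h12 (fun h => hxy (hinj _ _ h)))
  · rintro i j ⟨h1, h2, h3⟩; exact Finset.mem_range.1 h2
  · intro i hi
    have := hnb i (Finset.mem_range.2 hi) (fun _ => True)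
    rw [Finset.filter_true, Finset.filter_true, he] at this
    exact this
  · intro i hi h5 h4
    have hi' := Finset.mem_range.2 hi
    rw [hnb i hi' (fun c => 5 ≤ c)]
    apply hns _ (e _).2
    · rw [he]; exact h5
    · intro j hj
      rw [mem_nb] at hj
      have h6 := he (e.symm ⟨j, hj.1⟩)
      rw [Equiv.apply_symm_apply] at h6
      rw [show (nb R T j).card = _ from h6]
      apply h4
      exact ⟨hi', (e.symm _).2, by simpa using hj.2⟩

/-- everything that has to be checked about the parameters -/
def PC (p : Par) (U : ℕ) : Prop :=
  (p.n ≤ 30 ∧ p.dmin + p.m < 8 ∧ p.top < 2 ^ p.n ∧ p.E2 = ∑ i ∈ Finset.range p.n, dg p i) ∧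
  (∀ t < 8, ∀ i < 31, (lt p t).testBit i = decide (i < p.n ∧ dg p i < t)) ∧
  (∀ i < p.n, p.dmin ≤ dg p i ∧ dg p i ≤ p.dmin + p.m) ∧
  (∀ k < p.n + 1, thr p k = 0 ∨ (0 < k ∧ 8 + k ≤ p.n ∧ 2 * thr p k + 2 * ff (p.n - k) ≤ p.E2)) ∧
  (∀ i < 31, ∀ j < 31, (row U i).testBit j = decide (i < p.n ∧ j < p.n ∧ i ≠ j))

instance (p : Par) (U : ℕ) : Decidable (PC p U) := by unfold PC; infer_instance

theorem kill (p : Par) (U : ℕ) (hp : PC p U) (cs : List ℕ) (h : run p cs 0 U [] = true) (hA : FA p.n)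
    (F : Free R) (T : Finset ℕ) (hc : ∀ c, cnt R T c = cntp p c)
    (hns : ∀ i ∈ T, (nb R T i).card = 5 → (∀ j ∈ nb R T i, 4 ≤ (nb R T j).card) →
      ((nb R T i).filter (fun j => 5 ≤ (nb R T j).card)).card ≤ p.tau) : False := by
  obtain ⟨⟨h1, h2, h3, h4⟩, h5, h6, h7, h8⟩ := hp
  obtain ⟨R', M⟩ := relabel p F T hc hns
  exact no_model ⟨h1, h5, h4, h6, h2, h3⟩ (HD_of hA h4 h7) cs U h8 h M

end
end Eng

namespace Eng
open Finset

def Uo (n : ℕ) : ℕ := sumN (fun i => Nat.shiftLeft (Nat.xor (Nat.sub (Nat.pow 2 n) 1) (Nat.shiftLeft 1 i)) (Nat.mul 32 i)) n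

def NS (R : ℕ → ℕ → Prop) (T : Finset ℕ) (tau : ℕ) : Prop :=
  ∀ i ∈ T, (nb R T i).card = 5 → (∀ j ∈ nb R T i, 4 ≤ (nb R T j).card) →
      ((nb R T i).filter (fun j => 5 ≤ (nb R T j).card)).card ≤ tau

theorem NS9 (R : ℕ → ℕ → Prop) (T : Finset ℕ) : NS R T 9 := by
  intro i _ h _
  have := Finset.card_filter_le (nb R T i) (fun j => 5 ≤ (nb R T j).card)
  omega

def Dead (n tau c2 c3 c4 c5 c6 : ℕ) : Prop := FA n → ∀ R, Free R → ∀ T : Finset ℕ,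
  (∀ t ∈ T, 2 ≤ (nb R T t).card ∧ (nb R T t).card ≤ 6) → cnt R T 2 = c2 → cnt R T 3 = c3 → cnt R T 4 = c4 →
  cnt R T 5 = c5 → cnt R T 6 = c6 → NS R T tau → False

theorem dead_of {n tau c2 c3 c4 c5 c6 : ℕ} (p : Par) (cs : List ℕ) (h : run p cs 0 (Uo p.n) [] = true)
    (hp : PC p (Uo p.n) ∧ (∀ i < p.n, 2 ≤ dg p i ∧ dg p i ≤ 6) ∧ p.n = n ∧ p.tau = tau ∧ cntp p 2 = c2 ∧
      cntp p 3 = c3 ∧ cntp p 4 = c4 ∧ cntp p 5 = c5 ∧ cntp p 6 = c6) :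
    Dead n tau c2 c3 c4 c5 c6 := by
  obtain ⟨hp1, hp2, rfl, rfl, rfl, rfl, rfl, rfl, rfl⟩ := hp
  intro hA R F T hT h2 h3 h4 h5 h6 hns
  refine kill p (Uo p.n) hp1 cs h hA F T ?_ hns
  intro c
  by_cases hc : 2 ≤ c ∧ c ≤ 6
  · obtain ⟨ha, hb⟩ := hc
    interval_cases c <;> assumption
  · rw [cnt, cntp, Finset.card_eq_zero.2, Finset.card_eq_zero.2]
    · rw [Finset.filter_eq_empty_iff]
      intro i hi he
      have := hp2 i (Finset.mem_range.1 hi); omega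
    · rw [Finset.filter_eq_empty_iff]
      intro i hi he
      have := hT i hi; omega

section
variable {R : ℕ → ℕ → Prop}

theorem counts (T : Finset ℕ) (hT : ∀ t ∈ T, 2 ≤ (nb R T t).card ∧ (nb R T t).card ≤ 6) (f : ℕ → ℕ) :
    ∑ t ∈ T, f (nb R T t).card = cnt R T 2 * f 2 + cnt R T 3 * f 3 + cnt R T 4 * f 4 + cnt R T 5 * f 5 + cnt R T 6 * f 6 := by
  have h := Finset.sum_fiberwise_of_maps_to (s := T) (t := ({2,3,4,5,6} : Finset ℕ)) (g := fun t => (nb R T t).card)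
    (by intro t ht
        obtain ⟨h1, h2⟩ := hT t ht
        simp only [Finset.mem_insert, Finset.mem_singleton]; omega) (fun t => f (nb R T t).card)
  rw [← h]
  have e : ∀ c, ∑ i ∈ T with (nb R T i).card = c, f (nb R T i).card = cnt R T c * f c := by
    intro c
    rw [Finset.sum_congr rfl (g := fun _ => f c), Finset.sum_const, cnt, smul_eq_mul]
    intro x hx
    rw [(Finset.mem_filter.1 hx).2]
  simp only [e]
  simp [add_assoc]

theorem cnt_zero {T : Finset ℕ} {c : ℕ} (h : ∀ t ∈ T, (nb R T t).card ≠ c) : cnt R T c = 0 := by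
  rw [cnt, Finset.card_eq_zero, Finset.filter_eq_empty_iff]
  intro t ht; exact h t ht

theorem moore (F : Free R) (T : Finset ℕ) : ∑ t ∈ T, (nb R T t).card ^ 2 ≤ T.card * (T.card - 1) := by
  have := cherry F T T
  rw [← Finset.sum_add_distrib] at this
  refine le_trans (le_of_eq (Finset.sum_congr rfl fun t _ => ?_)) this
  rcases (nb R T t).card with _ | k
  · rfl
  · simp; ring

theorem moore2 (F : Free R) (T : Finset ℕ) : (∑ t ∈ T, (nb R T t).card) ^ 2 ≤ T.card * (T.card * (T.card - 1)) :=
  le_trans sq_sum_le_card_mul_sum_sq (Nat.mul_le_mul_left _ (moore F T))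

theorem deg_mul (F : Free R) {T : Finset ℕ} {lo v : ℕ} (hv : v ∈ T) (hlo : ∀ t ∈ T, lo ≤ (nb R T t).card) :
    (nb R T v).card * lo < T.card := by
  refine lt_of_le_of_lt ?_ (nbr_sumF F T hv)
  rw [← smul_eq_mul]
  exact Finset.card_nsmul_le_sum _ _ _ fun t ht => hlo t (mem_nb.1 ht).1

/-- basic facts for the inductive step -/
theorem basic {m b : ℕ} (hb : FB m b) (F : Free R) {T : Finset ℕ} (hT : T.card = m + 1) :
    ∃ E, ∑ t ∈ T, (nb R T t).card = 2 * E ∧ (∀ t ∈ T, E - b ≤ (nb R T t).card) ∧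
      (m + 1) * (E - b) ≤ 2 * E ∧ ∀ t ∈ T, (nb R T t).card * (E - b) ≤ m := by
  obtain ⟨E, hE⟩ := even_sum F T
  have h1 : ∀ t ∈ T, E - b ≤ (nb R T t).card := by
    intro t ht
    have := del1 hb F hT ht
    omega
  refine ⟨E, hE, h1, ?_, ?_⟩
  · rw [← hE, ← hT, ← smul_eq_mul]
    exact Finset.card_nsmul_le_sum _ _ _ h1
  · intro t ht
    have := deg_mul F ht h1
    omega

theorem FA_succ {m : ℕ} (hA : FA m) (h : FA m → FB m (ff m)) : FA (m + 1) := by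
  intro k h9 hk
  rcases Nat.lt_succ_iff_lt_or_eq.1 hk with h1 | rfl
  · exact hA k h9 h1
  · exact h hA

end
end Eng

namespace Eng
set_option maxRecDepth 100000
set_option maxHeartbeats 4000000
def pz0_0_14_8_0 : Par := ⟨22, 0x4444444444444455555555, 4, 1, 9, 0x262421201e1b191614110e0a070400, 0xff, 96, 0x3fffff003fffff003fff000000000000000000000000000000000000000000⟩
def kz0_0_14_8_0 : List ℕ := [80569681256513214348902645827910194502282708431146817177889954350654876295314936462578070785110091861637845782234571742746589544272020130114, 11629727997203148006292896889808515075565786186169424250258455258456242061772842640714578853922309290316085598063843230832165225917132775525, 32730549200565124977177212185819975306595264916274544970731917600758813359370708099935675558116018087140378695560101912738573463805321339, 413274674341006733465920563403730204002834060871101028888990270341872924690882642367720709811234799059656626836174540570882070470888586770438, 119009779453858412911955092879682315959430882696554557471654324706887148349246864146447256627407216431687346670992156493188547453077114601565, 102162384243356095265483353450304682553112522098497322958792693913839997380752103890642474815621814332578879576508680011375487196080995541003, 149802303006807749284511799571601878111595782253372933050798955492455173819332888942388343355842233247221368769021871255395316425186940568906, 61013133028198608031629594681919]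
theorem z0_0_14_8_0 : Dead 22 9 0 0 14 8 0 := dead_of pz0_0_14_8_0 kz0_0_14_8_0 (by decide +kernel) (by decide +kernel)
def pz0_0_15_6_0 : Par := ⟨21, 0x444444444444444555555, 4, 1, 9, 0x23211e1d1b181613110e0b070400, 0x3f, 90, 0x1fffff001fffff001fffc00000000000000000000000000000000000000000⟩
def kz0_0_15_6_0 : List ℕ := [1285500531260562234415464216716445661523417853116505642420495619]
theorem z0_0_15_6_0 : Dead 21 9 0 0 15 6 0 := dead_of pz0_0_15_6_0 kz0_0_15_6_0 (by decide +kernel) (by decide +kernel)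
def pz0_10_1_0_0 : Par := ⟨11, 0x33333333334, 3, 1, 9, 0x7050200, 0x1, 34, 0x7ff000007ff000007ff000007fe00000000000000000000000000000000⟩
def kz0_10_1_0_0 : List ℕ := [3]
theorem z0_10_1_0_0 : Dead 11 9 0 10 1 0 0 := dead_of pz0_10_1_0_0 kz0_10_1_0_0 (by decide +kernel) (by decide +kernel)
def pz0_10_2_4_0 : Par := ⟨16, 0x3333333333445555, 3, 2, 9, 0x13110e0d0b08060300, 0xf, 58, 0xffff0000ffff0000fff00000ffc000000000000000000000000000000000⟩
def kz0_10_2_4_0 : List ℕ := [551]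
theorem z0_10_2_4_0 : Dead 16 9 0 10 2 4 0 := dead_of pz0_10_2_4_0 kz0_10_2_4_0 (by decide +kernel) (by decide +kernel)
def pz0_11_0_5_0 : Par := ⟨16, 0x3333333333355555, 3, 2, 9, 0x13110e0d0b08060300, 0x1f, 58, 0xffff0000ffff0000ffe00000ffe000000000000000000000000000000000⟩
def kz0_11_0_5_0 : List ℕ := [767]
theorem z0_11_0_5_0 : Dead 16 9 0 11 0 5 0 := dead_of pz0_11_0_5_0 kz0_11_0_5_0 (by decide +kernel) (by decide +kernel)
def pz0_2_13_6_2 : Par := ⟨23, 0x33444444444444455555566, 3, 3, 9, 0x28262322201d1b181613100c09060300, 0xff, 100, 0x7fffff007ffffc007fff000060000000000000000000000000000000000000⟩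
def kz0_2_13_6_2 : List ℕ := [60874464398944858959579610965251]
theorem z0_2_13_6_2 : Dead 23 9 0 2 13 6 2 := dead_of pz0_2_13_6_2 kz0_2_13_6_2 (by decide +kernel) (by decide +kernel)
def pz0_2_14_4_3 : Par := ⟨23, 0x33444444444444445555666, 3, 3, 9, 0x28262322201d1b181613100c09060300, 0x7f, 100, 0x7fffff007ffff8007fff800060000000000000000000000000000000000000⟩
def kz0_2_14_4_3 : List ℕ := [498683652275913018308538304309585155]
theorem z0_2_14_4_3 : Dead 23 9 0 2 14 4 3 := dead_of pz0_2_14_4_3 kz0_2_14_4_3 (by decide +kernel) (by decide +kernel)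
def pz0_2_15_2_4 : Par := ⟨23, 0x33444444444444444556666, 3, 3, 9, 0x28262322201d1b181613100c09060300, 0x3f, 100, 0x7fffff007ffff0007fffc00060000000000000000000000000000000000000⟩
def kz0_2_15_2_4 : List ℕ := [421749894243587]
theorem z0_2_15_2_4 : Dead 23 9 0 2 15 2 4 := dead_of pz0_2_15_2_4 kz0_2_15_2_4 (by decide +kernel) (by decide +kernel)
def pz0_2_16_0_5 : Par := ⟨23, 0x33444444444444444466666, 3, 3, 9, 0x28262322201d1b181613100c09060300, 0x1f, 100, 0x7fffff007fffe0007fffe00060000000000000000000000000000000000000⟩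
def kz0_2_16_0_5 : List ℕ := [51483075843]
theorem z0_2_16_0_5 : Dead 23 9 0 2 16 0 5 := dead_of pz0_2_16_0_5 kz0_2_16_0_5 (by decide +kernel) (by decide +kernel)
def pz0_3_10_9_1 : Par := ⟨23, 0x33344444444445555555556, 3, 3, 9, 0x28262322201d1b181613100c09060300, 0x3ff, 100, 0x7fffff007ffffe007ffc000070000000000000000000000000000000000000⟩
def kz0_3_10_9_1 : List ℕ := [48578988022998706265094257604880644975973812974475826117263448814732626602829812614191749114364138145531351101851634149490055685341311947778, 119019308508591260170680420352459256039966080817551489670216273663833587848430052952213948541091472239543601676289737929292551526813291078911, 6433968315021376033629974251311219436121865050858136088252225031478874859683131003577288978441974434542933771648771689023965439813478473813, 206374713291513908672692620362578873803443811837288868612631420297999421279029876291070474618814494730606698373079888597091868525327831664774, 119009858454358440291376944206702982198523664084141469952852694486252333920135697718608951567332355931707923444606482304475582184507545436730, 668377700248770805331302767211571077793300241938005240586667975524717136086932905946526819796755405228599974941859323877408826716848681806354, 10713591677562849588932022532208807290206145454425845222868085121876761400539888095475112183008705411226380683793703038932756635695217369147, 144495737526574466781063693488826660746975017159685558395190467216188388239298199383512215515808392593050783075834739610788175503814634135667,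 666879322185568524180965829462011451043140644317508553517812653712697985018988430397740049720312526494289408544521479175698979407928083080978, 193714530988068455389962053593736447059709814531493745704986388557410550391578370550286877493421349074330758185324316650813069892406772780578, 168440719519677969514474353485152739400554905811904342473894195208693373264666947168573831337845424775187992788827842374808444544417913922815, 119018583356967305479559646015738649350004050383632764432632295300750231092376033141818730520138442267238816623610658100162719187114240649234, 119012688428205350547254601818640447663011716905062597435087971750722286472912218500605229784173623790926040985272723723027690624941614576146, 3483400184865719453928751089312660878374600966153806132099747260983082892156541266343162903566764797738683809181108517289761374090622490121, 331122135699151390081775390585274879026936878417035302207069209452719462430197109137084853639770652235832587986499263602193836590366870, 7566108786971774649219020434831442828013229983511738705777489108682656628021210700254348239936064003696955276253986886]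
theorem z0_3_10_9_1 : Dead 23 9 0 3 10 9 1 := dead_of pz0_3_10_9_1 kz0_3_10_9_1 (by decide +kernel) (by decide +kernel)
def pz0_3_11_7_2 : Par := ⟨23, 0x33344444444444555555566, 3, 3, 9, 0x28262322201d1b181613100c09060300, 0x1ff, 100, 0x7fffff007ffffc007ffe000070000000000000000000000000000000000000⟩
def kz0_3_11_7_2 : List ℕ := [14261330638492591536600644006043893334139749891]
theorem z0_3_11_7_2 : Dead 23 9 0 3 11 7 2 := dead_of pz0_3_11_7_2 kz0_3_11_7_2 (by decide +kernel) (by decide +kernel)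
def pz0_3_12_5_3 : Par := ⟨23, 0x33344444444444455555666, 3, 3, 9, 0x28262322201d1b181613100c09060300, 0xff, 100, 0x7fffff007ffff8007fff000070000000000000000000000000000000000000⟩
def kz0_3_12_5_3 : List ℕ := [93444794393236821638198650085984131747580559320579]
theorem z0_3_12_5_3 : Dead 23 9 0 3 12 5 3 := dead_of pz0_3_12_5_3 kz0_3_12_5_3 (by decide +kernel) (by decide +kernel)
def pz0_3_13_3_4 : Par := ⟨23, 0x33344444444444445556666, 3, 3, 9, 0x28262322201d1b181613100c09060300, 0x7f, 100, 0x7fffff007ffff0007fff800070000000000000000000000000000000000000⟩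
def kz0_3_13_3_4 : List ℕ := [573937813061159765424146502563980930448372567350797827]
theorem z0_3_13_3_4 : Dead 23 9 0 3 13 3 4 := dead_of pz0_3_13_3_4 kz0_3_13_3_4 (by decide +kernel) (by decide +kernel)
def pz0_3_14_1_5 : Par := ⟨23, 0x33344444444444444566666, 3, 3, 9, 0x28262322201d1b181613100c09060300, 0x3f, 100, 0x7fffff007fffe0007fffc00070000000000000000000000000000000000000⟩
def kz0_3_14_1_5 : List ℕ := [37526529539]
theorem z0_3_14_1_5 : Dead 23 9 0 3 14 1 5 := dead_of pz0_3_14_1_5 kz0_3_14_1_5 (by decide +kernel) (by decide +kernel)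
def pz0_4_10_6_3 : Par := ⟨23, 0x33334444444444555555666, 3, 3, 9, 0x28262322201d1b181613100c09060300, 0x1ff, 100, 0x7fffff007ffff8007ffe000078000000000000000000000000000000000000⟩
def kz0_4_10_6_3 : List ℕ := [1392648111535246725832289744289446282420482]
theorem z0_4_10_6_3 : Dead 23 9 0 4 10 6 3 := dead_of pz0_4_10_6_3 kz0_4_10_6_3 (by decide +kernel) (by decide +kernel)
def pz0_4_11_4_4 : Par := ⟨23, 0x33334444444444455556666, 3, 3, 9, 0x28262322201d1b181613100c09060300, 0xff, 100, 0x7fffff007ffff0007fff000078000000000000000000000000000000000000⟩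
def kz0_4_11_4_4 : List ℕ := [4083907615633580719592355796983362896026]
theorem z0_4_11_4_4 : Dead 23 9 0 4 11 4 4 := dead_of pz0_4_11_4_4 kz0_4_11_4_4 (by decide +kernel) (by decide +kernel)
def pz0_4_12_2_5 : Par := ⟨23, 0x33334444444444445566666, 3, 3, 9, 0x28262322201d1b181613100c09060300, 0x7f, 100, 0x7fffff007fffe0007fff800078000000000000000000000000000000000000⟩
def kz0_4_12_2_5 : List ℕ := [11339253306543295014138630509716738]
theorem z0_4_12_2_5 : Dead 23 9 0 4 12 2 5 := dead_of pz0_4_12_2_5 kz0_4_12_2_5 (by decide +kernel) (by decide +kernel)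
def pz0_4_13_0_6 : Par := ⟨23, 0x33334444444444444666666, 3, 3, 9, 0x28262322201d1b181613100c09060300, 0x3f, 100, 0x7fffff007fffc0007fffc00078000000000000000000000000000000000000⟩
def kz0_4_13_0_6 : List ℕ := [767]
theorem z0_4_13_0_6 : Dead 23 9 0 4 13 0 6 := dead_of pz0_4_13_0_6 kz0_4_13_0_6 (by decide +kernel) (by decide +kernel)
def pz0_4_8_10_1 : Par := ⟨23, 0x33334444444455555555556, 3, 3, 9, 0x28262322201d1b181613100c09060300, 0x7ff, 100, 0x7fffff007ffffe007ff8000078000000000000000000000000000000000000⟩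
def kz0_4_8_10_1 : List ℕ := [60855043052590478277504210583706]
theorem z0_4_8_10_1 : Dead 23 9 0 4 8 10 1 := dead_of pz0_4_8_10_1 kz0_4_8_10_1 (by decide +kernel) (by decide +kernel)
def pz0_4_9_8_2 : Par := ⟨23, 0x33334444444445555555566, 3, 3, 9, 0x28262322201d1b181613100c09060300, 0x3ff, 100, 0x7fffff007ffffc007ffc000078000000000000000000000000000000000000⟩
def kz0_4_9_8_2 : List ℕ := [25944370854829068666976454702031362]
theorem z0_4_9_8_2 : Dead 23 9 0 4 9 8 2 := dead_of pz0_4_9_8_2 kz0_4_9_8_2 (by decide +kernel) (by decide +kernel)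
def pz0_6_10_0_0 : Par := ⟨16, 0x3333334444444444, 3, 1, 9, 0x13110e0d0b08060300, 0x3ff, 58, 0xffff0000ffff0000ffff0000fc0000000000000000000000000000000000⟩
def kz0_6_10_0_0 : List ℕ := [1767955752153954860186568380855935965951181829634792536379133964737911526434666160556047236887781278757846082587800646531247963410494704466, 151927248625272108339239795854658370707042441005808451710363826543913061471998596048529488630137575380969315273623186876246176186057072199697, 335151357759271978796859120064828104171426236407115478818176951300970782929177726272706032251848833635871153386574933737632661333302458073649, 25115645389718738564580222742494933879743335915205853156236027115784567281491501197936019316774]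
theorem z0_6_10_0_0 : Dead 16 9 0 6 10 0 0 := dead_of pz0_6_10_0_0 kz0_6_10_0_0 (by decide +kernel) (by decide +kernel)
def pz0_7_8_1_0 : Par := ⟨16, 0x3333333444444445, 3, 2, 9, 0x13110e0d0b08060300, 0x1, 58, 0xffff0000ffff0000fffe0000fe0000000000000000000000000000000000⟩
def kz0_7_8_1_0 : List ℕ := [13762671709576852034187323149230433890008096973919002172941752352652919566159449267813381832100162111030275]
theorem z0_7_8_1_0 : Dead 16 9 0 7 8 1 0 := dead_of pz0_7_8_1_0 kz0_7_8_1_0 (by decide +kernel) (by decide +kernel)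
def pz0_8_6_0_0 : Par := ⟨14, 0x33333333444444, 3, 1, 9, 0xe0c0908060300, 0x3f, 48, 0x3fff00003fff00003fff00003fc000000000000000000000000000000000⟩
def kz0_8_6_0_0 : List ℕ := [150963108902622423153083490382846109177462619573862738741042]
theorem z0_8_6_0_0 : Dead 14 9 0 8 6 0 0 := dead_of pz0_8_6_0_0 kz0_8_6_0_0 (by decide +kernel) (by decide +kernel)
def pz0_8_6_2_0 : Par := ⟨16, 0x3333333344444455, 3, 2, 9, 0x13110e0d0b08060300, 0x3, 58, 0xffff0000ffff0000fffc0000ff0000000000000000000000000000000000⟩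
def kz0_8_6_2_0 : List ℕ := [51480978435]
theorem z0_8_6_2_0 : Dead 16 9 0 8 6 2 0 := dead_of pz0_8_6_2_0 kz0_8_6_2_0 (by decide +kernel) (by decide +kernel)
def pz0_9_4_3_0 : Par := ⟨16, 0x3333333334444555, 3, 2, 9, 0x13110e0d0b08060300, 0x7, 58, 0xffff0000ffff0000fff80000ff8000000000000000000000000000000000⟩
def kz0_9_4_3_0 : List ℕ := [421732712276995]
theorem z0_9_4_3_0 : Dead 16 9 0 9 4 3 0 := dead_of pz0_9_4_3_0 kz0_9_4_3_0 (by decide +kernel) (by decide +kernel)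
def pz1_8_2_0_0 : Par := ⟨11, 0x23333333344, 2, 2, 9, 0x7050200, 0x3, 34, 0x7ff000007ff000007ff000007fc00000400000000000000000000000000⟩
def kz1_8_2_0_0 : List ℕ := [3]
theorem z1_8_2_0_0 : Dead 11 9 1 8 2 0 0 := dead_of pz1_8_2_0_0 kz1_8_2_0_0 (by decide +kernel) (by decide +kernel)
def pz1_9_0_1_0 : Par := ⟨11, 0x23333333335, 2, 3, 9, 0x7050200, 0x1, 34, 0x7ff000007ff000007fe000007fe00000400000000000000000000000000⟩
def kz1_9_0_1_0 : List ℕ := [3]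
theorem z1_9_0_1_0 : Dead 11 9 1 9 0 1 0 := dead_of pz1_9_0_1_0 kz1_9_0_1_0 (by decide +kernel) (by decide +kernel)
def pz2_6_3_0_0 : Par := ⟨11, 0x22333333444, 2, 2, 9, 0x7050200, 0x7, 34, 0x7ff000007ff000007ff000007f800000600000000000000000000000000⟩
def kz2_6_3_0_0 : List ℕ := [12294]
theorem z2_6_3_0_0 : Dead 11 9 2 6 3 0 0 := dead_of pz2_6_3_0_0 kz2_6_3_0_0 (by decide +kernel) (by decide +kernel)
def pa0 : Par := ⟨23, 0x44444444444444455555555, 4, 1, 0, 0x28262322201d1b181613100c09060300, 0xff, 100, 0x7fffff007fffff007fff000000000000000000000000000000000000000000⟩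
def ka0 : List ℕ := [47186933485530123436036]
theorem a0 : Dead 23 0 0 0 15 8 0 := dead_of pa0 ka0 (by decide +kernel) (by decide +kernel)
def pa1 : Par := ⟨23, 0x34555544444444445445555, 3, 2, 1, 0x28262322201d1b181613100c09060300, 0x1e004f, 100, 0x7fffff007fffff0061ffb00040000000000000000000000000000000000000⟩
def ka1 : List ℕ := [382654637954152408367508520469341399982445015512725750813473532930259014262982582140066647659065770741651169989500817257779421158895586265522, 370869663654678370934156770856783943385503213558865760278303646192773645468982880993282495807771183606917284832272025215829934519368410501158, 372443982008033642606713617223206937770929611830646818576822956919829717762232759599472092921943461485690820053471977065899840133434278290, 83546352309464504727132533321516702098397905998185641840766776361690390820777172011444486871876336244412611793859279511080908737897488925722, 361928456967128408480293954499175951795084129344562001625135225109447307640621866531737757870458844542507600514948577214916120498122797912134, 15166637251396004465915772113611725489004971254753381545404920462021656178764963019654674308478496909814743239193058472247321928478962533762, 2605319375494773614765832639787842680783977300398429428135109077950789939041249202060949319687914778444046276419026077479684168830021705875, 59776176349270413321399421001729773167905159327663896330976504579214633484266558706165607910739123148105908767958901292357061294081698845297, 9840573838892933330561737091158706905544836235625588152689529339685456568247780281827622406835553574816581135224953106616008316692742274,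 35173990700747142995729621388488766472322171559235237217648731853431141499115809483220446844990787194982653671801305851256295661194743878, 104432965948554891680693469712022785215525882956456516085976327662752923811170367319823790692933814942779524607744388859656463485870255149254, 371599502062386898454543421247337729719867859081402912489055307896207152533323740901519371976025538479210153414668038227972258231081194000518, 2605291218347776147192654389391442642091995525901643233641026225276642905371182130988386505232890023392407541496763380918036108030909827610, 132681706403543534663142781926453144312356915036945528318049422939307309880666484940571646942639291062508748943069956088582782549998300258331, 390422942758369025708809168580190865430329150814089188676930488981460163875449068810754875687370622873942439688657153619304845069070324760722, 14278226833416455857277551775340312527177553327361165135654560124983050011346079941026156337716752584142875804800135665806908174049833541763, 1953958297519462598125910706721198397958862861913455303045754309779358485649196962861446300035022328476791060331201724523292248788107821212, 4746563719948367701826475219163893033120747492878479623613080811627498452084685662768266398396156192648453122373090849387357186470341399145, 14248936767386139317169385836058243948643394965584903487102846666365443143689487623074646402120749738303261351583963636334095380754997854259, 4746589127179322143581636332744174599544932276555569025578617280277410827936785549087437509862505113272060337291962781655474177566294859780, 382791638224597119523500303901078494689344437229154954622920643622883298732261545684566465734321908087316917001760850965862458705792379666483, 420388044897621560138399258195083681616422636285141504773733288651608429483260796353320228888529393713726835735219267363572994394972179,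 6303199370482784166122176090023839338395237111560211843842218825517274900082981048340704318543620472231172055615736485665787594436090304646, 118992800504975197030359156012671448256470344340256560208157563707949354145693937851319551562714253130231549771999419195496849785834413645891, 316913219488780532652651971612394311628375579372514895254639611564523318501964567199200666134687073111822320860847047404825847746771304547, 513673111607144697578182938525725365444510629458629369742111499171711226706485163201240884698470670724886386070910385733230256172404693819397, 14515264817300131757719966820054004843365057372107796882516210477293081918861307001737239723759443197896482023734180752990887075529709683090, 2605581678947403046458406487347145702212268529316903255686656710418101780264225065794596833582075913568859604964827056548736707322348527771, 14608311530888052048456944250811191061258423661041899551888560895859287893680687983790269347990750489487996154515922891418213997933324815922, 342589916318123774841102160009768630630636354461642348078789114655947634712433198000562913387963918437815970864492367715370476530057582170138, 338128853358309446482331657499613513982113352966103108366427577957635222337656954714317774583431001766914442436217922966430436430064407711750, 118992449268717092288370713222334027521086323060324159536479829177699516406543688643133006727703675946403522176255031300755740403710085059426, 2512261306937094545834477444916101895872532958726057369801063671466835056159693764052258663892299591544065009901071475589116593285838857471, 166937433559187455386810350968676722723920695875016474707743046099843801457876960557494786326591212733700631216490548538015996652142879482003, 26245084116540158462248628932855594343496177306764767031644558281469806671738960594279908543504182070079647088801891562809810087801258266370,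 2532602850068691942713523729738693495390550411458557490001927297239672477021923212024837103823081361191532306033871123147134021345715904540, 2614283513836148181761814748050507028912742352916050384348008565276392131960707275302827713604788539258086504412433864501579484399755567131, 33281647096889953682260428682349479881052881382702456809850193752087045016408286034290087727133091892730453790165758109242772515329363226, 12946440546537738494517369260121252195337713114598128013024746140308909185948553775226007556736701593823618073107379170506987929461994999814, 9280691365351362007519840305310978120886241651995858096833529525520717451983972356759967283916367886507423536954026090926690608550745513987, 9397885612088507055714300193331864854479432933854494106818638646943124398037011536619206323130199433899205485903217711561042147777711399067, 61270800956218065823854308052368584079795115693957199855129717674003804085233261510344229181111202007950620301069868287676264415097262346246, 382747691054663155016326950567342267152595702048009283582772681756805947370993561270783210240116041205973516360858381322913851590499355475988, 13935093991220172867390161033116072590428935708679900144415469003356027030073792034760072410533568536846048383466026296056663191826544615443, 382747673311555143731926744574275457628900704751691770426231420312257775851875338266125671717204598560973620086809731907578787326015814049899, 53536350750514581738854655723349059784814224780603518872217168054103131828549875504381062712151852012815394957692289912312953963091750418, 508811598026087037497880443342680384852189066133245355839741563189347148947496028128892393061961735898856476004498959761816887722726494214, 13677894777576405641139605859124049573031259932134183778587975864314219652182212023416050033547664809252673507782313171055534454668094743697,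 2512261303688041757774277444882353701815778917549803627699611764723036533649777411441748901980956531109464436139032495913261673896519837073, 15258041987951127200438872679259893817352717178338567952040715693999166813803604888953673394949953283212591786174785723549112599653691641138, 443780502902074687421215094045435313836997936510002651288397107917337928065935553238030397378800701754390630099787302260865597857735566840450, 511265780026625617332723608816141843898516558035823335705105622590765819256687144899405141733734451868757165416919824094888674517606565, 1221202640619174303873684000207355197750486773990109939328201949322666546635445853754865334113269368356723099972288465488630660177516901126, 15166614540068762707341104490019085004083636626641472798421425142944605677881208199469704403360954674651524300221157715110814804915290988555, 108574130061163346152613650431953773892639838179246244909335205041682093869043871013739844820934713815368218725243911037642920601852261253131, 437080436944953091644417971938683946953863474352026380974342691557269027721263976213153708515613418942241937848300409113412965697650617902087, 276340019211712468088916435254312089592980192990671945819749525886059573976449648176315548768727312334770850070349633060987235727862652784646, 118992915498885906049010309029682200809591207772151610948602653059777234443730034342802487347365478076178499336349638192650514943222865478498, 25506214929250670452347766252002630252607698696333136043663625712901330622435834729642195724778227151384390959361381735265325711216045187133, 1863820357655622877794303863591935141609357643742721766801681465777026526810392562213253767830879976841463604219367003939843836821624758292, 1953970008083427746314795281364431184551589072206150984207968862103591067169965851903914256371982216003401842012061436244337956401738514453,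 96986749813898657248780269629870862225599692443273967458182944816097073940494304834712976271499856430542906508050344261469094892603732647948, 2657620274433938649561905673705634196878721277655203235681764223781030876261385041796039402502808415888325448234277217534904773471969101074, 372379948525530127794930240980389512622381388116605348547378656770497817246364191327215501419611797303775254245572640756719357845819314202, 1767887584076938291292266801645327970928235218883226705506016377907707850563179511779110879609973783419111745574277781704478002345911808001, 279162858564387358567750766526479585849461911348263976218575941763372072606996191539554052622682543142142072015644605761369001788677710866, 175837948547680474396578058834008982205591429876816023455407311988332276158843033929016457682879585272174338786631839354868299764355681198107, 192955375282445426262557253510974427217396963017950319221711744887126596001123572070539451002365325958803829767886510805170095284386046988130, 2512261292596049772749254297565513187572625851792255155771246944240620473035508891031205294809967198879339592624522639676757376602235685658, 61250903923789669328253877901972810205740729412332111905541429122151411396044779782541593511233751855835341381659496922196937553006913871899, 14515268365147525000823404429740766713616210157616529230543456639926409500540000305377403570998637642684775458176196181335204640110239801364, 9396696443149957501082181788481033824224600339887134889660680206136900257059393335737767299411399665711894845875379447899334643778244001796, 15166643637634425165216303673528112039395933383714838711664709965266586288993881471185518419414584627200166200991756236485121649677058614527, 279167470900397145697597916713510932945368718438400979745278004782856462049645093845982683909126326310546515561301242619290228448305373347,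 276340017228647453736942903989904526099560628847806204360096804565693156208610786267481945740351797092220896331608504430379875297090399854595, 251755447132236663489776027754598524317129153502793269919483117042360171423634522634707993337753080394992107868194805778120771485670943457562, 274828022516419956134542002261005111863621822088705821596567408900321097072329318391860252197904558714171589767589185311908179239363471953298, 12933493256233476318367380985030321527300013761358690112425063120483984582162721409092389354298478497840814572942384025139508265672166688650, 4844222945957864966679574206831859511386477560024078447593001713091708715140149330497617219268186636835368383828026538279550123301688918155, 12933493378230968227706273605324019061097915600863882470233986607958864222219584906663996890290971939163635984743120083750211813185881006131, 228697010818834966934989216420323823829672788083410856873082439648018449636603901987051583489670294784172892485825718258026263813197040608511, 7165577051378117176731476461037660065867805976879080523903135426074172356169474675333143634893754947669454651108965074358860163964288060058, 2000453276177213733752679797620974639826008896707809593264636781710614810328953433362657644870972525343885448108151613293785551330025332861, 12373943801228659959186667471149271561590986694678928184240049256128179935576071463898446477690504000138610002846134264908390152129973723267, 119026121473763560835613404178299598413043917532405125416717413908051494167695746563589839317109023379433070945775043608341079030651103996841, 287399561265971920964846864945749885446955010797023051860359904281376366703637492512593987495350806015567754717628110985231049895911307436205, 465210858280673629086147139431197176223720380500968853999632096613200417424741537669414328340529904676485517552411219683627501182086651925,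 118992736607623577367115629514182073770895708109254237161481655326913949831192709195985136669378565999494783170827570150756664499389539959666, 465210913746589027088322429815366028215200775202009249054075014448006242727120410073669835619112985424338488876871589007433360071552024619, 375073268785382620931216592502239803975216295657878573794577964521932765695971695871804214007433688965504413351372315738098527682079973379, 293631504397222464572829446083216133947181732785864054798426668718510310236142375750119671816639761402912201943380192610636025516242599941, 309746711076042660399276719946363194360290495635751003175132743753026092120469518352140991542498286556068487731354288320793980611555080830981, 465212627238690024021949652935761744363566875383418185600410416843760624574093139123921895679130612247699637371807396691681227274478256386, 2552954045927803852800402616086403954508275659568576643842251463328960891321494138436705224043179817910793909848739245122908022222701109252, 375075047843407047148821603657446522956294990735542719082973679400327231973022245665277811252515831707372686638503669962860471401811886107, 340324300181426627397003154395199133756355587676830267368405760814452752031684727572441084389339458992031666435297854066960252293379256320005, 14421422913154997885442087677043336160887819718857626424323381120249636180715906655157021118734614973524289024759915787640484938211299180618, 375077177080439622640006959037759411850974033293497742905148949558015112138612200904831632161086831118033016819965520596912696271813435547, 24026392231546098871471111452700645076649700716257825149316378073637178311867917402199567124975048568544448622854090385627901119173454979084, 32935631020222632223958153897759831048435824308322150009525178576589713332974861145371481502020742348609740432943005817402026085522985754628,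 375075757040521369526265699485681191632920603006446794157270869773032779266570573504657911811105330435459630886201347685008012444120687759, 264406790441905486264908633884151488505543217343127608894340695789561475131830700999882339419620280652004216731573050727763804198074818068485, 4001010301345330269737386574945026764337502762719529445386957133192917266399697781131271886158882160655566765030453062572308715690396960538, 285990731960393511261551279595216822930855319150065238643391071837420275025748262939469425862406283482347522865583374431425070483357642539082, 279151504915071494525630112692665116076748519534134358790325985669616937517987927219621540862058682095784646791477859365583606225146249221, 2718676402183686420311893191449360228815867014438841192499791228718763925281476789244038644295599179320813327577866510225173911734688180738, 279321879492035907792678522501833952466572812298496634471445786984500114859089448281237158550137267785455097318946233505168966034985209938, 119005747958843953008421119403926289680311152927907768714662390140907300275104388981132873428660519451630498546886867450601663908790516350981, 2698332017627458973218574250394946798191316518112509301741866955157741520354178167792104986665014836946823565990523551951789743424921886779, 13119565672065750978019831551560106247717790740015389379307541533104857140444709180359845932631575155189731375413101005687305363517591470107, 14420787143225515574193534761629855740695290418302813640615313606383554824354955453900284888669772467965717883969627615922245625150451049615, 14451303009571595414999958791841170883513618268163721248085157220667244556659993148802731283611034063710128145474840147670081090387581165707, 14422252177572568244295863589563109328052439251424592067703752140317649780387026067866115358391595888697474607869184356584079694207915221147,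 1985932101953186896103158254535857355017125226500535501701275327099314252639940231351410608711453996958172171189927558610057584311373360026, 291954605635183953803548159805129742768402241619128371041470637616316831607291510199300897319365209998712437562633850673363926910648671428628, 7635467153093386954300877253680709419549646836698512390564584542670088329714177893269517031835881769396295774948240904274561067246658041862, 14454210364482318913351173562976675315959631827445537548207314589781181824054486105406682178856927711483676411932726315086142844557236101458, 59738540889938085211666578023342673702321589969209865074058243256637458737178322910763962230514415585072669802765108842328968361626567205019, 108596087978999220372893070416125371825276131305666218285906316477976700220502219908539673907214630935695694819787407326378181131088767303714, 2512899023261673479283835985763431886400594894277501173916406205809546764016440307344069836786938351854898915492105084071629733912912740405, 119005475516980352946810815761882664199620868955310683131774274457230005805892567357807983290255332091130131447210893124687300178295241523227, 118994163491580916529350078184262289865897450729825636569021455417190899240487904392864462541794245009997525823299799422215256525216212869187, 7164055044325970232085487026736959049152093787389969891922986841276023026968932604643661549699402521534266606254601890021968438051247054859, 311217793663335860876349157508598694540231803045208630913739142142971681719200061878340920969625059662298798351469502116262272338712525479971, 7722719725776028602561175096463165837069418797510896488374835339118623172289135690122615113419023158384107225076517708781223953164098904085, 9956022838381644350972511554371585097716253953582317592177872447464190259334822926582646777601919747593832230701016675078751723882803781701,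 364149951343413420263710862204718956017773125329429909076890974718448076984147825004052245377647707952117960117269194589563880396770700322047, 2698332020313276515755843562487366627371221825649108271908815835876280573885171036212440356548616853908315545360147454274021047905460398617, 324721403498616654446239854179444797165170437758765075001011726551880431690234564239633349498018144918478351386332143698043416529433579315227, 108572322681541029684508924670499166925112063277443128014633180786262395992071523350384868035707195409400157607228980447963153586672480044449, 230171403217471524937011282025784059602824468059538452592233577494800755962917722588450175669129660801310531055320301082901916318166683762691, 1211311033567302706950675727957206463691665011229574736808616035369889849137685432589701544380485027962002390350207880655528334860158853291, 1209584788634131525248964577740904907082537705225992455882316345704203008528862355170498392993159930355396745563872655851638121687707574437, 1232836317689175282803931689310254123097097987390300726503709837679902153022892742987148729907454658460325329600162931389041811541510283275, 2727382966365493405439348606123977515801640272381198798327070841624561165348717045714609647091674182285830602254662816648704291108357874506, 169176369427816024460252424148344972723904917966591844071354870969316178213553500772113734869020994197751542837388972884263172103928989114453, 16120307988492338396621594801528874340021966993258233560548446859090122558021211468700654439332780461628558984240929565178508771126219120669, 3442705703454059698416602670535104531335592496106077744456548708916311575213109209683511721398957699373449198532471622911442025800418026751, 6977776696667779273260265987150483073785912227502535356731474561453552786364190743514945879564401350678504336466085559897196828373333205035,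 288223841859428195885102037224952972805931270089944098562387010322016780574224766286442059728032464964578198330279521769512758213321527730506, 6977801165477833151246512346518688746179889242849569965632636190030775496719247762739304806732224759541411498881051829583380139233604640797, 2698332128016195578382270558573797970364027622817988228326808829333357735326858320099487183145551490540146679021831305091579160354263490573, 7163849009918248848638144198117229837648166218250886680529655818758524850414483291569908598550447518144339335721008758427761940911676932123, 7221973563890459077813017758264627284092312309691433073328111747749433329678416264878493218567345628825864259295117655231458734011165393770, 30701974389541528598946151670072523095163912743686592617310516316425275458006332295288103535023602689521415886346424221524638544758561942185, 1023513867801196883282540956292281227996534839953782980165940196910428931913938678073939611177285073963049903087209385203860980764460018185, 280048704351967450533033969614190232910122997278251856457875838138360540485558142213098899316856095874099947050101206087459748273218756683, 193720535970506404796631483171260513656573852417891471919125150013546577672544577730380133810993908958233178006020134615504621904512818388995, 465222568860319438103614606491068572182629473855963163210390948877206397679063909508496871978737576218856377562390016913295504011941658658, 273339275077938263866644137299374957563369171702049059064527043192560882301182553495623699406519899278524722406107097281242112354171100323852, 465222568860319438103536379689379948503431932426804632118579883477600709509755801173945782040925626925976517263535354832451981549261572742, 11445291068075036929738543496173431602412613862171648194826500117869248330838307769106868484469182205646604483553004553401340213578753368076,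 15937143447403281416633444213005859198913263207392669546365822421003316000981918937453264695725091440915499079097409099381680536029167444093, 15375935924166336793641552989565687413805860746143942958368335211814417720520097696433018939136638862732276108896880641800482689186957090987, 7173290486980001244655893293562207068573347288863475707859836739607177847057986807984907572658063357104256829892975918980930802596300742819, 3269491027619669246541281750388416694972210640303787757210826984973211121689051664180264080403286397494974323733275742585610331227957717529, 95382163928207974932869786319124240459343831716807551354153550493549981140160566315626436358614678279476924354874167350536425027477263635489, 1247371672520910946069234702923298295934825206636791123318962308582429275368456901042943370815541740550294845526230753303813518384091408642, 238371109414987339319794090970795562571817729973921790919693285282026270332499006329766376940593689034258809441516031551218738737489291337803, 220494215610112471287665959669173511053862113364454994217142813833576205460884358241895490832623352063023512901221798683674105560303227518981, 4745200686288630811042825543632474219755180424940677254636519656809125124029947788465859078686706387337758035159733674526530131924225114178, 7222698641492566930183251857316507085867103006387490252193459248001567332256433564013151705521920512175994340452020134869859763236958003251, 8466638738648501957945212175317648940350965505539828281735896973784803366245471317262203218842930207537564233628345719445854188701009683511, 118993370180467622295814544420029681576883632268510382079342991753254595633035505474356759010215278009131351354710076852452021552062150296719, 312067047992169626400763778012352439169005440301840379041874152434007667323438587926561129083592144933808464620827407211047197341371903156243,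 7908948098741545020402578393591923471101550885280704930283473818619804707542244124805226993201113573785459080345076820903850927124786662169, 16102862323050254384515290536800328901450089366422451962348003370581380379917277130893363396609072536582037048747953530295374472700636455003, 9211647386271663416237237394398648981258569131710365706870001798140651019869371842215751527320314755792113442727969765621326512326751437841, 7722968231895377582588256223465105835733728399062666448636475950331014322998306077240683242698365741939264528937046924868642014636237217811, 120760110232889411112229398968928554263080235105011704998092708095085870937017515911564756962931233033420855242966367993025903947663755010133, 8467160130918765953397420202367037252923350390467971835433978786458477971283769712950530545714998502650399503451312960783491439562397925397, 6977799496331013767600945608611915348869103801699636819769886472884441291413440361888761374381708883412876801170354345300163322393144221789, 1023536578186462911116389737155291826479674896168900606534397080819101714316530417246014458769775901594588099341944270209763680723912581195, 1241543154833197520017455832603859424479081237252893144793947145062488799146580753610664887538427960992626821900606648354887406907432329291, 1043857184667134430998398569644636090211530614161290210034700714998594504405815341369338452932332601624786574708537277365439967279079071755, 359706969872494614630881048640770640005174593122782633503911722415985311422674762282392441570400537110499731949534507165920807476456404918283, 324600781260118317649402905928741123771604252633502910040280751117447449669820666245574491004506671011222196555833202298918621247022865457737, 300878194995980117965626807552113069422241607430730633713354245227017285416867378476913330495908749417848875216910340555021669714034240562593,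 119271372736364385135291720924476696193464295621891422465584981527024064448706346989452161513362522954130171220547755337172492546302857355429, 15393365505350084092995000177267487944694167954058939884536624673098578597078216635166124641165274236571213265819706390468517112354846035457, 15166001045628233810980362030553139935499866222074122079997680514811952872739365095496795272052448538706932317759878477838172383157654134947, 372199984453401397582887404550348008892213786941125629239474210107089692159039562349739162133293246063930187731250798284574935783099686925, 3443523433064955841764815136073108146026835147211478904395528672540679308135280654983861385648954915451255522063283527695993465360583303339, 1953958352956609193508613551200655797809298258900120071401430503955734132854662910483578059506012469366739238435784644086578257507411910763, 166824035459789647027289803088649388646055842330884123690508626668314220493618365138796683094266707424159221589657474867301618162945462452243, 487599006163395946943904803318978672383729585090726445502846562186752710750732381569271821387386506644991294118094885522469207158050334474498, 465222568656566123981040724473083520380071406993875366687229624850245182248694498786419679263521039321013224866544427419401974260250435693, 268872396700793444881254451386994442398623367900212693781868596117875118337584690879925331435586169184095029386932414734033032913646961401868, 119271361379942352065806190716956527553199378099132662682615653531121753910636376053725447809634043577701005768140068429493521799360704159818, 30702508225497023176082784986129219777896873512564725541841919387897492410211520246061649828402254652356903356079377487309967878335896791810, 3163600759231892293918536192716328895023301022275795551871777647942516071356555041172524097150734089949623458925106891085994996038889399298,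 286011049514795498092713401372311690761482536030746247423444976400566100542865610852628330781673960328589623123018979103870851799091924451618, 500087761574246370776166323548423058982205588563087518240604721202635215171813709756847296994251667290413780672433697082308783470228292866, 118992357541958243347314314569415078970601929322233520898414811526286085049113545490282758283498240466926203993779348327988220892201963511811, 1968488327463346745856899431641422251130275981258736380786223481884410089463368001354592285516130980139056494803705206146576621794237441279, 7163847410087476656095985882013051682707103847921457122537557118492155171097448386968991585399560335940585924523713191844929753315253756234, 15911012387219464420461500494906909850728269927594999034358595630747982800040979073186768110355723097906843070072537338313077107621818942034, 311296520774636904559132680678024961820793566414593959875958580121274561443337637840814973096331012367502659610554767050222274566271383478954, 7164574246039080553886425732267059381354127202593236846566546019777660412203547245812635339597954684838407241648053995065726354048713646101, 54426016964453303528066025704235438977758948463377782105612038380615057738274102651976383396675280115873628547317949202889267761552386385151, 6977685829349239529293022404853794306369915624520636531441901164548680662035730466630306117053889437963850028221530368891103635490929271825, 240615897863919238172058671983125946296117644697889140930986878439536359180635297507448654928612617356532460328139102475433340586318325432394, 118992357521075557181506388301962464294749578390864151345065591857072343944116346098753532167713296302966491534256221433271417198044434882587, 285990731960393511261551279595216822213402164080004354839080726690268703373891058162663392813015702916152434269434322960405490406419498811395,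 1119356835387334258205681951131799475443697316633879868720206514262066428360549100612442231664560050351970464326497491153499467802881312513, 7908050754688679792504385287729391119846417798707475621151577062730800325865140976537926841676635985590197224814242030173013231600182256895, 312055421687678006056869088246852443534518403997447033050931444742136224071304114536495318621166616958923486656345988787958967046092192958842, 485550987085785242505875586127988068503965267167253037914887902399825026348294317252505737724258079848223151607343408877971009003804246045, 54519570944450878265793529477325010104033085246088082716235030382596754454508131136932543489158475761066532827465587529702301014241688182788, 3256544158016416955370824282911543448631535080601491852800281806402816229566284647729128887106075003656117415689523069426632869581601718346, 293631504397222464572987140641389006086166858676827788052567401713817142053422681325631646875968224095690835362498732981446970775647240994, 3256271560955742826575985152413061479239377343726236381235469335172722222714702519176485176646679836311934809257818749593168217906222235653, 263595537621496928696334180667304868258353900250198862855694243057341919854032363814962697003419398520243728250084748144336343790583569342515, 215327632683158843769596779561458979920128530152098868945178041815672382298294371653006515489343211745607111339838779023322201968739038086930, 29126903484381541214430954520260730421057624750435524151046534949047315145335536314302459612056493474160563387467025015900459665004888680970, 5490119604830971833779531124734470389815933746784640266557256097454257667059706582355255695761155672271954065378216707750859343765644717402, 216784309927345350646676990010613634548484874554429019980044389999501969796686129863555220213795987067056774181980307988573436266146818974863,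 359695337611916045848247968879632036224926008248996685902819982999174728842268441496918822327224076312722214637434187416295166400524439471385, 96988021936931610320546124734488003037547989512391487884385236560997485891325405838709845638618643555174684558403131074346343881415686375682, 274851271771868679354314111117289003836678905882710512055900767799444695360335241458745269967985792196721339665600453118181860299380386580754, 2512287210127327329366784947577574576724718334490766535588793217897772458693878768145380782857572113687153440419842237646750791284507574322, 2512284017398222086529450095817232277440577078451321452424423450731847239961419542581380147730965483913103108612186122205058923571408429083, 9124124014948070520064833028635840281736543698742260632562688414503902781843106913460024812549672175552837750771557236596251076117156570394, 10885556945793717441694190954085262361163267978163835846590396386711282457169569424979469331746080341756667448373096251129526794695960437066, 200305724917224129265516915843106877088718854365421025462911638031428109742879862878235557973743792029012066071209929559536939086767570855585, 10142364538742572959109738547139040763167761835528789914503433350638156030659537541465195935636497422220077154011993945066963410494316851521, 9956021305755966895164466154792017027818025265093799414491328559546066972301036370526320912935008866600511654382143289541752009880655667317, 1953867434336544405115642685913761746054603885573755984081039536254572149688755430846922367793913229731817723892471954796040783654697312429, 338016087721479526766560853941516985691450907632988777199025855861777918285244045947702809725582940435580432367139911994408959332499410994697, 108574112677265502256413894994683035796071927941694595007394245630435373235721417659081763109964699673110882969869764422792861215686400450613,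 15166091947791036187964378615445286804965845360603893217243504633549282466669074840132487407855037512131665096395978741053501615916397374721, 5489756185338855138422332762703820536623703154691990371675408409932640259177821076685058554074203110200597864631267572965879198971239637077, 1767796718144622398950622754146961491708282930160666377842186605613125751259664937883308198908452933460887699659935283702528371322288947211, 505908147756909127795171473727403050299316414692696810100479670809806046675347708032038823842308345760743624358036896439088907369303920658, 5713516379780089820491110107074173750162103233473224127439558490183000690640986713384181822944259378485934435674355580462796614702218691210, 108572774111983091037430745958866967694669431952593753640508884516269285584335084530835801396734990444056027706501427362828546234644196733017, 1767913845417776985655369896931302157781854900750243355206515434333706482026814973819119052590301470749016311146911791101564175763031147319, 1209584578101639974507414913680151665262055396247683860598039299002229730653398652739010514321368074209542102858154767893823163035259330579, 4762985601947052091730782242194354225157786810110146753722962472464870324646592650622689117431945809366503778637932687270998430144935305227, 15166637220290415522228246503905020819028236725482422541287773057997694406802544217951107754903094619398262448436900371256739958579811951767, 410938591967373109458955607036091785232366509081212198632252639335543946234930708215139351375003296768437367978493643209127168359559563698317, 15351435996436886815971540819051228794612705590313717849959624482664976281785305724155236036645989290036528310857575909726628083106055381131, 476885928483175487247583349429527885992237362238784487234731302081491065919282690904615702041151769715467534347887122895452620798057423011,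 108014108766410908811324078828731649756233184726685994458435216057709456272110227144109374507494559687053590521125861657681625433266725118116, 15166637250790213080546838976199422526015754360051510623874177749199377774564698164619287273920864954040526429934720129083231314610261106829, 15352685253531593950880989243923353934837640221419019804269599524401298080062760065050844808201489683259366134478812914258438978023953836034, 4188101521291665138145895433956476577620173839052531748140262632798845061738199334320563129669191825347741448868258236204220586241239818403, 381165890736762566246174389677734067787321146984067303876520984070504754492037743112089027312745139159759742556547046169235544857980381213089, 119179893266026388490324865999667501023848381873696948072411272402591639820558659825883712236734351523044090623498182660712296758750899888133, 250918208442581175153221080391812372968520400796220958664342522840327909291354500744104448765055550404555008400463339396444630186178637750277, 203282288488492739606153075820095425376014628994280289503666272887367694766605429792378598155227618147282038276813770515837015994389830414217, 370001647712521865732794773578214280055959757994256590479989647254324176817353402281223001952132070704248214304230356383743252959047273525129, 15911010970399701982498411571104217272524744031957921356679874005912156069307597993222266217794350663675605329161183061064367829487694681225, 108014108766582167564078789072806547090471491401820990540940127961883852532896994618442306504191595629902004561575377104552544537116617555979, 279594610394159591911672944669302913337176917193530484917301619067892464541074294129120124342800363435812266740191292445569629890516639885, 465210861739401759720530777411924707430812931384721648673841044034975726621658519099823880997590845807284868588301269807564664465186448639,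 381166467276755525183101280616565319787040256339960261782597994369481494155233835275674319250545168720950709139706134432826887413813932859395, 1038040700342783900919471796789737469905819205985327869672454669337094629587429120450624416760712415753707878468122503230560146348587393027, 1994655586979451179577507698122628856035534189391129775659996268519577034731988051178180830426763601510377579256829556271004629216023126027, 5713516379780089820491110107074173750162103233473224127439558490183000690640986713384181822944259378485934435674355579872428737953382088842, 108572774111983091037430745958866967694669431952593753640508884516269285584335084530835801396734990444056027706501427362828546234644196733017, 279166406195234603304701623066668929374609372603743414908255701470369234053756559151496080123853962725460212285228604954482354051305390903, 382747690699660063517100736258188651746089923779820476562403734436242649158831357461700223443579781392203504026201354405471159235047901454339, 492064605180622781864913552283205776635598009508897170511241726715495858746150735969063530226484575902306297154923666150363731095936796110354, 314180536314829603175620643180324581790750818237672903232792937778818504179024633760929161432124681867186827528384024189114794775611625778489, 12189142339068939315453181318627655417016010034706554169893140264234052088896656775370690964370168477518796262323530638929481525592157662633, 4931907508389230550507113679895370251188390980772486624702776441718225838081456437201438656147582068809761614306587162902355228554238533805, 598827956388360016300340356750810077929195451582473551408127187277377880513659968670530985513024474332506690186362153275618846767257930768445, 118994083830678411369359381157595645080540035171980572306037098903317765881098001144355976268258886136497633876157930527323238589173613797549,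 361826688213520093619537572275992028402832377581993669653137456970135516544702766204332068332172299785435978464330103203430684357628069462069, 16096968106952050924613672349268512374609527433939714940813927443710428625709093800352257776125388323518824620011844051044567243842480542214, 396081598063777000335384833585206213449731268086025552843110571022344565388287299909400578250427727573068829768789593206644461580253955237169, 4745414028752184593409318080509436979993976950444061340150195368559602760389608259926623952992244666805291273868581584894472949046120317093, 1767892551314528575744166386537619430729221596196767510180753464356779745580104400096361713732377019121034342353843369796107046105442975885, 1224109995516356734391395921290389499351315711465304318587022787434750463658975784747025290015741574889108059985848736025503208342269612050, 109643921310543659346133604660937345548151449005757362456099084780408362458192521086013423448824908951741293627221976519383575354772438474763, 13677867108949140922238280970685708068282487060167811618486760703284493549638451509748145209639447734934098870357133320982946878593366706842, 806242751603695763]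
theorem a1 : Dead 23 1 0 1 13 9 0 := dead_of pa1 ka1 (by decide +kernel) (by decide +kernel)
def pa2 : Par := ⟨23, 0x33444444444445555555555, 3, 2, 1, 0x28262322201d1b181613100c09060300, 0x3ff, 100, 0x7fffff007fffff007ffc000060000000000000000000000000000000000000⟩
def ka2 : List ℕ := [95919589774291817349525856998663734630767297100356853663242979884329022291171803637176649212546855190185631199296417359312799670349558270634, 132675898303192467123647432492188158600804276074837801830847068281941339466923849108190268307941911809707682861820719076375546806374525626122, 58988715159692200153935716249104598023934052614957408086310017970424528667824456703098203130814410792575260190258284386124126767298670469269, 5489757873472470679576356212926581225050848484581147397001820979680941059676756265810487238350462609824490045559321613387235291001414242938, 411077478590493832443708506259016122520512347023125397646952887853631086695578446452212839626915861411151990129605117896221986602130610815035, 571888496698275352862225202789245187533481194215410967665317826621171752769391812183481565764915962677944542592624548503002580501107174330034, 13659467142819038126701105024423036639930876143515578767928819358747106796691462127735976817068356903273505051801896275100203437384646741, 9210922291050776332602160679008917077464444597917782672306388613946946117267511982125205593649324631490697437592375987462884916648248107142, 469109548973745044581323474919514412231594913964301455141811540158769927350035741891294415579555745640355115549132674584412577480998364948514,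 3370010507644881527983976510826621412971030635546100560808350641280520109510641640659531265421269584073777319989738225565597580118145916934, 373868696996580442734410917987826696692029919660704719506525366174666977683719365911929972679669268842649630081954806820444097841353975963683, 11629839842627649850251285986120663640551319462504923977915239463294459049094358696648743019560519195459602423852340351066348584097097736262, 101130102802202032632800668779582947507185319056262139100728640113409535322546511640816916555447091168418323253940246843584490991711120827647, 511717236829929250345988008709441827178616516026929653925162672224078207281351074368619732312176109222549532896183819737306694928326606908, 95507267151103720478984228558885348317125878066831948624399805674209133181748119451752909455416822613488514353581035653030592222167285735485, 381259289335370215289330998193902270420229746321937983209093601656194472862981328601254105224484592789520329643024732216680534841749154054180, 14608249055879940078849183540611177965315434566000023914917282171380368816643374913835534162200320088395682825674709100903785122555594162181, 13677957966563701575114835053098683582870847939780488471955455022948403000599970491845298777940415203366151851571901088341285476125157515419, 2581765316311544578812071225560209115907822499206167930591323958213506017663717236798632373391306973874475009694788246465642888625778745493, 571888773184854530056460363726484001373051927625065805964089864604872757280838937287954069441212969327281164840734241619420064859917623017493, 571888500598324860791765513360532031003688104731660527460753075258444441100886776126563145105305098297209440603163907743135453936519391577362, 6326725124037004139039643950808587116714012885653725172734101666252032788160452767649157933718121952143429893038219849109758630196979138565,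 1767887639536932339882476740435396180451149951101671160302229819804065219726673389256040423347427285530147687587977161418857335797470941722, 359715687326106560270223087565228880244920654881575631557589808693834602302376721341320532799365053587050402783737095667294125211158382272571, 8466914212577220832089984541257441238151802244684476859233258025127481302802859892840186956561843642888684115516451261778775304616427139098, 393822855639205689931977768943940665812451354889789233320734661886893722784001642620407238432648265381385280203174761581882422387762334097469, 6347494131628543675682958930862396588340192628821038141466499830761993498029348480817834078894559504251043218566762115384325991046851872906, 6349687249582326022845145096947055226406863640144730359287634729387254185425941907945188238190941839717925465469123666161891664424730124357, 190754487358464062987524695871844145383690237813306163097756066253489640744074775710670250306315837136496865180921548266785868018010997491969, 8653071890646462008114516828169708133478627271550015320442403887691700350016621474904628221516457535076213180817998461145949323379675643972, 13616804082400152645028438661373938615897247840933196542314560881290474027642675383315065846777054460751913752996554475353937570853963654159, 11455150088302550137263142328580667606361001853454767634310023487869483887984234016354464299144014542144336826622314363233297881362468472641, 6350140087692723367400066214361465326013728469596312910090401247536381142560541078120358817238806311495253801198235219108352591317391338362, 339579827154492462692789517623674549059955708873170405753073187582419276086304102291907330983267671049085261437987891914470257497324546208066, 408797777635197317567832746400683481736827344306880447057098350292013961430078949292271911218253877383946697957061075892866972578114435571781,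 194444372571267219866688322506390783395381123960657815253523355242430693177166454445430093144602153926820902248636065670726230265585750855210, 6234134869458536808509897682131664741255729290097232380695001265601040059240863297984184516586621153658124101623724286960626380328571101252, 6326815990184833859856930708799660043415604687742720996782024128807507251038562373297897712772914447294976722116579604006504946576908640325, 16096059445878202645309936274522838396930868416715169903048750667889400998304864301146650296724627154524885985054067804160151107653960086306, 56173958372427979410607411978296450989766573162674123709223236370119621974696700130729078376838721257233847874808703728557965061189017606, 6234141261502006718266332400532693567803643733947796615668339529678121670041096925078758368584089298884889664533151375409840720232222564366, 315762693523153282718239557471998532843098630933518263858973907930588056802150271881058708074730091201697809851910955659900365856735859531843, 5489847048628724071461216967151430451308411918400374021680842611325991276715663077640385624139608405810324530880183564299141104458931916354, 4855305453220474879733524379776784339551041654759047251569046728260129769573306664285707286234369536102927196794404475673276422966322089018, 286022693695540391022848792925556076776339025109445465565155873183519676577482391748881858540411998498679173968455705887376812018026282452738, 120678658866533469331400106238201913240938617569288539917279466854407914405746041313884869886305182132725837877019893278374731745840467234074, 6266088172515835118581262108569371502411428761885251426243783275771403190928683617335027608077401561709579764584439755961880860151135725329, 4963422667515740589377924990655088031691453977959776100536388512538294971016334635544338209714543451844224196515201436662423827204157235269,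 1023513865515067088691828097155711485791946117116187612386235855623164524169394114493432233278852124846003173901450122959210373236740173066, 59635812764012236344755678573660833285255263340211406264928294817671119191887040406500865344188626538527061849069297070328069037153508040755, 334424886059249121704717283812866663727727699925014743194382397770296020679664162253510227355821568239602243437343754087869443365351084534913, 174366639946213101400362604369533106549103174182910532984629616016703397634012084020023082659581909480694271099072490925708694763090383306765, 8467371371223105738440577159842790955122864700405121896580314723234699832779939290830623438254755705137627816673187878894173953118052667482, 314274027708560974281249483224447649755412175305599749128296566419336852818808146835108554249593975127148161169723354745355877463885840408667, 460206138052203156877772541572464334641536908810610115913270691967008724299717994709014550305883199489121068579319480889028146172643496058933, 151276614465020941456536029461647973780865022466578483910222984674549538304032275204439641416143439235115816245142303347953527545235130929242, 433408688404236755647133682101679229021371110531578789419937845147853992097479415041264076230999754290939864599133850927143533832089843222370, 433391244984402626967810392428281046627737643390038966335606852463352542408996243477535338531680078573514383344332890908260286289454408642106, 8466728578866894924624360455060700382549963026538612669535226330336073244093178410419003742023640199000567937015064510158047801739360023346, 5602938931287751630667213281113633018555473115194590283889049442698863556845683301018645866038764620492342453367180619357955973694811154522, 4963422734047839913129263657697083232778725577006809932017574301756505508125811165159931371550314945707479004351692177631414548903043303466,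 6247896090368181677437677034596214063789804900944072807140503274655327999745783896261731639222831192915868974060934306043138300973960028219, 175852391683585024082317660644473075588302890848087873194890021737727278906068184181454534187354150506890348524352998692388046083873377869891, 3256636448457161127302873549882851463394851491613571631758696957113923386165503956961814563719424591073247897942485385644416749183196506202, 13118500800543360169456891433214171505754193512114925375783907019261647586608118810787442622054364962724248727118924870711268320149609529379, 3442705739751256061526016263812398035409840852097754777599626307400260620727502916442448655053069113591035137088946492037547078549061787685, 7097320889479317473155777187756471044313088643483831060702667606872985974288099991251583746526889221684532918019474554398869481648982171683, 4745200733429384113187849076960730995585270804911947531215644744164429773199085492692386994227834110040394657694457264485489784822166040138, 3256641055242231032198125484489749280878084056736301393920620640037527180140804698017033834534600052319320067035381604596142219538706358325, 27033341156936643926593224409338610297020275225134555219846888605954571143573562545799707132086616729267257867510488804197608393939710918747, 12189146547965459431855344838303301664211190133015531742156749893924215244749928449436793760348294132607824738138440381648277062597672029826, 384247732201300854793120397568899521482675681223306416501548679069740958862460426727855272544855547006204369266285450649433703056241542342177, 7723059061899120645903814375690555227531344294269962237911471166121474012606355408360826146096807861673857392496433221315173746431907623458, 456339844319944699800570955927801210438631211352146471645004199467282311251668415323830733486241789859064579967493184985239787044119813857363,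 6349776679249992114810801931027236863631922707066065275740549910198442189422341760379616760157202014155699049744449602207181403356481782038, 252498196686259620250378136020122331204709383950869710925210528264806906964158562571965832109682985564263689835304550809417408219017900041226, 96943525612873958385961718273568002114266217957275674703316889248339848521768390392604579593220138705236916074881931643283849632633088843886, 382003414589120828234821867115926341478192006218558838116269210898989091243142178185726311422534656625527239807495991090701101126081912982074, 1779655769545014671466956250780840725589995859289147093732928805194728482172304318709053005093285655913029194144624550682495437922180900873, 245055992712894914030468740371982050084623917331294125210123112624035113825626436850470438244768969578588521899118070116819200749507520389141, 167649846977264573696871120373721260953201943347818207081213812561314721128038081590679674109673530527361118233366255199997464547368859426893, 243578306937979575757756376637080627228551584975570244814109113851549053107057587750463624182347999311599956753017075023442363878504296177677, 2512624769102419933255856274137230596082050263619407454556316081765573842428777701603437585641337385512150215130541030679874779822185476154, 291852687064833272939962207194679511609537942037886259727779105438414177153388022546971410342427140679307785518755564678518958476661663096883, 4192871489578824553073305530218369276403359814175558780623761025492318464403292006338841915415015280095588450102735408847136999755561312323, 6491487642949205137238679501588642173821861061079896365795126874392014399700439373427041174143986106642150880837076756074860345130717700117, 12375281138158854255868087442730094775414533402370112799994200227950736384883898165325976160055347923892871171219933927752603348617064981769,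 170574988901967355252464242700895413862399082830868262932780795221807759620249057459956108968557355643629793792161140943287064507765226578314, 4207412839235426662361858191837351401365586849615415869018297076592141674553832273381902423843583600022476082125930064388679684016896024621, 7071117255016472656594514266385852687725503840517617330600238518345917179015494808105243863005469379080744999963325026476241078809998501119, 3256667629913022011180296219412468908176435046384691485475094715688244892750492315682972144914009250185631888255032646754541217464816315690, 4187261188888395680195384565742329298583283579174910864502900151532463139003060416564778771326948177263489199576194164333694300350732517461, 27015530790600363488257014731715048607483477689590338360708494953809495854270560035726231548596584889759455612433955117488157586851572960570, 5489778895843343875529304701189379509476027358122966022040676789390341405400754617096125757302311301371851005174255733574425684645388604194, 5489778895843343875529304701189379509335705822400897013606507397039781081860481951223260582815316123143904499354821062690885252282059423781, 8466615001822891359233709227600398267796766059706482910922829786799864251272036709950271142559420517506801713881400037216342971855828959267, 434153062478188240135326256399376651775709163697827564606177878512578919282178129576109103449148205475503413718378026147375959754100980818005, 7908948054377575997141168421913548368346110674307622879799187352466825985832964865363381449053506408293235253631362859879651739428046025530, 4745405176232062105523196230259210012875476161090640268713593319531306013514394221089707578452647986195418709573495809568591289333714214939, 361948813095630437990216392676186900991948805145159649211438675450727443574828520826540329741181057568615051598656302627314682472444299730963,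 6327085685597204282436000604682957966297916101956367003999509339418100452623563445944631997845387137686692048187815144289564755153689595954, 7722968195809189166144747700082575304183520802529434643848795260855003655634148038451670234787751312596582845709266101086370235149468124415, 52645071448016583509795472513187604617514138304020785478465172631638021122407391998914481117369497942021104376438869]
theorem a2 : Dead 23 1 0 2 11 10 0 := dead_of pa2 ka2 (by decide +kernel) (by decide +kernel)
def pa3 : Par := ⟨23, 0x33344444444455555555555, 3, 2, 1, 0x28262322201d1b181613100c09060300, 0x7ff, 100, 0x7fffff007fffff007ff8000070000000000000000000000000000000000000⟩
def ka3 : List ℕ := [2512274433666730787246695097942340825399076640074152908051474367271480465179484667068102314338210063784813045182701620557757585121983124898, 14562219565786004176964466995341126255880465493819414251740727495431571802130083009351164214100151535538016186450412676411539619261333531, 183299118616149526889882609395652509945081121902834158933344996368135526142850002740944812285234319338706192363381143354078748124918163964174, 5675826895566676789943385286088121793500089230935523918845838592978744558367465910585494350182611942953730015667606477550231714750102325426, 3256657737180706956378376259291053329450803970073522760180684946218461636175261307971706630417252696320482408399827516439387564494430511188, 5489778895835137252865415360936460153558369190970835201879454340410466681658969753741775216477039629050792335271777852558419395591182494498, 485557484200485944738729955830841707449175371599423666846758833549278066188744397718054114492853296935480884956150506509889448208947666987,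 280048696056638083089269753921962096782111175298637393236502253359952857866157072465232925812787258954886264019601756694843363838621297714, 462293203211218140663550222311040787824780686842632028145599292402135589511281168229891771384321635363558339796741159961045334786381179420701, 405077365375155494187179055703599091870847067457474563715795029401814341932346160944165743734223427371237677847773241754107792626078647378785, 5489778896770154003971374014036338818610159207370670176604119389253395610049701698061633801711363651484426164404516462688580668632977196425, 82850920900568158713519506670740803377480288955513067933199907615464808908523395859626022883778079200021368088528693038641224866842448191549, 7824612129074071981314882456974635011949855912844667011637115398535803920907214888273805703458422475193958364447651058515655648831062623866, 179571344434048209330368295456287468332571816595119352404007037370918780108329069320926318810756964492481854221792698559558221163316600513615, 12199343311120683853925411237255644879061082677871555464032077898807211778712745218810723837346553364564462862986433796805045372181590067329, 6978503621343481346296285578436971940274714322017983933928791077094103234762133395582029103424556428517456284430464446325997714770414744186, 127417760924885552391886033248658439675884621004944721041213338169753083006564034399808585173842125679493309922400283347038665966743754195019, 4001033939554889822446927425989484250562258166019737619661764321568641751502918724924582585618833974474379498490483566342259336360346601513, 3442705769992377172411669064760030618552676884036876636667056158743069559662469201206888769148201009260958118181177680408910740411054571563, 2698334143745371066178855483338062413930647580693903997836755633596067542546746177799277839040326439934064130212464233557189213363930357821,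 4754082165635443832332526416909977463078033520775036049328791431756198066703631930627176755131749631740551541970966077285480633312479633435, 13677889811568615473730998242949698381807620922565177368950228263484581943644684421587960578774696389442300681634842783800497864944149487669, 4763269445479809071883485181517452046233944960452535414184441452248735411752835990327184892377856414888235488067576628543706527725769630866, 156487128215731324234490181266761836731853719802358050428069350849662368107701894324034322081685696639871833929020129324874413325394534678619, 8482560104154506186415098925086517295176132607442340392459629833723915649346279488855348492611332882169381586612142672723412990474006511765, 386489518926145335117287822278578736380567982146653790798295220604082989990757846867086926886570508351192652173567016040057980452733809483859, 154254012321593365822582917179997012923228645268914086331512506214352768486884736501789885737374397010616874225802921757947803041045968019515, 145321522629521960365544820404125158749803562440659334425962959563515775700660764605755921984346282179653889506713209033671856318929902321946, 388746264161597638038278492891515336699019518289057553718625615170643168211661325148931656020913675392568744918379092838379417508400810967069, 3256659232859668106693410485373914920528780128739082696963949216767274389248954151656362503401875863488495289209087573765828379202516832594, 6234129904560221349948734781290702691266131435189122699643830071343857683449030861421594465624860449993968999149222457612487934424396611677, 79824370134538140852363667517139602032402953473414876309807334461185796629840535817128028720572547197491325084506862542371763963715870933139, 4745200730657137428444850461051470176292387726209417268270061138435200018023849172767309159033745192263836727654356141728821227715098044250,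 11394491802663799391317176464267993828700918783241935660804938006878227912535538285359784524316371969128114424625668653811773981641369075837, 9211647552129740374296011935877666835969010023613725262532309690596626070869221677519849340055770543538353728451754578940396604107939373946, 9211897400168907347764784445125371908430796049847326103539714233229941317186442982733108476864324576489153439093655694227585134173570967418, 15166614537081004528105736601831395590258835997948906040866334175841895796085294825765462498280174677398586244858708847118334200059536367717]
theorem a3 : Dead 23 1 0 3 9 11 0 := dead_of pa3 ka3 (by decide +kernel) (by decide +kernel)
def pa4 : Par := ⟨23, 0x33334444444555555555555, 3, 2, 1, 0x28262322201d1b181613100c09060300, 0xfff, 100, 0x7fffff007fffff007ff0000078000000000000000000000000000000000000⟩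
def ka4 : List ℕ := [27021528229197997199745734206737827828602063015276107107075839894549372422345868830728243268430479532046790463026400768093285825432847963290, 8467341929274400510236604190648511200021435979451987883878583464648044808155849311838691354701583631124499222266169014021116324055200583458, 30007564150105579202340548563681933283895046922210858032277535037301160888405402610333254338743399605469360987741714237314798140865607213149, 4227771411238657584895007362063093369460181007010473000238791657021582533231526626798105894374753486050086860389163506248130589102732324394, 4760509862792398999553475935967068851281261821087229050279308525915356587878599924418298191582868030394738327928884767942985312587803025541, 338091065553875684446673900017785875456193326570012802963025798454931224047893801217897044274156252066890085409435814511029825554703750406195, 6978526335069863722544690349139223900807824199549959894301623575166793885168664293322757405020181634380266541920107427206168273144710057778, 6234765966078756154581467738350710891826418375295147138044513464726990761042898544498249632375439810868635206235699200304034473293096837195, 4745927660882209229629348000310064712389287913727007897580295606071379268285148799483598664655286452994513842431802397606297488002420072517, 9446567522214853446135342556975143872976062978135516182253162595288056679045894233725342793106953530966293515004294328055936944946974974005, 9397176559362869897205874957269385498417180946614893684285505781220603954997083626219315065511725671524670928414873474459062214336388025121, 11630475946791304700894124569892123023506079568326012422860148843146198280615586605863244853563321376759362705998992856137830901820271517795,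 7164756089047334238223616688305483825573556439094495324799575578281584766837880529343787405700880034742705926117776991650347281841017036923, 125927103120244534962298616722576397727158727767443534784846571191317228266626871373968685303717537346734381687511552637945920466859227635813, 4187288514457849037495244370169917058467063962390931287947851489576233858562230584666881383318131612848754751223843415813481745513748145994, 2512261336964138623451821575795219895996549781405592388872106256203138720254828608018069146614763281970806035195882541536438968433200554027, 9417764795708911938464209965455504983190855635288505379635560593650862921830298420419576995082136432669835212736289023794056804582411160858, 216810203722889132945964765754364988036498174375904460605440790162708080737532607496324037015553351520743663665006445936265116262077789986915, 364141238019330495835006610164221730530947565173429111603887078074830308042125331444140632876224074933247929262916588847763828274969465538330, 410286070744759719289735793436984796910958634972705752331543094973967286623613922751966862937190992321956521821082106558252705371051295592522, 4949330229227292271636562665843677652975600537653501512757309625667876714012242359979665791212000307823847922965187071673232293797541921337, 364141238030419821719259809737542999654851245010319803148151831209654542307398002659007312107095809213232077350953280390259019814731554439259, 12189142308573297069632723261969312116871843646231541297171764141124982583207640471933044691834947223312788143849682858491948865996269899850, 1023514008665986149981336251310488524318104337532139430079136557439285359499895716901989279835995198756730062856940314291174000036610875427, 12375190272221885399722871109625384115462225203525483656878735541499901647954615856507180174115455343179497000704013343351221729059242549283,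 219017432317481466834292527675211565328536064065698491635564086576392555802401687360855315247094500285383006768038954129214630795445885550723, 4187470601001996633849470732838264469905234751814603918279942887653432079324848245044419830708822367396580849608525896800381583800261693490, 1209584722321906886561267056618983534400680966724928513174476418562258425373735223516890113780668188704345072293977692803329722988836249643, 359715687324460414327182482916916516287561978780871074304689562897176423805663716113556748788751090880251633032699037685024068683589792915467, 405866858649346155893680392221508659768038793287760567958862792017901825562109636871139813528555483606839790539807583665914316371345889710106, 10906420304293642000337799532916001263534601133509717601143948014084767838857174209085483137104440565330176048816487294113112985737802493018, 1769250575818092450292887679220642133097230391959058125772313901051639116820842058831514450436461224748171890841481551054485667015828417626, 1023513942108373412040572530652633217146656536280018470688585832490916841471925036713729695216078165178615110653066398397793189173517787219, 7737823009371027284961534547369729064988954690273581601455094565802506319460355591138916322781175336756684414072931696994149094797619572490, 1210402437830835093482452121379681923720869046021093597708505451120097039097840630326207120253057186113288786633781376446085413146425188437, 409588729376156333533215804389812378888862962232644033427583618233846396459251389991310398494235153287469420573345992215688996698647681444946, 12188574465820284813859379300526248121321293431537492106946384359420046278166690890844313518114740445802828564202089285976786079487783161930, 12380075481155150749721065336900969239471574502923407650725214303082852400074774996711553536145533178322865966757478127307397185732853973067,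 12377179483112945599378700749110676270809516802896001629356257241729540345884898577564762089453446885498120577541555286593809435301719157802, 6978503565895535205339724366606190014902835558568786700648958217883945808698524959551627097852141698289740236752595865087469498873936194602, 338090909018684218714323625735604909624371610784059891143247956220629192828821909849663802344808074303493063593406694772690272790114718008906, 98153450332921520977094165697245612821972364575759288857902053585057441446125504887609977994245544535776090717055045259966036693943713980469, 385754230381423919246814209903314074478221028048172144327331629409899649162977945453942677703161754111856058191406694133318554845134557847587, 216772687806448309952520082636189528587094602358350018612756012322545948955719281402449906948956882577213307834007740718553224232270803063090, 383535649898832744097852480244028092099792678384335948158993669116915854602002916008121274674355780945115545441858861668458238642884832349978, 7722900054846980797859116960051866523275933203130714332301140401338364866347880355773588685482088521257275139254260502137611928084123631954, 6978049294472633936378706952605545487882278639036133697346741158517913873663910956141783162103473022421530543894244835586922437258915307547, 411821846987356564843703600383154485554977511581900627374549188459089033537414578604494724367588250780293730484822080825079660814034862170189, 78382861264249142150383620999843781392301448974963086419794677531034430213152656812791033327501810922769818167911162161612600009139085856282, 142809579222131388800375254792425371572735882273509529291023201921813496493170442053981541285164490840467944292163937585290044274309832722250, 118992255306607135279801543863959510056984674169137390214648513953760693221404037918253180765829330429758007219462001808928041258178564210739,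 3144157296830077266408313447604395]
theorem a4 : Dead 23 1 0 4 7 12 0 := dead_of pa4 ka4 (by decide +kernel) (by decide +kernel)
def ps6 : Par := ⟨23, 0x33444444444444555555556, 3, 3, 9, 0x28262322201d1b181613100c09060300, 0x1ff, 100, 0x7fffff007ffffe007ffe000060000000000000000000000000000000000000⟩
def ks6 : List ℕ := [152680952066693858602340530952434877904433891722554164319528491170288786196592969199684050794016836920703816313161077568805465749894632654083, 385652019756756499772646699555699132166242475174857564247181198428031840821829432977445936839486172273254616366201574335584031711069964420095, 1023536578175970589112759944665653911919156091658924045739259344313145168986479471736441306475161403114239574575186956256386884368356864561, 95175682390870156722615630071273348459109972824062781879758788015625798318927318465391742697797384664494078997576576635903991116460773433451, 453454453547178838655517919005016317470484836304890360994636708336879737115631741927214171772451197689561277948097305375397609718353619935243, 107136147222275469969621819625967694242764089533185700136301853526804546323708154092070628635155456958317232666837794370692832886119804785161, 429637402229460392065997834076166970466701569585762054606637408403558653472655374041307396007097746354301341555875667693414499731669313275658, 154160098745232033145726299551034597833009278874385237075866735100085444825619972795231657516864957195707832864742056030876001861840203240457, 1767888832081318101618349849621024267837039471977432666658725393173891318472197371696626838212271753049555828888592438617989105582038049591,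 83453227645928670802969272111816537707280651817986472479611646804379316560301091263171615305941520508041542419082616192306397605612820254482, 1767888975962730099559947387027044842520967910882957806817483907605988899667638596527656363249307010786927809482264082648990683111872259239, 75137878377974810098037093039141996987400875253821177602379751749584418392773073053945102333975233188448196234218424627863827234443826974482, 110113721254934502548873453564744261689804238989038080995127586546331664437013650871644374159231076903456980119208349057587568160764059723538, 56752692058917904298522057711248129827906063563992318040153956022310904942825359989468418673187420577981219955766078464109492086974722334773, 571934927532598443586933069890058077645352158847724613450742447927512828710537221822384016240102847545191638020965175467523648526956648981255, 119008238836573497958379327153229755086336979763994151667223380462402367831713193614520983285435722045791357681270229720833582966216948597842, 100716798830174538781050124205414882820513617585959596104975530202798188939863468013021123710698226182438376469952709100897975248004752384131, 9211624802372626029415353226690794701100476567809514977869572530952922668708443178048855738405066470999608957063674365264798770661423530297, 31422731486548977534995513158667975301080085290409853160370211962441595138615615160154002746495324423106928074330047609957196377140165829887, 382747673344138175182589897379161555342012051984335018343517343022966577786309434746633132959214396416177034567611269078451568937824893808662, 291253567155665233316251263541478561467868063583122533533112290139811354057944571964289950948603765287951948236639417170728391587739587653906, 290512106825579918807150766374457555578137888946503957462544708737557993754097669573365295717562910242623309774763718555983573971932581470269,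 1210061687810690382442274124486893936465231548725469537389711025778728759912558625110993781728087561770752302289027295158278134052361232435, 238376051561495705009836225620941744745131432690988826825751084020115201981213665511808769597095969588994758064155640871101749333838117625867, 418438345702130258279410251718778517547252155638511837164316734010786904019374655258856366698199379939273601038027322696958485784929838844674, 477922844328683297141187350441794983752857586344804416629679061556447079527285867470335777428284040522974704086247121556397297936459911155750, 73591212773065005236293549423460970169577980216911783534627059820069400674445219294498414598737686295286263641574656809574632107541523604754, 51071806361206819957432551942622025633592998343557521364501757120781945626727076538003897760360389205945420274284133888723836258174019346, 38877990112657546379301541405065312911874642156074124423071927880890254967854166432529816388181650417358745570001659718437405032253488648230, 1702480193300972710352867561377901672422587754802700931212227373362102918888452024489443234164080848278731898450969850023396978492784654, 4197580714225650303354175959967391547573377124915850947773051036593376705445525657234402122288150001564978991449774046295459051509743630, 3256657737029891643719215321637464440614017273202688696628978522252501672991068038591987691952286229603930527671953183278883308667867963406, 3497934257131527760455580897976514843533556707787717930996092126884643174289496004790664006250732130815949089572718158828912014768424109426, 340185310904998799856565151296925302457807251052557877722076172426776364228402082020391643470416820054211190386253488963269884196536640917401, 9397695404872894133222497719207987175765921193984254782379674270625573689907434054529347157884843884578175149657496185717777119777190358658,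 10774941189979487469163766213105019150050046377814411193142288879025356424873113962337679802973293112485692079496698428687618231555112846335, 6442983981122651940488450807689217527269833398015056677577741312616995380267094382127258255393696659406706171695020154601893828879541215601, 1789273511966511921347119125882126309166385154038154769550141742545411166336663214060742784863456371439921948242633508051241875821273927, 13003383291037443001488003411207056234946275427562160693298570614700665536799069847236287034440381278402486444657608506876300918288641261582, 192873918590825820154273797085304721249216777645264993917307970098600697650102662848568376411401105050483873335751825199778309172763182702619, 107842816548018078280243186169017515430682697530313426597952792630607417216246499108791431586121114940193599414232419293004982691684577133703, 9211624780191268476448440481530369406959369224398150692911881890783306993041435533738038953224302928056368006542222048034780921245066272795, 4290282135660997169205913502329075108337176781223259039539376949399106165332182421283642591337723981708148647904073784158892626671280219, 395321978626067372667831594447857757386374836286639662983172773139546497773725659727644588406618277220283874991604253701589578378068333215758, 106394862944302732159409291646783808670986342756041432412205087704762535424649198061674295019835502192373623576931486594533896108878529843238, 623150978457251809650869193774645504315830131146234719814646486060377483517013846275585485454014824966386292158496701458911540498066742255637, 632268443392651129505057533006649624184655597399272642961410466246447253531034972171072411535162234158051773051709332525734374182724742361753, 599333927128399361320874801436090644541866573365262986812136440986817143299433024699077221547988375793651145580137772245075090376263182311565,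 587053260009406412565345160628749403586071786748235012546627668331519482325242840478049895405670078838396762520789857101218835896455832678801, 120783344941616730847377299863488344021053326270677578815283541698418527433900157392448971016893814464650211807548869576341467184326865051773, 602497129583675697279508594992559986339299480332691555024803507152549066132621259721672540375313676708334768116117846604357932134593828368530, 7908948065478660886892633284737830687175094348554512452657969406373812261664052292921673385709814704783468578749317678248005490135468720261, 280050462236739594142524381732653212749620715833732460799252611804205044183480114888256177334325007696566704394538962649773607370697163610, 110079300102211887840934405992382442740613522141343064162709375618869281604578310731170372081579226692228639346258617992615322986208848535555, 601659812083485247384728115338207289923955231189991310199968302108128985362065067750534838131742918260643121203998430451302377677670520144647, 13119565028828212657092984700402716666234035221507578188574208582509327334012209179288439336073640442231624713028497623447339298897934721155, 440765209488245643421584217626357430162158962549050182281724740950297482999880207522257151773904660922258498623519563692334825636521340592267, 12261076530268458660968455179432931039112653652572616003766714305263186594175740766016701636203577761873852212279984375024610317582452507010, 12189142372460453745875369753910702348460424071227696820969838489879895514960033456290933299090154029235649541032591114485125202874398171269, 202539468093309409570649674649097162012818245132598375410532635590970248890579499050560709882730072063909581521011098858257065926335663196290, 107838178489379601787888651420624269618639096552216550986999028066441790744493146295415743542419406998912252958939610870194097048082515607938,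 9415044142730709169940154721741616016078297441627313408249420473241233498364139135231034158366654239694676689742604005828394865071410397315, 75825145600529277683785231723344209767914705585802151426840416130818922780309077761367801358155651368344165613906595633084247503858737205098, 10895156122249397134957491411393386925067814535963477466032501790380285841826353085509868405570778042139756314123127685087274681431119749237, 10144965211262881480600595041886059849745047432378635050933777446722074183333655080753109840033725483781234713174063893386326044390489744175, 10708322020774872269454285519821617053678913696595717436630669783314703387717699641041176849190539805003269213882837704203052441239345258603, 584494793706853699456518353949504417632313509813890703516809779527805474653948733156078315678171372445034382720313336957364819908172155084917, 203282493097676153105851047728731071903164244011755873524445308999875108916028341947683607417210799627617039225012224546951364930935269217130, 4931454523476964333458302217418965471723606605915914374542228030182729474903802448692797709865770854386062330603385870894675855880962154637, 118993824535263879239120730722616655147668209730222781598696307800187684484176581418567784937521819626894034545461247659637363631098937360435, 1954169484821128031136045911925017165026197827405535178249231122741117656867031188218996506528708268823611757571343953295649077700991230109, 457196651004671412727135666042868363500223597479262941632071266807369940794235270060955656083553782378235452623060143908773372670763164000275, 4986681517785105086193199382664419571968646983064048331625537747957771264153699077338671418730138631463680040329482141437417376328236621877, 4931463228249245598106243325567709273566494690709934450182857529422462211962175623330550909727731416110640497368210337331358548110128361746,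 13122455684697457250779966485270060821456073700285454243354724214695429850534884992581598731764740235852893558504607307220922943533688447027, 131831709184352944092120074354442074372792952429171281633349318216020005245998955923906756454325777182530865470344772310077929980612126433437, 203340600988105481144812537568274313644702312082849019315621913231713778074928877045050232921570641161094934222017322486589713843725261677823, 180954013352883053341990761951867955310759699554969459937304809461843398949429710870820065901546195681797244907940307222329943924910127818121, 479463907103354486439412734197311453447077475558019774719509137449820288169015953517145732246580312246020850810491232430344923245552361234469, 3492119438895722992481703886563744152762802775882263503465528494409277834879349276445328505520522630256049535146488933123835679275905788041, 108014289052322389439340398630364891899699161874455850438564854942125435842923130988778435411991175363702862041967074487338112633506313185177, 4745389204270922825027913105191751165232961118021976043223949035658296520928741178936477234159850005869806603178480406488857846411346043037, 3453926456497103875806242342048578640169132481981130897393639999886438092141361460901510761290939088301173649441353484164470647514437952327, 14421901484265269265524547656830475082994560612722925856896432652773017702543543681076792634407036840738384423271764973642417933250253136521, 9964129941475258788664166301576278015964242535228894899370374311850304583734969444149815483950102574715183954995943717710821637789077987453, 201059331900736202400715616539539925198866298427925455845532329505564675166866541420505518319297414438022407861090715570868481309234772664429, 174366633980815608838087608989795778005521665465206691025581934422255512178925215525495165860365619622416964974943974966580892114609660404082,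 201071041870580012125150621050903956814297087552899800001991966059039070465506996454772987020357796135360987404398073414263386705437093744730, 177236468698832010917761388217208449513380835635414367800758181924929480258582567228266163070136783987677438559820595507312566872855630176881, 9956021224603262772400548489347380013520763793640950990440119117340513868699555149717239837996850053085898814354072789374380180839030760306, 81325792297116920700097512179758583449458269813622194745354483672800291945423880110185938524140864899830616590806549764528066062815375237482, 56452122678865130067776889547636682816764385628108077067245041343491275059143538760843705977603117606309142116068365276994123564453815407, 47730057987317847870400332026672741584946464486486165854392950839756249477230194646187656600597457907153466226131145798720301707017949198, 7923382606084889424062264117249948921329805015765817706823939857988189167470543759246347634185022550781662270474778076864027611890620911630, 33683899349079556989333869258473587025207371]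
theorem s6 : Dead 23 9 0 2 12 8 1 := dead_of ps6 ks6 (by decide +kernel) (by decide +kernel)
end Eng

namespace Eng
open Finset
section
variable {R : ℕ → ℕ → Prop}

theorem cfacts (F : Free R) (T : Finset ℕ) (hT : ∀ t ∈ T, 2 ≤ (nb R T t).card ∧ (nb R T t).card ≤ 6) :
    T.card = cnt R T 2 + cnt R T 3 + cnt R T 4 + cnt R T 5 + cnt R T 6 ∧
    ∑ t ∈ T, (nb R T t).card = 2 * cnt R T 2 + 3 * cnt R T 3 + 4 * cnt R T 4 + 5 * cnt R T 5 + 6 * cnt R T 6 ∧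
    4 * cnt R T 2 + 9 * cnt R T 3 + 16 * cnt R T 4 + 25 * cnt R T 5 + 36 * cnt R T 6 ≤ T.card * (T.card - 1) := by
  have h1 := counts T hT (fun _ => 1)
  have h2 := counts T hT (fun d => d)
  have h3 := counts T hT (fun d => d ^ 2)
  have h4 := moore F T
  simp only [Finset.sum_const, smul_eq_mul, mul_one] at h1 h2 h3
  refine ⟨by omega, by omega, ?_⟩
  rw [h3] at h4
  omega

theorem FA8 : FA 8 := by intro m h1 h2; omega

theorem FBm (m b : ℕ) (h : m * (m * (m - 1)) < (2 * (b + 1)) ^ 2) : FB m b := by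
  intro R F T hT
  have h1 := moore2 F T
  obtain ⟨E, hE⟩ := even_sum F T
  rw [hT, hE] at h1
  rw [hE]
  by_contra hc
  have : (2 * (b + 1)) ^ 2 ≤ (2 * E) ^ 2 := Nat.pow_le_pow_left (by omega) 2
  omega

theorem FBs {m b b' : ℕ} (hb : FB m b) (H : ∀ R, Free R → ∀ T : Finset ℕ, T.card = m + 1 → ∀ E, b' < E →
    ∑ t ∈ T, (nb R T t).card = 2 * E → (∀ t ∈ T, E - b ≤ (nb R T t).card) →
      (m + 1) * (E - b) ≤ 2 * E → (∀ t ∈ T, (nb R T t).card * (E - b) ≤ m) → False) : FB (m + 1) b' := by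
  intro R F T hT
  obtain ⟨E, h1, h2, h3, h4⟩ := basic hb F hT
  rw [h1]
  by_contra hc
  exact H R F T hT E (by omega) h1 h2 h3 h4

theorem FA11 : FA 11 := by
  refine FA_succ (FA_succ (FA_succ FA8 fun _ => ?_) fun _ => ?_) fun _ => ?_
  · exact FBm 8 10 (by norm_num)
  · exact FBm 9 12 (by norm_num)
  · exact FBm 10 15 (by norm_num)

theorem FA12 : FA 12 := by
  refine FA_succ FA11 fun hA => FBs (hA 10 (by norm_num) (by norm_num)) ?_
  intro R F T hT E hE h1 h2 h3 h4
  have hm := moore2 F T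
  change 16 < E at hE
  change ∀ t ∈ T, E - 15 ≤ _ at h2
  change ∀ t ∈ T, _ * (E - 15) ≤ 10 at h4
  rw [hT, h1] at hm
  have : E = 17 := by
    by_contra h
    have : (2 * 18) ^ 2 ≤ (2 * E) ^ 2 := Nat.pow_le_pow_left (by omega) 2
    omega
  subst this
  have hd : ∀ t ∈ T, 2 ≤ (nb R T t).card ∧ (nb R T t).card ≤ 5 := fun t ht => by
    have := h2 t ht; have := h4 t ht; omega
  have hd6 : ∀ t ∈ T, 2 ≤ (nb R T t).card ∧ (nb R T t).card ≤ 6 := fun t ht => by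
    have := hd t ht; omega
  have c6 : cnt R T 6 = 0 := cnt_zero fun t ht => by have := hd t ht; omega
  obtain ⟨f1, f2, f3⟩ := cfacts F T hd6
  have key : ∀ c2 c3 c4 c5 : ℕ, Dead 11 9 c2 c3 c4 c5 0 → cnt R T 2 = c2 → cnt R T 3 = c3 → cnt R T 4 = c4 →
    cnt R T 5 = c5 → False := fun c2 c3 c4 c5 h e2 e3 e4 e5 => h hA R F T hd6 e2 e3 e4 e5 c6 (NS9 R T)
  rw [hT] at f1 f3
  rw [h1] at f2
  have g5 : cnt R T 5 = 0 ∨ cnt R T 5 = 1 := by omega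
  have g4 : cnt R T 4 = 0 ∨ cnt R T 4 = 1 ∨ cnt R T 4 = 2 ∨ cnt R T 4 = 3 := by omega
  rcases (by rcases g5 with g5 | g5 <;> rcases g4 with g4 | g4 | g4 | g4 <;> omega : cnt R T 4 = 1 ∧ cnt R T 2 = 0 ∧ cnt R T 5 = 0 ∧ cnt R T 3 = 10 ∨
    cnt R T 4 = 2 ∧ cnt R T 2 = 1 ∧ cnt R T 5 = 0 ∧ cnt R T 3 = 8 ∨
    cnt R T 4 = 3 ∧ cnt R T 2 = 2 ∧ cnt R T 5 = 0 ∧ cnt R T 3 = 6 ∨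
    cnt R T 4 = 0 ∧ cnt R T 2 = 1 ∧ cnt R T 5 = 1 ∧ cnt R T 3 = 9) with h | h | h | h
  · exact key _ _ _ _ z0_10_1_0_0 h.2.1 h.2.2.2 h.1 h.2.2.1
  · exact key _ _ _ _ z1_8_2_0_0 h.2.1 h.2.2.2 h.1 h.2.2.1
  · exact key _ _ _ _ z2_6_3_0_0 h.2.1 h.2.2.2 h.1 h.2.2.1
  · exact key _ _ _ _ z1_9_0_1_0 h.2.1 h.2.2.2 h.1 h.2.2.1

/-- all degrees equal -/
theorem reg {m E hi : ℕ} {T : Finset ℕ} (hT : T.card = m) (h1 : ∑ t ∈ T, (nb R T t).card = 2 * E)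
    (h : ∀ t ∈ T, (nb R T t).card ≤ hi) : 2 * E ≤ m * hi := by
  rw [← h1, ← hT, ← smul_eq_mul]
  exact Finset.sum_le_card_nsmul _ _ _ h

theorem FA14 : FA 14 := by
  refine FA_succ (FA_succ FA12 fun hA => FBs (hA 11 (by norm_num) (by norm_num)) ?_) fun hA =>
    FBs (hA 12 (by norm_num) (by norm_num)) ?_
  · intro R F T hT E hE h1 h2 h3 h4
    change 18 < E at hE
    change _ * (E - 16) ≤ _ at h3
    change ∀ t ∈ T, _ * (E - 16) ≤ 11 at h4
    have : E = 19 := by omega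
    subst this
    have := reg (hi := 3) hT h1 (fun t ht => by have := h4 t ht; omega)
    omega
  · intro R F T hT E hE h1 h2 h3 h4
    change 21 < E at hE
    change _ * (E - 18) ≤ _ at h3
    omega

/-- the situation after fixing the range of degrees -/
theorem rng {n tau : ℕ} (hA : FA n) (F : Free R) {T : Finset ℕ} (hT : T.card = n) {E hi lo : ℕ}
    (h1 : ∑ t ∈ T, (nb R T t).card = 2 * E) (hd : ∀ t ∈ T, lo ≤ (nb R T t).card ∧ (nb R T t).card ≤ hi) (hlo : 2 ≤ lo)
    (hhi : hi ≤ 6) (hn : NS R T tau)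
    (H : ∀ c2 c3 c4 c5 c6, n = c2 + c3 + c4 + c5 + c6 → 2 * E = 2 * c2 + 3 * c3 + 4 * c4 + 5 * c5 + 6 * c6 →
      (2 < lo → c2 = 0) → (3 < lo → c3 = 0) → (hi < 5 → c5 = 0) → (hi < 6 → c6 = 0) → 
      ¬ Dead n tau c2 c3 c4 c5 c6 → False) : False := by
  have hd6 : ∀ t ∈ T, 2 ≤ (nb R T t).card ∧ (nb R T t).card ≤ 6 := fun t ht => by
    have := hd t ht; omega
  obtain ⟨f1, f2, f3⟩ := cfacts F T hd6
  have z : ∀ c, (c < lo ∨ hi < c) → cnt R T c = 0 := fun c hc => cnt_zero fun t ht => by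
    have := hd t ht; omega
  exact H _ _ _ _ _ (hT.symm.trans f1) (h1.symm.trans f2) (fun h => z 2 (.inl h)) (fun h => z 3 (.inl h))
    (fun h => z 5 (.inr h)) (fun h => z 6 (.inr h)) fun hD => hD hA R F T hd6 rfl rfl rfl rfl rfl hn

theorem FA16 : FA 16 := by
  refine FA_succ (FA_succ FA14 fun hA => FBs (hA 13 (by norm_num) (by norm_num)) ?_) fun hA =>
    FBs (hA 14 (by norm_num) (by norm_num)) ?_
  · intro R F T hT E hE h1 h2 h3 h4
    change 23 < E at hE
    change _ * (E - 21) ≤ _ at h3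
    change ∀ t ∈ T, _ * (E - 21) ≤ 13 at h4
    change ∀ t ∈ T, E - 21 ≤ _ at h2
    have : E = 24 := by omega
    subst this
    refine rng (lo := 3) (hi := 4) hA F hT h1 (fun t ht => ⟨h2 t ht, by have := h4 t ht; omega⟩)
      (by norm_num) (by norm_num) (NS9 R T) ?_
    intro c2 c3 c4 c5 c6 a1 a2 a3 a4 a5 a6 a7
    have b2 := a3 (by norm_num)
    have b5 := a5 (by norm_num)
    have b6 := a6 (by norm_num)
    obtain ⟨rfl, rfl⟩ : c4 = 6 ∧ c3 = 8 := by omega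
    subst b2 b5 b6
    exact a7 z0_8_6_0_0
  · intro R F T hT E hE h1 h2 h3 h4
    change 26 < E at hE
    change _ * (E - 23) ≤ _ at h3
    omega

theorem FA20 : FA 20 := by
  refine FA_succ (FA_succ (FA_succ (FA_succ FA16 fun hA => FBs (hA 15 (by norm_num) (by norm_num)) ?_) fun hA =>
    FBs (hA 16 (by norm_num) (by norm_num)) ?_) fun hA => FBs (hA 17 (by norm_num) (by norm_num)) ?_) fun hA =>
    FBs (hA 18 (by norm_num) (by norm_num)) ?_
  · intro R F T hT E hE h1 h2 h3 h4
    change 28 < E at hE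
    change _ * (E - 26) ≤ _ at h3
    change ∀ t ∈ T, _ * (E - 26) ≤ 15 at h4
    change ∀ t ∈ T, E - 26 ≤ _ at h2
    have : E = 29 := by omega
    subst this
    refine rng (lo := 3) (hi := 5) hA F hT h1 (fun t ht => ⟨h2 t ht, by have := h4 t ht; omega⟩)
      (by norm_num) (by norm_num) (NS9 R T) ?_
    intro c2 c3 c4 c5 c6 a1 a2 a3 a4 a5 a6 a7
    have b2 := a3 (by norm_num)
    have b6 := a6 (by norm_num)
    subst b2 b6
    have h5 : c5 ≤ 5 := by omega
    obtain rfl : c4 = 10 - 2 * c5 := by omega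
    obtain rfl : c3 = 6 + c5 := by omega
    interval_cases c5
    · exact a7 z0_6_10_0_0
    · exact a7 z0_7_8_1_0
    · exact a7 z0_8_6_2_0
    · exact a7 z0_9_4_3_0
    · exact a7 z0_10_2_4_0
    · exact a7 z0_11_0_5_0
  · intro R F T hT E hE h1 h2 h3 h4
    change 31 < E at hE
    change _ * (E - 28) ≤ _ at h3
    omega
  · intro R F T hT E hE h1 h2 h3 h4
    change 34 < E at hE
    change _ * (E - 31) ≤ _ at h3
    omega
  · intro R F T hT E hE h1 h2 h3 h4
    change 38 < E at hE
    change _ * (E - 34) ≤ _ at h3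
    omega

theorem FA23 : FA 23 := by
  refine FA_succ (FA_succ (FA_succ FA20 fun hA => FBs (hA 19 (by norm_num) (by norm_num)) ?_) fun hA =>
    FBs (hA 20 (by norm_num) (by norm_num)) ?_) fun hA => FBs (hA 21 (by norm_num) (by norm_num)) ?_
  · intro R F T hT E hE h1 h2 h3 h4
    change 41 < E at hE
    change _ * (E - 38) ≤ _ at h3
    change ∀ t ∈ T, _ * (E - 38) ≤ 19 at h4
    have : E = 42 := by omega
    subst this
    have := reg (hi := 4) hT h1 (fun t ht => by have := h4 t ht; omega)
    omega
  · intro R F T hT E hE h1 h2 h3 h4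
    change 44 < E at hE
    change _ * (E - 41) ≤ _ at h3
    change ∀ t ∈ T, _ * (E - 41) ≤ 20 at h4
    change ∀ t ∈ T, E - 41 ≤ _ at h2
    have : E = 45 := by omega
    subst this
    refine rng (lo := 4) (hi := 5) hA F hT h1 (fun t ht => ⟨h2 t ht, by have := h4 t ht; omega⟩)
      (by norm_num) (by norm_num) (NS9 R T) ?_
    intro c2 c3 c4 c5 c6 a1 a2 a3 a4 a5 a6 a7
    have b2 := a3 (by norm_num)
    have b3 := a4 (by norm_num)
    have b6 := a6 (by norm_num)
    obtain ⟨rfl, rfl⟩ : c4 = 15 ∧ c5 = 6 := by omega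
    subst b2 b3 b6
    exact a7 z0_0_15_6_0
  · intro R F T hT E hE h1 h2 h3 h4
    change 47 < E at hE
    change _ * (E - 44) ≤ _ at h3
    change ∀ t ∈ T, _ * (E - 44) ≤ 21 at h4
    change ∀ t ∈ T, E - 44 ≤ _ at h2
    have : E = 48 := by omega
    subst this
    refine rng (lo := 4) (hi := 5) hA F hT h1 (fun t ht => ⟨h2 t ht, by have := h4 t ht; omega⟩)
      (by norm_num) (by norm_num) (NS9 R T) ?_
    intro c2 c3 c4 c5 c6 a1 a2 a3 a4 a5 a6 a7
    have b2 := a3 (by norm_num)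
    have b3 := a4 (by norm_num)
    have b6 := a6 (by norm_num)
    obtain ⟨rfl, rfl⟩ : c4 = 14 ∧ c5 = 8 := by omega
    subst b2 b3 b6
    exact a7 z0_0_14_8_0

end
end Eng

namespace Eng
open Finset
section
variable {R : ℕ → ℕ → Prop}

theorem c3_le (F : Free R) {T : Finset ℕ} (hT : T.card = 23) (h1 : ∑ t ∈ T, (nb R T t).card = 2 * 50) :
    cnt R T 3 ≤ 4 := by
  by_contra hc
  obtain ⟨S, hS, hS5⟩ := Finset.exists_subset_card_eq (show 5 ≤ (T.filter (fun t => (nb R T t).card = 3)).card by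
    change 5 ≤ cnt R T 3; omega)
  have hST : S ⊆ T := hS.trans (Finset.filter_subset _ _)
  have h2 := del F T S hST
  have h3 := FA23 18 (by norm_num) (by norm_num) R F (T \ S) (by rw [Finset.card_sdiff_of_subset hST]; omega)
  change _ ≤ 2 * 34 at h3
  have h4 : ∑ i ∈ S, (nb R T i).card = ∑ i ∈ S, 3 :=
    Finset.sum_congr rfl fun i hi => (Finset.mem_filter.1 (hS hi)).2
  rw [Finset.sum_const, hS5, smul_eq_mul] at h4
  omega

theorem nb_low (F : Free R) {T : Finset ℕ} (hd : ∀ t ∈ T, 3 ≤ (nb R T t).card) {v : ℕ} (hv : v ∈ T) :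
    4 * (nb R T v).card < T.card + cnt R T 3 := by
  have h := nbr_sumF F T hv
  have h2 : ∑ y ∈ nb R T v, 4 ≤ ∑ y ∈ nb R T v, ((nb R T y).card + if (nb R T y).card = 3 then 1 else 0) := by
    apply Finset.sum_le_sum
    intro y hy
    have := hd y (mem_nb.1 hy).1
    split <;> omega
  rw [Finset.sum_add_distrib, Finset.sum_const, smul_eq_mul, ← Finset.card_filter] at h2
  have h3 : ((nb R T v).filter (fun y => (nb R T y).card = 3)).card ≤ cnt R T 3 :=
    Finset.card_le_card (Finset.filter_subset_filter _ fun y hy => (mem_nb.1 hy).1)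
  omega

theorem core (F : Free R) {T : Finset ℕ} (hT : T.card = 23) (h1 : ∑ t ∈ T, (nb R T t).card = 2 * 50) :
    (∀ t ∈ T, 3 ≤ (nb R T t).card ∧ (nb R T t).card ≤ 5) ∧
    ((∃ t ∈ T, (nb R T t).card = 3) ∧ ¬ NS R T 1 ∨ (∀ t ∈ T, 4 ≤ (nb R T t).card) ∧ ¬ NS R T 0) := by
  have hlo : ∀ t ∈ T, 3 ≤ (nb R T t).card := by
    intro t ht
    have := del1 (FA23 22 (by norm_num) (by norm_num)) F hT ht
    change _ ≤ 2 * 47 + _ at this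
    omega
  have hc := c3_le F hT h1
  have hnl := fun v (hv : v ∈ T) => nb_low F hlo hv
  have hd6 : ∀ t ∈ T, 2 ≤ (nb R T t).card ∧ (nb R T t).card ≤ 6 := fun t ht => by
    have := hlo t ht; have := hnl t ht; omega
  have key : ∀ tau, NS R T tau → ∀ c3 c4 c5 c6 : ℕ, Dead 23 tau 0 c3 c4 c5 c6 → cnt R T 3 = c3 → cnt R T 4 = c4 →
    cnt R T 5 = c5 → cnt R T 6 = c6 → False := fun tau hn c3 c4 c5 c6 h e3 e4 e5 e6 =>
      h FA23 R F T hd6 (cnt_zero fun t ht => by have := hlo t ht; omega) e3 e4 e5 e6 hn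
  obtain ⟨f1, f2, -⟩ := cfacts F T hd6
  have c2 : cnt R T 2 = 0 := cnt_zero fun t ht => by have := hlo t ht; omega
  rw [hT, c2] at f1
  rw [h1, c2] at f2
  have h6 : cnt R T 6 = 0 := by
    by_contra h6
    have hp : 0 < cnt R T 6 := by omega
    obtain ⟨v, hv⟩ := Finset.card_pos.1 hp
    rw [Finset.mem_filter] at hv
    have hv2 := hnl v hv.1
    rw [hv.2, hT] at hv2
    have key9 := key 9 (NS9 R T)
    have e4 : cnt R T 4 = 15 - 2 * cnt R T 3 + cnt R T 6 := by omega
    have e5 : cnt R T 5 = 8 + cnt R T 3 - 2 * cnt R T 6 := by omega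
    have e6 : cnt R T 6 ≤ 6 := by omega
    have key9 := fun h => key9 _ _ _ _ h rfl e4 e5 rfl
    have h26 : 2 * cnt R T 6 ≤ 8 + cnt R T 3 := by omega
    generalize cnt R T 3 = c3 at *
    generalize cnt R T 6 = c6 at *
    clear hnl key e4 e5 f1 f2 hlo hd6 h1
    have h3 : 2 ≤ c3 := by omega
    interval_cases c3
    · interval_cases c6
      · exact key9 s6
      · exact key9 z0_2_13_6_2
      · exact key9 z0_2_14_4_3
      · exact key9 z0_2_15_2_4
      · exact key9 z0_2_16_0_5
      · omega
    · interval_cases c6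
      · exact key9 z0_3_10_9_1
      · exact key9 z0_3_11_7_2
      · exact key9 z0_3_12_5_3
      · exact key9 z0_3_13_3_4
      · exact key9 z0_3_14_1_5
      · omega
    · interval_cases c6
      · exact key9 z0_4_8_10_1
      · exact key9 z0_4_9_8_2
      · exact key9 z0_4_10_6_3
      · exact key9 z0_4_11_4_4
      · exact key9 z0_4_12_2_5
      · exact key9 z0_4_13_0_6
  have e4 : cnt R T 4 = 15 - 2 * cnt R T 3 := by omega
  have e5 : cnt R T 5 = 8 + cnt R T 3 := by omega
  refine ⟨fun t ht => ⟨hlo t ht, ?_⟩, ?_⟩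
  · have h := Finset.card_eq_zero.1 h6
    rw [Finset.filter_eq_empty_iff] at h
    have := h ht
    have := hd6 t ht
    omega
  · by_cases h3 : cnt R T 3 = 0
    · right
      have h := Finset.card_eq_zero.1 h3
      rw [Finset.filter_eq_empty_iff] at h
      refine ⟨fun t ht => ?_, fun hn => ?_⟩
      · have := h ht
        have := hlo t ht
        omega
      · rw [h3] at e4 e5
        exact key 0 hn _ _ _ _ a0 h3 e4 e5 h6
    · left
      have hp : 0 < cnt R T 3 := by omega
      obtain ⟨v, hv⟩ := Finset.card_pos.1 hp
      rw [Finset.mem_filter] at hv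
      refine ⟨⟨v, hv.1, hv.2⟩, fun hn => ?_⟩
      have key9 := fun h => key 1 hn _ _ _ _ h rfl e4 e5 h6
      clear hnl key e4 e5 f1 f2
      generalize cnt R T 3 = c3 at *
      interval_cases c3
      · exact key9 a1
      · exact key9 a2
      · exact key9 a3
      · exact key9 a4

theorem not_NS {T : Finset ℕ} {tau : ℕ} (h : ¬ NS R T tau) : ∃ i ∈ T, (nb R T i).card = 5 ∧
    (∀ j ∈ nb R T i, 4 ≤ (nb R T j).card) ∧ tau < ((nb R T i).filter (fun j => 5 ≤ (nb R T j).card)).card := by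
  unfold NS at h
  push Not at h
  obtain ⟨i, h1, h2, h3, h4⟩ := h
  exact ⟨i, h1, h2, h3, h4⟩

end
end Eng

namespace Eng
section
variable {V : Type*} {G : SimpleGraph V}

theorem no_tri (hg : GirthAtLeast5 G) {a b c : V} (h1 : G.Adj a b) (h2 : G.Adj b c) (h3 : G.Adj a c) : False := by
  have := hg (Walk.cons h1 (Walk.cons h2 (Walk.cons h3.symm Walk.nil))) (by
    rw [Walk.cons_isCycle_iff]
    have := h1.ne; have := h2.ne; have := h3.ne
    simp_all [Walk.isPath_def, Ne.symm])
  simp at this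

theorem no_c4 (hg : GirthAtLeast5 G) {a b x y : V} (h1 : G.Adj a x) (h2 : G.Adj a y) (h3 : G.Adj b x) (h4 : G.Adj b y)
    (hxy : x ≠ y) : a = b := by
  by_contra hab
  have := hg (Walk.cons h1 (Walk.cons h3.symm (Walk.cons h4 (Walk.cons h2.symm Walk.nil)))) (by
    rw [Walk.cons_isCycle_iff]
    have := h1.ne; have := h2.ne; have := h3.ne; have := h4.ne
    have := h1.ne'; have := h2.ne'; have := h3.ne'; have := h4.ne'
    have := hxy.symm
    have := Ne.symm hab
    simp_all [Walk.isPath_def])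
  simp at this

theorem star [Fintype V] [DecidableEq V] [DecidableRel G.Adj] {x y0 y1 : V} {e0 e1 : ℕ} (hx : G.degree x = 5) (h0 : G.Adj x y0)
    (h1 : G.Adj x y1) (h01 : y0 ≠ y1) (d0 : e0 + 1 ≤ G.degree y0) (d1 : e1 + 1 ≤ G.degree y1)
    (hd : ∀ y, G.Adj x y → 4 ≤ G.degree y) : HasEmbeddedStar G 5 ![e0, e1, 3, 3, 3] := by
  have hc : (((G.neighborFinset x).erase y0).erase y1).card = 3 := by
    rw [Finset.card_erase_of_mem (by simp [h1, h01.symm]), Finset.card_erase_of_mem (by simp [h0]), card_neighborFinset_eq_degree, hx]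
  obtain ⟨a, b, c, hab, hac, hbc, he⟩ := Finset.card_eq_three.1 hc
  have hm : ∀ z, z ∈ ({a, b, c} : Finset V) → z ≠ y1 ∧ z ≠ y0 ∧ G.Adj x z := by
    intro z hz
    rw [← he] at hz
    simpa using hz
  obtain ⟨a1, a2, a3⟩ := hm a (by simp)
  obtain ⟨b1, b2, b3⟩ := hm b (by simp)
  obtain ⟨c1, c2, c3⟩ := hm c (by simp)
  refine ⟨x, ![y0, y1, a, b, c], hx, ?_, ?_, ?_⟩
  · intro i j h
    fin_cases i <;> fin_cases j <;> first | rfl | (exfalso; simp at h; first | exact absurd h (by assumption) | exact absurd h.symm (by assumption))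
  · intro i; fin_cases i <;> simp <;> assumption
  · intro i; fin_cases i
    · exact d0
    · exact d1
    · exact hd a a3
    · exact hd b b3
    · exact hd c c3

end

def RR (G : SimpleGraph (Fin 23)) (i j : ℕ) : Prop := ∃ (a b : Fin 23), a.1 = i ∧ b.1 = j ∧ G.Adj a b

theorem RR_iff {G : SimpleGraph (Fin 23)} (a b : Fin 23) : RR G a.1 b.1 ↔ G.Adj a b := by
  constructor
  · rintro ⟨c, d, h1, h2, h⟩
    obtain rfl := Fin.ext h1
    obtain rfl := Fin.ext h2
    exact h
  · intro h; exact ⟨a, b, rfl, rfl, h⟩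

theorem RR_free {G : SimpleGraph (Fin 23)} (hg : GirthAtLeast5 G) : Free (RR G) where
  sym := by rintro i j ⟨a, b, rfl, rfl, h⟩; exact ⟨b, a, rfl, rfl, h.symm⟩
  irr := by
    rintro i ⟨a, b, rfl, h1, h⟩
    obtain rfl := Fin.ext h1
    exact G.irrefl h
  tri := by
    rintro i j k ⟨a, b, rfl, rfl, h⟩ ⟨b', c, h1, rfl, h'⟩ h''
    obtain rfl := Fin.ext h1
    exact no_tri hg h h' ((RR_iff _ _).1 h'')
  c4 := by
    rintro i j x y ⟨a, x, rfl, rfl, h1⟩ ⟨a', y, h2, rfl, h3⟩ ⟨b, x', rfl, h4, h5⟩ h6 hxy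
    obtain rfl := Fin.ext h2
    obtain rfl := Fin.ext h4
    exact congrArg _ (no_c4 hg h1 h3 h5 ((RR_iff _ _).1 h6) fun h => hxy (congrArg _ h))

theorem RR_nb (G : SimpleGraph (Fin 23)) [DecidableRel G.Adj] (a : Fin 23) :
    nb (RR G) (Finset.range 23) a.1 = (G.neighborFinset a).map Fin.valEmbedding := by
  ext j
  simp only [mem_nb, Finset.mem_range, Finset.mem_map, mem_neighborFinset, Fin.valEmbedding_apply]
  constructor
  · rintro ⟨hj, h⟩
    exact ⟨⟨j, hj⟩, (RR_iff a ⟨j, hj⟩).1 h, rfl⟩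
  · rintro ⟨b, h, rfl⟩
    exact ⟨b.2, (RR_iff _ _).2 h⟩

theorem RR_deg (G : SimpleGraph (Fin 23)) [DecidableRel G.Adj] (a : Fin 23) :
    (nb (RR G) (Finset.range 23) a.1).card = G.degree a := by
  rw [RR_nb, Finset.card_map, card_neighborFinset_eq_degree]

theorem RR_sum (G : SimpleGraph (Fin 23)) [DecidableRel G.Adj] (he : G.edgeFinset.card = 50) :
    ∑ t ∈ Finset.range 23, (nb (RR G) (Finset.range 23) t).card = 2 * 50 := by
  rw [Finset.sum_range, ← he, ← G.sum_degrees_eq_twice_card_edges]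
  exact Finset.sum_congr rfl fun a _ => RR_deg G a

theorem ns_fin (G : SimpleGraph (Fin 23)) [DecidableRel G.Adj] {tau : ℕ} (h : ¬ NS (RR G) (Finset.range 23) tau) :
    ∃ x, G.degree x = 5 ∧ (∀ y, G.Adj x y → 4 ≤ G.degree y) ∧
      tau < ((G.neighborFinset x).filter (fun y => 5 ≤ G.degree y)).card := by
  obtain ⟨i, h1, h2, h3, h4⟩ := not_NS h
  rw [Finset.mem_range] at h1
  obtain ⟨x, rfl⟩ : ∃ x : Fin 23, x.1 = i := ⟨⟨i, h1⟩, rfl⟩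
  rw [RR_deg] at h2
  refine ⟨x, h2, ?_, ?_⟩
  · intro y hy
    rw [← RR_deg]
    apply h3
    rw [RR_nb]
    exact Finset.mem_map.2 ⟨y, by simpa using hy, rfl⟩
  · refine lt_of_lt_of_eq h4 ?_
    conv_lhs => rw [RR_nb G x, Finset.filter_map, Finset.card_map]
    congr 1
    ext y
    simp only [Finset.mem_filter, Function.comp, Fin.valEmbedding_apply, RR_deg]

theorem min_eq (G : SimpleGraph (Fin 23)) [DecidableRel G.Adj] {k : ℕ} (h : ∀ v, k ≤ G.degree v) (v : Fin 23)
    (hv : G.degree v ≤ k) : G.minDegree = k :=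
  le_antisymm ((G.minDegree_le_degree v).trans hv) (G.le_minDegree_of_forall_le_degree k h)

theorem max_eq (G : SimpleGraph (Fin 23)) [DecidableRel G.Adj] {k : ℕ} (h : ∀ v, G.degree v ≤ k) (v : Fin 23)
    (hv : k ≤ G.degree v) : G.maxDegree = k :=
  le_antisymm (G.maxDegree_le_of_forall_degree_le k h) (hv.trans (G.degree_le_maxDegree v))

end Eng

theorem stmt10 (G : SimpleGraph (Fin 23)) [DecidableRel G.Adj]
    (hg : GirthAtLeast5 G) (he : G.edgeFinset.card = 50) :
    ((G.minDegree, G.maxDegree) = (3, 5) ∧ HasEmbeddedStar G 5 ![4, 4, 3, 3, 3]) ∨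
    ((G.minDegree, G.maxDegree) = (4, 5) ∧
      (HasEmbeddedStar G 5 ![4, 4, 3, 3, 3] ∨ HasEmbeddedStar G 5 ![4, 3, 3, 3, 3])) := by
  obtain ⟨hd, hc⟩ := Eng.core (Eng.RR_free hg) (Finset.card_range 23) (Eng.RR_sum G he)
  have hd1 : ∀ v, 3 ≤ G.degree v ∧ G.degree v ≤ 5 := fun v => by
    rw [← Eng.RR_deg]; exact hd v.1 (Finset.mem_range.2 v.2)
  rcases hc with ⟨⟨t, ht, h3⟩, hn⟩ | ⟨h4, hn⟩
  · left
    obtain ⟨x, hx, hy, hk⟩ := Eng.ns_fin G hn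
    rw [Finset.mem_range] at ht
    obtain ⟨v, rfl⟩ : ∃ v : Fin 23, v.1 = t := ⟨⟨t, ht⟩, rfl⟩
    rw [Eng.RR_deg] at h3
    refine ⟨?_, ?_⟩
    · rw [Eng.min_eq G (fun v => (hd1 v).1) v h3.le, Eng.max_eq G (fun v => (hd1 v).2) x hx.ge]
    · obtain ⟨y0, m0, y1, m1, h01⟩ := Finset.one_lt_card.1 hk
      rw [Finset.mem_filter, mem_neighborFinset] at m0 m1
      exact Eng.star hx m0.1 m1.1 h01 m0.2 m1.2 hy
  · right
    obtain ⟨x, hx, hy, hk⟩ := Eng.ns_fin G hn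
    have h4' : ∀ v, 4 ≤ G.degree v := fun v => by
      rw [← Eng.RR_deg]; exact h4 v.1 (Finset.mem_range.2 v.2)
    refine ⟨?_, Or.inr ?_⟩
    · have hv : ∃ v, G.degree v ≤ 4 := by
        by_contra hv
        push Not at hv
        have h1 := G.sum_degrees_eq_twice_card_edges
        rw [he] at h1
        have h2 : ∑ v : Fin 23, 5 ≤ ∑ v, G.degree v := Finset.sum_le_sum fun v _ => hv v
        rw [h1] at h2
        simp at h2
      obtain ⟨v, hv⟩ := hv
      rw [Eng.min_eq G h4' v hv, Eng.max_eq G (fun v => (hd1 v).2) x hx.ge]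
    · obtain ⟨y0, m0⟩ := Finset.card_pos.1 hk
      rw [Finset.mem_filter, mem_neighborFinset] at m0
      have : 0 < ((G.neighborFinset x).erase y0).card := by
        rw [Finset.card_erase_of_mem (by simpa using m0.1), card_neighborFinset_eq_degree, hx]; norm_num
      obtain ⟨y1, m1⟩ := Finset.card_pos.1 this
      rw [Finset.mem_erase, mem_neighborFinset] at m1
      exact Eng.star hx m0.1 m1.2 (Ne.symm m1.1) m0.2 (hy _ m1.2) hy
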